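/- arXiv:2503.16830 — 2 statements merged into one kernel-verified Lean document; each statement's English description precedes it below -/
import Mathlib

section
/- Let K be a local field of characteristic p > 0 with perfect residue field and let a = (a_0, …, a_{n-1}) ∈ W_n(K) be a reduced Witt vector; set m_i = -v_K(a_i). Assume m_0 = 0 and a_0 ∉ ℘(K) = {c^p - c : c ∈ K}. Let 1 ≤ r ≤ n be maximal such that m_i ≤ 0 for all 0 ≤ i < r, and let K_n = K[a]. Then K_n/K is a (Z/p^nZ)-extension with residue class degree p^r and ramification index p^{n-r}, and its positive upper ramification breaks are u_1, …, u_{n-r}, where u_i = max{p^{i-1} m_r, p^{i-2} m_{r+1}, …, p m_{r+i-2}, m_{r+i-1}}. -/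
noncomputable section

open scoped Classical

/-- The normalized valuation on `k((t))`: `v(x)` is the order of vanishing of `x`,
with `v(0) = ∞`. -/
def lsVal {k : Type*} [Field k] (x : LaurentSeries k) : WithTop ℤ :=
  if x = 0 then ⊤ else (x.order : WithTop ℤ)

/-- The normalized valuation `v_K` on a local field `K` presented by an isomorphism
`ι : K ≃ k((t))`. -/
def lfVal {K k : Type*} [Field K] [Field k] (ι : K ≃+* LaurentSeries k) (x : K) :
    WithTop ℤ :=
  lsVal (ι x)

/-- `v : L → ℤ ∪ {∞}` is a normalized discrete valuation on the field `L`: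
`v x = ∞` iff `x = 0`, `v` is multiplicative, satisfies the ultrametric
inequality, and `v(L^×) = ℤ` (there is a uniformizer of valuation `1`). -/
def IsNormVal {L : Type*} [Field L] (v : L → WithTop ℤ) : Prop :=
  (∀ x, v x = ⊤ ↔ x = 0) ∧
  (∀ x y, v (x * y) = v x + v y) ∧
  (∀ x y, min (v x) (v y) ≤ v (x + y)) ∧
  (∃ π, v π = (1 : ℤ))

/-- The valuation `v` on `L` restricts on `K` to `e` times the normalized valuation
`vK` of `K`; thus `e = e_{L/K}` is the ramification index of `L/K`. -/
def ExtendsWithE {K L : Type*} [Field K] [Field L] [Algebra K L]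
    (vK : K → WithTop ℤ) (v : L → WithTop ℤ) (e : ℕ) : Prop :=
  ∀ (x : K) (z : ℤ), vK x = (z : WithTop ℤ) →
    v (algebraMap K L x) = (((e : ℤ) * z : ℤ) : WithTop ℤ)

/-- `σ` lies in the inertia subgroup `G_0` of `Gal(L/F)`: `σ` induces the identity
on the residue field. -/
def InInertia {F L : Type*} [Field F] [Field L] [Algebra F L]
    (v : L → WithTop ℤ) (σ : L ≃ₐ[F] L) : Prop :=
  ∀ x : L, 0 ≤ v x → (1 : ℤ) ≤ v (σ x - x)

/-- The ramification group `G_x = {σ ∈ G_0 : v_L(σ(π_L) - π_L) ≥ x + 1}` of `Gal(L/F)`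
in the lower numbering (for real `x`); since `v_L` is integer valued, the condition
`v_L(σ(π_L) - π_L) ≥ x + 1` is expressed via the ceiling `⌈x + 1⌉`. -/
def ramGrp (F : Type*) {L : Type*} [Field F] [Field L] [Algebra F L]
    (v : L → WithTop ℤ) (π : L) (x : ℝ) : Set (L ≃ₐ[F] L) :=
  {σ | InInertia v σ ∧ ((⌈x + 1⌉ : ℤ) : WithTop ℤ) ≤ v (σ π - π)}

/-- The Hasse–Herbrand function `φ_{L/F}(x) = ∫_0^x dt / (G_0 : G_t)`, where
`1/(G_0 : G_t) = |G_t|/|G_0|`. -/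
def hhPhi (F : Type*) {L : Type*} [Field F] [Field L] [Algebra F L]
    (v : L → WithTop ℤ) (π : L) (x : ℝ) : ℝ :=
  ∫ t in (0 : ℝ)..x, ((ramGrp F v π t).ncard : ℝ) / ((ramGrp F v π 0).ncard : ℝ)

/-- `ψ_{L/F}`, the inverse of the Hasse–Herbrand bijection `φ_{L/F} : ℝ_{≥0} → ℝ_{≥0}`. -/
def hhPsi (F : Type*) {L : Type*} [Field F] [Field L] [Algebra F L]
    (v : L → WithTop ℤ) (π : L) (u : ℝ) : ℝ :=
  Function.invFunOn (hhPhi F v π) (Set.Ici 0) u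

/-- The ramification group `G^u = G_{ψ_{L/F}(u)}` in the upper numbering. -/
def upperRamGrp (F : Type*) {L : Type*} [Field F] [Field L] [Algebra F L]
    (v : L → WithTop ℤ) (π : L) (u : ℝ) : Set (L ≃ₐ[F] L) :=
  ramGrp F v π (hhPsi F v π u)

/-- `b` is a lower ramification break of `L/F`: `b ≥ 0` and `G_{b+ε} ≠ G_b` for all
`ε > 0`. -/
def IsLowerBreak (F : Type*) {L : Type*} [Field F] [Field L] [Algebra F L]
    (v : L → WithTop ℤ) (π : L) (b : ℝ) : Prop :=
  0 ≤ b ∧ ∀ ε : ℝ, 0 < ε → ramGrp F v π (b + ε) ≠ ramGrp F v π b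

/-- `u` is an upper ramification break of `L/F`: `u ≥ 0` and `G^{u+ε} ≠ G^u` for all
`ε > 0`. -/
def IsUpperBreak (F : Type*) {L : Type*} [Field F] [Field L] [Algebra F L]
    (v : L → WithTop ℤ) (π : L) (u : ℝ) : Prop :=
  0 ≤ u ∧ ∀ ε : ℝ, 0 < ε → upperRamGrp F v π (u + ε) ≠ upperRamGrp F v π u

/-- A separable closure `K^sep` of `K`. -/
abbrev SepCl (K : Type*) [Field K] : Type _ :=
  separableClosure K (AlgebraicClosure K)

/-- The Frobenius `F` on truncated Witt vectors, induced by the `p`-th power map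
on components. -/
def wittF {p n : ℕ} {R : Type*} [CommRing R] (x : TruncatedWittVector p n R) :
    TruncatedWittVector p n R :=
  TruncatedWittVector.mk p fun i => x.coeff i ^ p

/-- Componentwise application of a map (the inclusion `W_n(K) → W_n(K^sep)` and the
Galois action on Witt vectors are componentwise). -/
def wittMap {p n : ℕ} {R S : Type*} (f : R → S) (x : TruncatedWittVector p n R) :
    TruncatedWittVector p n S :=
  TruncatedWittVector.mk p fun i => f (x.coeff i)

theorem IsNormVal.val_one {L : Type*} [Field L] {v : L → WithTop ℤ}
    (hv : IsNormVal v) : v 1 = ((0 : ℤ) : WithTop ℤ) := by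
  have h2 := hv.2.1 1 1
  rw [one_mul] at h2
  have hne : v 1 ≠ ⊤ := fun h => one_ne_zero ((hv.1 1).mp h)
  lift v 1 to ℤ using hne with z hz
  have : z = z + z := by exact_mod_cast h2
  have hz0 : z = 0 := by omega
  exact_mod_cast congrArg (fun t : ℤ => (t : WithTop ℤ)) hz0

theorem IsNormVal.val_neg {L : Type*} [Field L] {v : L → WithTop ℤ}
    (hv : IsNormVal v) (x : L) : v (-x) = v x := by
  have hm1 : v (-1 : L) = ((0 : ℤ) : WithTop ℤ) := by
    have h2 := hv.2.1 (-1 : L) (-1 : L)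
    rw [neg_mul_neg, one_mul, hv.val_one] at h2
    have hne : v (-1 : L) ≠ ⊤ := fun h => by
      have := (hv.1 (-1 : L)).mp h
      simp at this
    lift v (-1 : L) to ℤ using hne with z hz
    have : (0 : ℤ) = z + z := by exact_mod_cast h2
    have hz0 : z = 0 := by omega
    exact_mod_cast congrArg (fun t : ℤ => (t : WithTop ℤ)) hz0
  calc v (-x) = v ((-1) * x) := by rw [neg_one_mul]
  _ = v (-1 : L) + v x := hv.2.1 _ _
  _ = v x := by rw [hm1]; exact zero_add _

/-- The valuation ring `O_L = {x : v(x) ≥ 0}` of a normalized valuation `v`. -/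
def valRing {L : Type*} [Field L] (v : L → WithTop ℤ) (hv : IsNormVal v) :
    Subring L where
  carrier := {x | 0 ≤ v x}
  zero_mem' := by
    have : v 0 = ⊤ := (hv.1 0).mpr rfl
    simp [Set.mem_setOf_eq, this]
  one_mem' := by
    have := hv.val_one
    simp [Set.mem_setOf_eq, this]
  add_mem' := fun {a b} ha hb => le_trans (le_min ha hb) (hv.2.2.1 a b)
  mul_mem' := fun {a b} ha hb => by
    simp only [Set.mem_setOf_eq, hv.2.1]
    exact add_nonneg ha hb
  neg_mem' := fun {a} ha => by
    simp only [Set.mem_setOf_eq, hv.val_neg]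
    exact ha

/-- The maximal ideal `M_L = {x : v(x) ≥ 1}` of the valuation ring `O_L`. -/
def valIdeal {L : Type*} [Field L] (v : L → WithTop ℤ) (hv : IsNormVal v) :
    Ideal (valRing v hv) where
  carrier := {x | ((1 : ℤ) : WithTop ℤ) ≤ v x.1}
  zero_mem' := by
    have : v 0 = ⊤ := (hv.1 0).mpr rfl
    simp [Set.mem_setOf_eq, this]
  add_mem' := fun {a b} ha hb => le_trans (le_min ha hb) (hv.2.2.1 a.1 b.1)
  smul_mem' := fun c x hx => by
    simp only [Set.mem_setOf_eq] at hx ⊢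
    show ((1 : ℤ) : WithTop ℤ) ≤ v (c.1 * x.1)
    rw [hv.2.1]
    have h0 : (0 : WithTop ℤ) + ((1 : ℤ) : WithTop ℤ) ≤ v c.1 + v x.1 :=
      add_le_add c.2 hx
    simpa using h0

/-- The residue field of `L` is `O_L / M_L`; the (perfect) residue field `k` of `K`
maps into it via `c ↦ ι⁻¹(C c) mod M_L`, making `O_L / M_L` a `k`-algebra. -/
def resHom {k K L : Type*} [Field k] [Field K] [Field L] [Algebra K L]
    (ι : K ≃+* LaurentSeries k) (v : L → WithTop ℤ) (hv : IsNormVal v)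
    (e : ℕ) (he : ExtendsWithE (lfVal ι) v e) :
    k →+* (valRing v hv ⧸ valIdeal v hv) :=
  (Ideal.Quotient.mk (valIdeal v hv)).comp
    (RingHom.codRestrict
      ((algebraMap K L).comp
        ((ι.symm : LaurentSeries k ≃+* K).toRingHom.comp
          (HahnSeries.C : k →+* LaurentSeries k)))
      (valRing v hv)
      (by
        intro c
        by_cases hc : c = 0
        · subst hc
          simp only [RingHom.comp_apply, map_zero]
          have : v 0 = ⊤ := (hv.1 0).mpr rfl
          show (0 : WithTop ℤ) ≤ v 0
          simp [this]
        · show (0 : WithTop ℤ) ≤ v (algebraMap K L (ι.symm (HahnSeries.C c)))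
          have hv0 : lfVal ι (ι.symm (HahnSeries.C c)) = ((0 : ℤ) : WithTop ℤ) := by
            have hCne : (HahnSeries.C c : LaurentSeries k) ≠ 0 := by
              simpa using hc
            simp only [lfVal, lsVal, RingEquiv.apply_symm_apply]
            rw [if_neg hCne, HahnSeries.order_C]
          have := he (ι.symm (HahnSeries.C c)) 0 hv0
          rw [this]
          simp))

/-- The residue class degree: the degree of the residue field `O_L/M_L` of `L` over
the residue field `k` of `K`. -/
def residueDegree {k K L : Type*} [Field k] [Field K] [Field L] [Algebra K L]
    (ι : K ≃+* LaurentSeries k) (v : L → WithTop ℤ) (hv : IsNormVal v)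
    (e : ℕ) (he : ExtendsWithE (lfVal ι) v e) : ℕ :=
  letI : Algebra k (valRing v hv ⧸ valIdeal v hv) := (resHom ι v hv e he).toAlgebra
  Module.finrank k (valRing v hv ⧸ valIdeal v hv)

section ValApi
variable {L : Type*} [Field L] {v : L → WithTop ℤ}

theorem nv_zero (hv : IsNormVal v) : v 0 = ⊤ := (hv.1 0).mpr rfl

theorem nv_fin (hv : IsNormVal v) {x : L} (hx : x ≠ 0) : ∃ c : ℤ, v x = (c : WithTop ℤ) := by
  have hne : v x ≠ ⊤ := fun h => hx ((hv.1 x).mp h)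
  exact ⟨(v x).untop hne, (WithTop.coe_untop _ _).symm⟩

theorem nv_ne (hv : IsNormVal v) {x : L} {c : ℤ} (hx : v x = (c : WithTop ℤ)) : x ≠ 0 := by
  rintro rfl
  rw [nv_zero hv] at hx
  exact absurd hx (by simp)

theorem nv_inj {x : L} {c d : ℤ} (hx : v x = (c : WithTop ℤ)) (hd : v x = (d : WithTop ℤ)) :
    c = d := by
  rw [hx] at hd; exact_mod_cast hd

theorem nv_le_of {x : L} {c d : ℤ} (hx : v x = (c : WithTop ℤ)) (hd : (d : WithTop ℤ) ≤ v x) :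
    d ≤ c := by
  rw [hx] at hd; exact_mod_cast hd

theorem nv_ge_of {x : L} {c d : ℤ} (hx : v x = (c : WithTop ℤ)) (hd : d ≤ c) :
    (d : WithTop ℤ) ≤ v x := by
  rw [hx]; exact_mod_cast hd

theorem nv_mono {x : L} {c d : ℤ} (hx : (c : WithTop ℤ) ≤ v x) (hd : d ≤ c) :
    (d : WithTop ℤ) ≤ v x := le_trans (by exact_mod_cast hd) hx

theorem nv_ge_zero (hv : IsNormVal v) (c : ℤ) : (c : WithTop ℤ) ≤ v 0 := by
  rw [nv_zero hv]; exact le_top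

theorem nv_ge_add (hv : IsNormVal v) {x y : L} {c : ℤ} (hx : (c : WithTop ℤ) ≤ v x)
    (hy : (c : WithTop ℤ) ≤ v y) : (c : WithTop ℤ) ≤ v (x + y) :=
  le_trans (le_min hx hy) (hv.2.2.1 x y)

theorem nv_ge_neg (hv : IsNormVal v) {x : L} {c : ℤ} (hx : (c : WithTop ℤ) ≤ v x) :
    (c : WithTop ℤ) ≤ v (-x) := by rwa [hv.val_neg]

theorem nv_ge_sub (hv : IsNormVal v) {x y : L} {c : ℤ} (hx : (c : WithTop ℤ) ≤ v x)
    (hy : (c : WithTop ℤ) ≤ v y) : (c : WithTop ℤ) ≤ v (x - y) := by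
  rw [sub_eq_add_neg]; exact nv_ge_add hv hx (nv_ge_neg hv hy)

theorem nv_ge_sum (hv : IsNormVal v) {ι : Type*} (s : Finset ι) (f : ι → L) {c : ℤ}
    (h : ∀ i ∈ s, (c : WithTop ℤ) ≤ v (f i)) : (c : WithTop ℤ) ≤ v (∑ i ∈ s, f i) := by
  induction s using Finset.induction_on with
  | empty => simpa using nv_ge_zero hv c
  | insert a s ha ih =>
    rw [Finset.sum_insert ha]
    exact nv_ge_add hv (h a (by simp)) (ih fun i hi => h i (by simp [hi]))

theorem nv_mul (hv : IsNormVal v) {x y : L} {c d : ℤ} (hx : v x = (c : WithTop ℤ))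
    (hy : v y = (d : WithTop ℤ)) : v (x * y) = ((c + d : ℤ) : WithTop ℤ) := by
  rw [hv.2.1, hx, hy]; rfl

theorem nv_ge_mul (hv : IsNormVal v) {x y : L} {c d : ℤ} (hx : (c : WithTop ℤ) ≤ v x)
    (hy : (d : WithTop ℤ) ≤ v y) : ((c + d : ℤ) : WithTop ℤ) ≤ v (x * y) := by
  rw [hv.2.1]; exact (add_le_add hx hy : (c : WithTop ℤ) + d ≤ _)

theorem nv_pow (hv : IsNormVal v) {x : L} {c : ℤ} (hx : v x = (c : WithTop ℤ)) (n : ℕ) :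
    v (x ^ n) = (((n : ℤ) * c : ℤ) : WithTop ℤ) := by
  induction n with
  | zero => simpa using hv.val_one
  | succ n ih =>
    rw [pow_succ, nv_mul hv ih hx]; congr 1; push_cast; ring

theorem nv_ge_pow (hv : IsNormVal v) {x : L} {c : ℤ} (hx : (c : WithTop ℤ) ≤ v x) (n : ℕ) :
    (((n : ℤ) * c : ℤ) : WithTop ℤ) ≤ v (x ^ n) := by
  induction n with
  | zero => simpa using hv.val_one.ge
  | succ n ih =>
    rw [pow_succ]; exact nv_mono (nv_ge_mul hv ih hx) (by push_cast; linarith)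

theorem nv_ge0_mul (hv : IsNormVal v) {x y : L} {d : ℤ} (hx : ((0 : ℤ) : WithTop ℤ) ≤ v x)
    (hy : (d : WithTop ℤ) ≤ v y) : ((d : ℤ) : WithTop ℤ) ≤ v (x * y) := by
  simpa using nv_ge_mul hv hx hy

theorem nv_ge0_pow (hv : IsNormVal v) {x : L} (hx : ((0 : ℤ) : WithTop ℤ) ≤ v x) (n : ℕ) :
    ((0 : ℤ) : WithTop ℤ) ≤ v (x ^ n) := by simpa using nv_ge_pow hv hx n

theorem nv_inv (hv : IsNormVal v) {x : L} {c : ℤ} (hx : v x = (c : WithTop ℤ)) :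
    v x⁻¹ = ((-c : ℤ) : WithTop ℤ) := by
  have hx0 := nv_ne hv hx
  obtain ⟨d, hd⟩ := nv_fin hv (inv_ne_zero hx0)
  have h := nv_mul hv hx hd
  rw [mul_inv_cancel₀ hx0] at h
  have := nv_inj h hv.val_one
  rw [hd]; congr 1; omega

theorem nv_zpow (hv : IsNormVal v) {x : L} {c : ℤ} (hx : v x = (c : WithTop ℤ)) (n : ℤ) :
    v (x ^ n) = ((n * c : ℤ) : WithTop ℤ) := by
  obtain ⟨m, rfl | rfl⟩ := n.eq_nat_or_neg
  · simpa using nv_pow hv hx m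
  · rw [zpow_neg, zpow_natCast, nv_inv hv (nv_pow hv hx m)]; congr 1; ring

theorem nv_neg (hv : IsNormVal v) {x : L} {c : ℤ} (hx : v x = (c : WithTop ℤ)) :
    v (-x) = (c : WithTop ℤ) := by rwa [hv.val_neg]

theorem nv_add (hv : IsNormVal v) {x y : L} {c d : ℤ} (hx : v x = (c : WithTop ℤ))
    (hy : (d : WithTop ℤ) ≤ v y) (hcd : c < d) : v (x + y) = (c : WithTop ℤ) := by
  have h1 : (c : WithTop ℤ) ≤ v (x + y) := nv_ge_add hv hx.ge (nv_mono hy hcd.le)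
  by_contra hne
  have h2 : ((c + 1 : ℤ) : WithTop ℤ) ≤ v (x + y) := by
    rcases eq_or_ne (v (x + y)) ⊤ with h | h
    · rw [h]; exact le_top
    · lift v (x + y) to ℤ using h with z hz
      have h3 : c ≤ z := by exact_mod_cast h1
      have h4 : z ≠ c := by exact_mod_cast hne
      exact_mod_cast (by omega : c + 1 ≤ z)
  have h3 := nv_ge_sub hv h2 (nv_mono hy (show c + 1 ≤ d by omega))
  rw [add_sub_cancel_right] at h3
  have := nv_le_of hx h3
  omega

theorem nv_sub (hv : IsNormVal v) {x y : L} {c d : ℤ} (hx : v x = (c : WithTop ℤ))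
    (hy : (d : WithTop ℤ) ≤ v y) (hcd : c < d) : v (x - y) = (c : WithTop ℤ) := by
  rw [sub_eq_add_neg]; exact nv_add hv hx (nv_ge_neg hv hy) hcd

theorem nv_sum (hv : IsNormVal v) {ι : Type*} (s : Finset ι) (f : ι → L) {c : ℤ} (i₀ : ι)
    (hi : i₀ ∈ s) (h0 : v (f i₀) = (c : WithTop ℤ))
    (h : ∀ i ∈ s, i ≠ i₀ → ((c + 1 : ℤ) : WithTop ℤ) ≤ v (f i)) :
    v (∑ i ∈ s, f i) = (c : WithTop ℤ) := by
  rw [← Finset.add_sum_erase s f hi]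
  refine nv_add hv h0 (d := c + 1) (nv_ge_sum hv _ _ fun i hi' => ?_) (by omega)
  rw [Finset.mem_erase] at hi'
  exact h i hi'.2 hi'.1

theorem nv_not_ge {x : L} {c : ℤ} (h : ¬ (c : WithTop ℤ) ≤ v x) :
    ∃ d : ℤ, v x = (d : WithTop ℤ) ∧ d < c := by
  rw [not_le] at h
  have hne : v x ≠ ⊤ := (lt_of_lt_of_le h le_top).ne
  refine ⟨(v x).untop hne, (WithTop.coe_untop _ _).symm, ?_⟩
  rw [← WithTop.coe_untop (v x) hne] at h
  exact_mod_cast h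

theorem nv_fix {p : ℕ} (hp : 2 ≤ p) (hv : IsNormVal v) {x : L} (hx : x ≠ 0) (h : x ^ p = x) :
    v x = ((0 : ℤ) : WithTop ℤ) := by
  obtain ⟨c, hc⟩ := nv_fin hv hx
  have h1 := nv_pow hv hc p
  rw [h] at h1
  have h2 := nv_inj hc h1
  have hp' : (2 : ℤ) ≤ p := by exact_mod_cast hp
  have : ((p : ℤ) - 1) * c = 0 := by linarith
  rcases mul_eq_zero.mp this with h3 | h3
  · omega
  · rw [hc, h3]

theorem nv_natCast {p : ℕ} [Fact p.Prime] [CharP L p] (hv : IsNormVal v) {l : ℕ} (hl : ¬ p ∣ l) :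
    v (l : L) = ((0 : ℤ) : WithTop ℤ) := by
  refine nv_fix (Fact.out (p := p.Prime)).two_le hv ?_ ?_
  · rwa [Ne, CharP.cast_eq_zero_iff L p]
  · have : frobenius L p (l : L) = l := map_natCast _ _
    exact this

theorem nv_intCast {p : ℕ} [Fact p.Prime] [CharP L p] (hv : IsNormVal v) {l : ℤ}
    (hl : ¬ (p : ℤ) ∣ l) : v (l : L) = ((0 : ℤ) : WithTop ℤ) := by
  refine nv_fix (Fact.out (p := p.Prime)).two_le hv ?_ ?_
  · rwa [Ne, CharP.intCast_eq_zero_iff L p]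
  · have : frobenius L p (l : L) = l := map_intCast _ _
    exact this

theorem nv_ge_natCast (hv : IsNormVal v) (l : ℕ) :
    ((0 : ℤ) : WithTop ℤ) ≤ v (l : L) := by
  induction l with
  | zero => simpa using nv_ge_zero hv 0
  | succ n ih => push_cast; exact nv_ge_add hv ih hv.val_one.ge

/-- `y^p - y = g` with `v g < 0` forces `p * v y = v g`. -/
theorem nv_as {p : ℕ} (hp : 2 ≤ p) (hv : IsNormVal v) {w g : L} {c : ℤ} (h : w ^ p - w = g)
    (hg : v g = (c : WithTop ℤ)) (hc : c < 0) : ∃ d : ℤ, v w = (d : WithTop ℤ) ∧ (p : ℤ) * d = c := by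
  have hp' : (2 : ℤ) ≤ p := by exact_mod_cast hp
  have h1 : ¬ ((0 : ℤ) : WithTop ℤ) ≤ v w := by
    intro h0
    have := nv_le_of hg (h ▸ nv_ge_sub hv (nv_ge0_pow hv h0 p) h0)
    omega
  obtain ⟨d, hd, hd0⟩ := nv_not_ge h1
  refine ⟨d, hd, ?_⟩
  have h2 : v (w ^ p - w) = (((p : ℤ) * d : ℤ) : WithTop ℤ) :=
    nv_sub hv (nv_pow hv hd p) hd.ge (by nlinarith)
  rw [h] at h2
  exact nv_inj h2 hg

theorem nv_as' {p : ℕ} (hp : 2 ≤ p) (hv : IsNormVal v) {w : L} {d : ℤ}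
    (hd : v w = (d : WithTop ℤ)) (hd0 : d < 0) :
    v (w ^ p - w) = (((p : ℤ) * d : ℤ) : WithTop ℤ) := by
  have hp' : (2 : ℤ) ≤ p := by exact_mod_cast hp
  exact nv_sub hv (nv_pow hv hd p) hd.ge (by nlinarith)

/-- An element whose `v` is at least `0` if it is a root of a monic polynomial with integral
coefficients. -/
theorem nv_integral (hv : IsNormVal v) (f : Polynomial L) (hf : f.Monic)
    (hc : ∀ i, ((0 : ℤ) : WithTop ℤ) ≤ v (f.coeff i)) {x : L} (hx : f.eval x = 0) :
    ((0 : ℤ) : WithTop ℤ) ≤ v x := by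
  by_contra h
  obtain ⟨d, hd, hd0⟩ := nv_not_ge h
  rw [Polynomial.eval_eq_sum_range, Finset.sum_range_succ] at hx
  rw [hf.coeff_natDegree, one_mul, add_comm] at hx
  have h1 := nv_add (y := ∑ i ∈ Finset.range f.natDegree, f.coeff i * x ^ i)
    (d := ((f.natDegree : ℤ) - 1) * d) hv (nv_pow hv hd f.natDegree) ?_ (by linarith)
  · rw [hx, nv_zero hv] at h1; exact absurd h1 WithTop.top_ne_coe
  · refine nv_ge_sum hv _ _ fun i hi => ?_
    have : (i : ℤ) + 1 ≤ f.natDegree := by exact_mod_cast Finset.mem_range.mp hi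
    exact nv_mono (nv_ge0_mul hv (hc i) (nv_pow hv hd i).ge) (by nlinarith)

end ValApi

section SpanStep
variable {L : Type*} [Field L] {v : L → WithTop ℤ}

theorem span_val {p : ℕ} [Fact p.Prime] (hv : IsNormVal v) {F : Set L} {q q' β : ℤ} {y : L}
    (hq : q = p * q') (hq' : q' ≠ 0) (hβ : ¬ (p : ℤ) ∣ β)
    (hy : v y = ((q' * β : ℤ) : WithTop ℤ))
    (hF : ∀ f ∈ F, ∀ c : ℤ, v f = (c : WithTop ℤ) → q ∣ c)
    (f : ℕ → L) (hf : ∀ l, f l ∈ F) (hz : ∑ l ∈ Finset.range p, f l * y ^ l ≠ 0) :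
    ∃ l₀ < p, ∃ c : ℤ, v (f l₀ * y ^ l₀) = (c : WithTop ℤ) ∧
      v (∑ l ∈ Finset.range p, f l * y ^ l) = (c : WithTop ℤ) ∧
      ∀ l < p, l ≠ l₀ → ((c + 1 : ℤ) : WithTop ℤ) ≤ v (f l * y ^ l) := by
  have hy0 := nv_ne hv hy
  have hne : (Finset.range p).Nonempty := ⟨0, by simp [(Fact.out (p := p.Prime)).pos]⟩
  obtain ⟨l₀, hl₀, hmin⟩ := Finset.exists_min_image (Finset.range p) (fun l => v (f l * y ^ l)) hne
  rw [Finset.mem_range] at hl₀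
  have hf0 : f l₀ * y ^ l₀ ≠ 0 := by
    intro h0
    apply hz
    refine Finset.sum_eq_zero fun l hl => ?_
    have := hmin l hl
    simp only [h0, nv_zero hv, top_le_iff] at this
    exact (hv.1 _).mp this
  obtain ⟨c, hc⟩ := nv_fin hv hf0
  have hrest : ∀ l < p, l ≠ l₀ → ((c + 1 : ℤ) : WithTop ℤ) ≤ v (f l * y ^ l) := by
    intro l hl hne
    by_contra hcon
    obtain ⟨d, hd, hdc⟩ := nv_not_ge hcon
    have h1 := hmin l (Finset.mem_range.mpr hl)
    simp only [hc] at h1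
    have h2 := nv_le_of hd h1
    have hdc' : d = c := by omega
    subst hdc'
    obtain ⟨a, ha⟩ := nv_fin hv (left_ne_zero_of_mul (nv_ne hv hd))
    obtain ⟨b, hb⟩ := nv_fin hv (left_ne_zero_of_mul hf0)
    obtain ⟨a', rfl⟩ := hF _ (hf l) a ha
    obtain ⟨b', rfl⟩ := hF _ (hf l₀) b hb
    have e1 := nv_inj hd (nv_mul hv ha (nv_pow hv hy l))
    have e2 := nv_inj hc (nv_mul hv hb (nv_pow hv hy l₀))
    have e3 : q' * (p * (a' - b')) = q' * (((l₀ : ℤ) - l) * β) := by rw [hq] at e1 e2; linarith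
    have e4 := mul_left_cancel₀ hq' e3
    have hpi : Prime (p : ℤ) := Nat.prime_iff_prime_int.mp Fact.out
    rcases hpi.dvd_or_dvd (Dvd.intro _ e4) with h | h
    · have h5 := Int.eq_zero_of_abs_lt_dvd h (by rw [abs_lt]; omega)
      omega
    · exact hβ h
  refine ⟨l₀, hl₀, c, hc, ?_, hrest⟩
  exact nv_sum hv _ _ l₀ (Finset.mem_range.mpr hl₀) hc
    fun l hl hne => hrest l (Finset.mem_range.mp hl) hne

theorem span_T {p : ℕ} [Fact p.Prime] (hv : IsNormVal v) {F : Set L} {q q' β γ : ℤ} {y : L}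
    (hq : q = p * q') (hq' : q' ≠ 0) (hβ : ¬ (p : ℤ) ∣ β)
    (hy : v y = ((q' * β : ℤ) : WithTop ℤ))
    (hF : ∀ f ∈ F, ∀ c : ℤ, v f = (c : WithTop ℤ) → q ∣ c)
    (T : L →+ L)
    (hT : ∀ f ∈ F, ∀ l < p, ∀ c : ℤ, (c : WithTop ℤ) ≤ v (f * y ^ l) →
      ((c + γ : ℤ) : WithTop ℤ) ≤ v (T (f * y ^ l)))
    (hT' : ∀ f ∈ F, ∀ l < p, 1 ≤ l → ∀ c : ℤ, v (f * y ^ l) = (c : WithTop ℤ) →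
      v (T (f * y ^ l)) = ((c + γ : ℤ) : WithTop ℤ))
    (f : ℕ → L) (hf : ∀ l, f l ∈ F) (c : ℤ) :
    ((c : WithTop ℤ) ≤ v (∑ l ∈ Finset.range p, f l * y ^ l) →
      ((c + γ : ℤ) : WithTop ℤ) ≤ v (T (∑ l ∈ Finset.range p, f l * y ^ l))) ∧
    (v (∑ l ∈ Finset.range p, f l * y ^ l) = (c : WithTop ℤ) → ¬ q ∣ c →
      v (T (∑ l ∈ Finset.range p, f l * y ^ l)) = ((c + γ : ℤ) : WithTop ℤ)) := by
  by_cases hz : ∑ l ∈ Finset.range p, f l * y ^ l = 0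
  · rw [hz, map_zero, nv_zero hv]; simp
  obtain ⟨l₀, hl₀, d, hd, hzd, hrest⟩ := span_val hv hq hq' hβ hy hF f hf hz
  rw [map_sum]
  constructor
  · intro hc
    have hcd := nv_le_of hzd hc
    refine nv_ge_sum hv _ _ fun l hl => ?_
    rw [Finset.mem_range] at hl
    refine hT _ (hf l) l hl c ?_
    by_cases h : l = l₀
    · subst h; exact nv_ge_of hd hcd
    · exact nv_mono (hrest l hl h) (by omega)
  · intro hc hqc
    obtain rfl := nv_inj hc hzd
    have hl1 : 1 ≤ l₀ := by
      by_contra h0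
      have : l₀ = 0 := by omega
      subst this
      rw [pow_zero, mul_one] at hd
      exact hqc (hF _ (hf 0) _ hd)
    refine nv_sum hv _ _ l₀ (Finset.mem_range.mpr hl₀) (hT' _ (hf l₀) l₀ hl₀ hl1 _ hd) ?_
    intro l hl hne
    rw [Finset.mem_range] at hl
    exact nv_mono (hT _ (hf l) l hl _ (hrest l hl hne)) (by omega)

end SpanStep

section WittLemmas
open WittVector

variable {p : ℕ} [hp : Fact p.Prime]

theorem witt_init_coeff_lt {R : Type*} [CommRing R] (X : WittVector p R) {i j : ℕ} (h : j < i) :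
    (WittVector.init i X).coeff j = X.coeff j := by
  simp [WittVector.init, WittVector.select, h]

theorem witt_init_coeff_ge {R : Type*} [CommRing R] (X : WittVector p R) {i j : ℕ} (h : i ≤ j) :
    (WittVector.init i X).coeff j = 0 := by
  simp [WittVector.init, WittVector.select, h]

theorem witt_tail_coeff_lt {R : Type*} [CommRing R] (X : WittVector p R) {i j : ℕ} (h : j < i) :
    (WittVector.tail i X).coeff j = 0 := by
  simp [WittVector.tail, WittVector.select, h]

theorem witt_tail_coeff_ge {R : Type*} [CommRing R] (X : WittVector p R) {i j : ℕ} (h : i ≤ j) :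
    (WittVector.tail i X).coeff j = X.coeff j := by
  simp [WittVector.tail, WittVector.select, h]

theorem witt_add_zero_lt {R : Type*} [CommRing R] (X Y : WittVector p R) (i : ℕ)
    (hX : ∀ j < i, X.coeff j = 0) (hY : ∀ j < i, Y.coeff j = 0) :
    (∀ j < i, (X + Y).coeff j = 0) ∧ (X + Y).coeff i = X.coeff i + Y.coeff i := by
  rw [eq_iterate_verschiebung hX, eq_iterate_verschiebung hY]
  rw [← iterate_map_add verschiebung i]
  constructor
  · intro j hj; exact iterate_verschiebung_coeff_eq_zero _ hj
  · have := fun Z : WittVector p R => iterate_verschiebung_coeff Z i 0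
    simp only [zero_add] at this
    rw [this, this, this, add_coeff_zero]

theorem witt_add_top {R : Type*} [CommRing R] (B T : WittVector p R) (i : ℕ)
    (hT : ∀ j < i, T.coeff j = 0) : (B + T).coeff i = B.coeff i + T.coeff i := by
  have h1 : B + T = WittVector.init i B + (WittVector.tail i B + T) := by
    rw [← add_assoc, init_add_tail]
  have h2 := witt_add_zero_lt (WittVector.tail i B) T i (fun j hj => witt_tail_coeff_lt B hj) hT
  rw [h1, coeff_add_of_disjoint, witt_init_coeff_ge B le_rfl, h2.2,
    witt_tail_coeff_ge B le_rfl, zero_add]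
  intro j
  rcases lt_or_ge j i with h | h
  · exact Or.inr (h2.1 j h)
  · exact Or.inl (witt_init_coeff_ge B h)

/-- Coefficients of sums of Witt vectors with entries in a subring. -/
theorem witt_add_mem {R : Type*} [CommRing R] (F : Subring R) (X Y : WittVector p R)
    (hX : ∀ j, X.coeff j ∈ F) (hY : ∀ j, Y.coeff j ∈ F) (i : ℕ) : (X + Y).coeff i ∈ F := by
  let X' : WittVector p F := WittVector.mk p fun j => ⟨X.coeff j, hX j⟩
  let Y' : WittVector p F := WittVector.mk p fun j => ⟨Y.coeff j, hY j⟩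
  have eX : WittVector.map F.subtype X' = X := by ext j; rfl
  have eY : WittVector.map F.subtype Y' = Y := by ext j; rfl
  rw [← eX, ← eY, ← map_add, map_coeff]
  exact ((X' + Y').coeff i).2

theorem witt_add_coeff_mem {R : Type*} [CommRing R] (F : Subring R) (X Y : WittVector p R) (i : ℕ)
    (hX : ∀ j < i, X.coeff j ∈ F) (hY : ∀ j < i, Y.coeff j ∈ F) :
    (X + Y).coeff i - X.coeff i - Y.coeff i ∈ F := by
  have h1 : X + Y = (WittVector.init i X + WittVector.init i Y) +
      (WittVector.tail i X + WittVector.tail i Y) := by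
    conv_lhs => rw [← init_add_tail X i, ← init_add_tail Y i]
    ring
  have h2 := witt_add_zero_lt (WittVector.tail i X) (WittVector.tail i Y) i
    (fun j hj => witt_tail_coeff_lt X hj) (fun j hj => witt_tail_coeff_lt Y hj)
  have h3 : (X + Y).coeff i = (WittVector.init i X + WittVector.init i Y).coeff i +
      (X.coeff i + Y.coeff i) := by
    conv_lhs => rw [h1]
    rw [witt_add_top _ _ i h2.1, h2.2, witt_tail_coeff_ge X le_rfl,
      witt_tail_coeff_ge Y le_rfl]
  have h4 : (WittVector.init i X + WittVector.init i Y).coeff i ∈ F := by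
    apply witt_add_mem F
    · intro j
      rcases lt_or_ge j i with h | h
      · rw [witt_init_coeff_lt X h]; exact hX j h
      · rw [witt_init_coeff_ge X h]; exact F.zero_mem
    · intro j
      rcases lt_or_ge j i with h | h
      · rw [witt_init_coeff_lt Y h]; exact hY j h
      · rw [witt_init_coeff_ge Y h]; exact F.zero_mem
  rw [h3]
  convert h4 using 1
  ring

theorem witt_ghost {R : Type*} [CommRing R] (X : WittVector p R) (i : ℕ) :
    ghostComponent i X = ∑ j ∈ Finset.range (i + 1), (p : R) ^ j * X.coeff j ^ p ^ (i - j) := by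
  rw [ghostComponent_apply, aeval_wittPolynomial]

/-- The form `F^i d` on Witt vectors. -/
def wth {R : Type*} [CommRing R] (D : R → R) (i : ℕ) (X : WittVector p R) : R :=
  ∑ j ∈ Finset.range (i + 1), X.coeff j ^ (p ^ (i - j) - 1) * D (X.coeff j)

theorem wth_ghost {S R : Type*} [CommSemiring S] [CommRing R] [Algebra S R] [Module S R]
    (D : Derivation S R R) (i : ℕ) (X : WittVector p R) :
    (p : R) ^ i * wth D i X = D (ghostComponent i X) := by
  rw [witt_ghost, map_sum, wth, Finset.mul_sum]
  refine Finset.sum_congr rfl fun j hj => ?_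
  have hj' : j ≤ i := by rw [Finset.mem_range] at hj; omega
  have h1 : (p : R) ^ j * X.coeff j ^ p ^ (i - j) = (p ^ j : ℕ) • X.coeff j ^ p ^ (i - j) := by
    rw [nsmul_eq_mul]; push_cast; ring
  have h2 : (p : R) ^ i = (p : R) ^ j * (p : R) ^ (i - j) := by
    rw [← pow_add]; congr 1; omega
  rw [h1, map_nsmul, Derivation.leibniz_pow, nsmul_eq_mul, nsmul_eq_mul, smul_eq_mul, h2]
  push_cast
  ring

theorem wth_add {R : Type*} [CommRing R] (D : Derivation ℤ R R) (i : ℕ) (X Y : WittVector p R) :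
    wth D i (X + Y) = wth D i X + wth D i Y := by
  let φ : (MvPolynomial R ℤ) →+* R := MvPolynomial.eval₂Hom (Int.castRingHom R) id
  let d : Derivation ℤ (MvPolynomial R ℤ) (MvPolynomial R ℤ) := MvPolynomial.mkDerivation ℤ fun r => MvPolynomial.X (D r)
  have hφX : ∀ r, φ (MvPolynomial.X r) = r := fun r => MvPolynomial.eval₂_X _ _ _
  have hd : ∀ f : MvPolynomial R ℤ, φ (d f) = D (φ f) := by
    intro f
    induction f using MvPolynomial.induction_on with
    | C a => simp [d, φ]
    | add f g hf hg => simp [hf, hg]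
    | mul_X f r hf =>
      rw [Derivation.leibniz, map_add, smul_eq_mul, smul_eq_mul, map_mul, map_mul, hf, map_mul,
        Derivation.leibniz, hφX]
      simp only [d, MvPolynomial.mkDerivation_X, hφX, smul_eq_mul]
  have key : ∀ Z : WittVector p (MvPolynomial R ℤ), φ (wth d i Z) = wth D i (WittVector.map φ Z) := by
    intro Z
    simp only [wth, map_sum, map_mul, map_pow, hd, map_coeff]
  let X' : WittVector p (MvPolynomial R ℤ) := WittVector.mk p fun j => MvPolynomial.X (X.coeff j)
  let Y' : WittVector p (MvPolynomial R ℤ) := WittVector.mk p fun j => MvPolynomial.X (Y.coeff j)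
  have eX : WittVector.map φ X' = X := by ext j; simp [X', map_coeff, hφX]
  have eY : WittVector.map φ Y' = Y := by ext j; simp [Y', map_coeff, hφX]
  have h0 : ((p : MvPolynomial R ℤ) ^ i) ≠ 0 := by
    have : (p : MvPolynomial R ℤ) ≠ 0 := by exact_mod_cast hp.out.ne_zero
    exact pow_ne_zero _ this
  have h1 : wth d i (X' + Y') = wth d i X' + wth d i Y' := by
    apply mul_left_cancel₀ h0
    rw [mul_add, wth_ghost, wth_ghost, wth_ghost, map_add, map_add]
  have h2 := congrArg φ h1
  rw [map_add, key, key, key, map_add, eX, eY] at h2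
  exact h2

theorem teich_mul_aux1 {S : Type*} (r : MvPolynomial S ℚ) (X : WittVector p (MvPolynomial S ℚ)) :
    teichmuller p r * X = WittVector.mk p fun j => r ^ p ^ j * X.coeff j := by
  apply (ghostMap.bijective_of_invertible p (MvPolynomial S ℚ)).1
  rw [map_mul]
  ext1 n
  simp only [Pi.mul_apply, ghostMap_apply, ghostComponent_teichmuller]
  rw [witt_ghost, witt_ghost, Finset.mul_sum]
  refine Finset.sum_congr rfl fun j hj => ?_
  have hj' : j ≤ n := by rw [Finset.mem_range] at hj; omega
  simp only [coeff_mk]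
  rw [mul_pow, ← pow_mul, ← pow_add, show j + (n - j) = n by omega]
  ring

theorem teich_mul {R : Type*} [CommRing R] (r : R) (X : WittVector p R) :
    teichmuller p r * X = WittVector.mk p fun j => r ^ p ^ j * X.coeff j := by
  let φ : (MvPolynomial R ℤ) →+* R := MvPolynomial.eval₂Hom (Int.castRingHom R) id
  have hφX : ∀ r, φ (MvPolynomial.X r) = r := fun r => MvPolynomial.eval₂_X _ _ _
  let X' : WittVector p (MvPolynomial R ℤ) := WittVector.mk p fun j => MvPolynomial.X (X.coeff j)
  have eX : WittVector.map φ X' = X := by ext j; simp [X', map_coeff, hφX]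
  have key : teichmuller p (MvPolynomial.X r : MvPolynomial R ℤ) * X' =
      WittVector.mk p fun j => (MvPolynomial.X r : MvPolynomial R ℤ) ^ p ^ j * X'.coeff j := by
    refine map_injective (MvPolynomial.map (Int.castRingHom ℚ))
      (MvPolynomial.map_injective _ Int.cast_injective) ?_
    rw [map_mul, map_teichmuller, teich_mul_aux1]
    ext j
    simp [map_coeff]
  have h := congrArg (WittVector.map φ) key
  rw [map_mul, map_teichmuller, eX, hφX] at h
  rw [h]
  ext j
  simp [map_coeff, hφX, X']

theorem witt_isobaric {L : Type*} [Field L] [CharP L p] {v : L → WithTop ℤ} (hv : IsNormVal v)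
    (X Y : WittVector p L) (i : ℕ) (N : ℤ)
    (hX : ∀ j ≤ i, ((-N : ℤ) : WithTop ℤ) ≤ v (X.coeff j ^ p ^ (i - j)))
    (hY : ∀ j ≤ i, ((-N : ℤ) : WithTop ℤ) ≤ v (Y.coeff j ^ p ^ (i - j))) :
    ((-N : ℤ) : WithTop ℤ) ≤ v ((X + Y).coeff i) := by
  obtain ⟨π, hπ⟩ := hv.2.2.2
  have hlam := nv_zpow hv hπ N
  rw [mul_one] at hlam
  let φ : L →+* L := iterateFrobenius L p i
  let G : WittVector p L → WittVector p L := fun Z =>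
    teichmuller p (π ^ N) * WittVector.map φ (WittVector.init (i + 1) Z)
  have hGc : ∀ (Z : WittVector p L) (j : ℕ), (G Z).coeff j =
      (π ^ N) ^ p ^ j * ((WittVector.init (i + 1) Z).coeff j) ^ p ^ i := by
    intro Z j
    simp only [G]
    rw [teich_mul]
    simp only [coeff_mk, map_coeff, φ, iterateFrobenius_def]
  have hG : ∀ Z : WittVector p L, (∀ j ≤ i, ((-N : ℤ) : WithTop ℤ) ≤ v (Z.coeff j ^ p ^ (i - j))) →
      ∀ j, (G Z).coeff j ∈ valRing v hv := by
    intro Z hZ j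
    rw [hGc]
    rcases lt_or_ge j (i + 1) with h | h
    · rw [witt_init_coeff_lt _ h]
      have h1 : Z.coeff j ^ p ^ i = (Z.coeff j ^ p ^ (i - j)) ^ p ^ j := by
        rw [← pow_mul, ← pow_add]; congr 2; omega
      rw [h1, ← mul_pow]
      have h2 : ((0 : ℤ) : WithTop ℤ) ≤ v (π ^ N * Z.coeff j ^ p ^ (i - j)) :=
        nv_mono (nv_ge_mul hv hlam.ge (hZ j (by omega))) (by omega)
      exact nv_ge0_pow hv h2 _
    · rw [witt_init_coeff_ge _ h, zero_pow (pow_ne_zero _ hp.out.ne_zero), mul_zero]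
      exact (valRing v hv).zero_mem
  have hsum := witt_add_mem (valRing v hv) (G X) (G Y) (hG X hX) (hG Y hY) i
  have hsum' : (G X + G Y).coeff i = (π ^ N * (X + Y).coeff i) ^ p ^ i := by
    have : G X + G Y = teichmuller p (π ^ N) *
        WittVector.map φ (WittVector.init (i + 1) X + WittVector.init (i + 1) Y) := by
      simp only [G]; rw [map_add, mul_add]
    rw [this, teich_mul]
    simp only [coeff_mk, map_coeff, φ, iterateFrobenius_def]
    rw [← witt_init_coeff_lt (WittVector.init (i + 1) X + WittVector.init (i + 1) Y)
      (Nat.lt_succ_self i), ← init_add, witt_init_coeff_lt _ (Nat.lt_succ_self i), mul_pow]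
  rw [hsum'] at hsum
  have hsum2 : ((0 : ℤ) : WithTop ℤ) ≤ v ((π ^ N * (X + Y).coeff i) ^ p ^ i) := hsum
  by_contra hcon
  obtain ⟨d, hd, hdN⟩ := nv_not_ge hcon
  have h3 := nv_le_of (nv_pow hv (nv_mul hv hlam hd) (p ^ i)) hsum2
  have h4 : (0 : ℤ) < ((p ^ i : ℕ) : ℤ) := by exact_mod_cast pow_pos hp.out.pos i
  nlinarith

end WittLemmas

section ASW
open WittVector Polynomial

variable {p : ℕ} [hp : Fact p.Prime]

/-- The field generated by the first `i` coefficients of a Witt vector. -/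
def wadj (E : Type*) {M : Type*} [Field E] [Field M] [Algebra E M] (X : WittVector p M) (i : ℕ) :
    IntermediateField E M :=
  IntermediateField.adjoin E {z | ∃ j < i, X.coeff j = z}

theorem wadj_mem (E : Type*) {M : Type*} [Field E] [Field M] [Algebra E M] (X : WittVector p M)
    {i j : ℕ} (h : j < i) : X.coeff j ∈ wadj E X i :=
  IntermediateField.subset_adjoin _ _ ⟨j, h, rfl⟩

theorem wadj_mono (E : Type*) {M : Type*} [Field E] [Field M] [Algebra E M] (X : WittVector p M)
    {i j : ℕ} (h : i ≤ j) : wadj E X i ≤ wadj E X j := by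
  apply IntermediateField.adjoin_le_iff.mpr
  rintro z ⟨l, hl, rfl⟩
  exact wadj_mem E X (by omega)

theorem as_poly {F M : Type*} [Field F] [Field M] [Algebra F M] (g : F) :
    ∃ P : F[X], P.Monic ∧ P.natDegree = p ∧
      ∀ y : M, y ^ p - y = algebraMap F M g → aeval y P = 0 := by
  have hdeg : (X + C g : F[X]).degree < (p : ℕ) := by
    rw [degree_X_add_C]; exact_mod_cast hp.out.one_lt
  refine ⟨X ^ p - (X + C g), monic_X_pow_sub hdeg, ?_, ?_⟩
  · apply natDegree_eq_of_degree_eq_some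
    rw [degree_sub_eq_left_of_degree_lt] <;> rw [degree_X_pow]
    exact hdeg
  · intro y hy
    simp only [map_sub, map_add, map_pow, aeval_X, aeval_C, ← hy]
    ring

theorem as_span {E M : Type*} [Field E] [Field M] [Algebra E M] (F : IntermediateField E M)
    (y : M) (hy : y ^ p - y ∈ F) (z : M) (hz : z ∈ IntermediateField.adjoin F {y}) :
    ∃ f : ℕ → M, (∀ l, f l ∈ F) ∧ z = ∑ l ∈ Finset.range p, f l * y ^ l := by
  set g : F := ⟨_, hy⟩ with hg
  obtain ⟨P, hP, hPd, hPy'⟩ := as_poly (p := p) (M := M) g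
  have hPy : aeval y P = 0 := hPy' y rfl
  have hal : IsAlgebraic F y := ⟨P, hP.ne_zero, hPy⟩
  have hz' : z ∈ (IntermediateField.adjoin F {y}).toSubalgebra := hz
  rw [IntermediateField.adjoin_simple_toSubalgebra_of_isAlgebraic hal,
    Algebra.adjoin_singleton_eq_range_aeval] at hz'
  obtain ⟨Q, rfl⟩ := hz'
  refine ⟨fun l => ((Q %ₘ P).coeff l : F), fun l => SetLike.coe_mem _, ?_⟩
  have h1 : aeval y Q = aeval y (Q %ₘ P) := by
    conv_lhs => rw [← modByMonic_add_div Q P]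
    simp [hPy]
  have h2 : (Q %ₘ P).natDegree < p := by
    rw [← hPd]; exact natDegree_modByMonic_lt _ hP (by
      intro h; rw [h] at hPd; simp at hPd; exact hp.out.ne_zero hPd.symm)
  change aeval y Q = _
  rw [h1, aeval_eq_sum_range' h2]
  refine Finset.sum_congr rfl fun l _ => ?_
  rw [Algebra.smul_def]; rfl

theorem wadj_succ (E : Type*) {M : Type*} [Field E] [Field M] [Algebra E M] (X : WittVector p M)
    (i : ℕ) (c : M) (hc : c ∈ wadj E X i) (z : M) (hz : z ∈ wadj E X (i + 1)) :
    z ∈ IntermediateField.adjoin (wadj E X i) {X.coeff i - c} := by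
  have h : wadj E X (i + 1) ≤
      (IntermediateField.adjoin (wadj E X i) {X.coeff i - c}).restrictScalars E := by
    apply IntermediateField.adjoin_le_iff.mpr
    rintro z ⟨l, hl, rfl⟩
    change X.coeff l ∈ IntermediateField.adjoin (wadj E X i) {X.coeff i - c}
    have hb : ∀ b ∈ wadj E X i, b ∈ IntermediateField.adjoin (wadj E X i) {X.coeff i - c} :=
      fun b hb => IntermediateField.algebraMap_mem _ (⟨b, hb⟩ : wadj E X i)
    rcases Nat.lt_succ_iff_lt_or_eq.mp hl with h | rfl
    · exact hb _ (wadj_mem E X h)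
    · have := add_mem (IntermediateField.mem_adjoin_simple_self (wadj E X l) (X.coeff l - c))
        (hb c hc)
      rwa [sub_add_cancel] at this
  exact h hz

theorem asw_g (E : Type*) {M : Type*} [Field E] [Field M] [Algebra E M] {n : ℕ}
    (X A : WittVector p M) (hA : ∀ j < n, A.coeff j ∈ (algebraMap E M).range)
    (h : ∀ j < n, X.coeff j ^ p = (X + A).coeff j) (i : ℕ) (hi : i < n) :
    X.coeff i ^ p - X.coeff i ∈ wadj E X i := by
  have hAi : ∀ j < n, A.coeff j ∈ wadj E X i := by
    intro j hj
    obtain ⟨b, hb⟩ := hA j hj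
    rw [← hb]; exact IntermediateField.algebraMap_mem _ _
  have := witt_add_coeff_mem (wadj E X i).toSubalgebra.toSubring X A i
    (fun j hj => wadj_mem E X hj) (fun j hj => hAi j (hj.trans hi))
  have h2 := add_mem this (hAi i hi : A.coeff i ∈ (wadj E X i).toSubalgebra.toSubring)
  rw [← h i hi] at h2
  have h3 : X.coeff i ^ p - X.coeff i - A.coeff i + A.coeff i = X.coeff i ^ p - X.coeff i := by
    ring
  rw [h3] at h2
  exact h2

theorem asw_le (E : Type*) {M : Type*} [Field E] [Field M] [Algebra E M] {n : ℕ}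
    (X A : WittVector p M) (hA : ∀ j < n, A.coeff j ∈ (algebraMap E M).range)
    (h : ∀ j < n, X.coeff j ^ p = (X + A).coeff j) (i : ℕ) (hi : i ≤ n) :
    FiniteDimensional E (wadj E X i) ∧ Module.finrank E (wadj E X i) ≤ p ^ i := by
  induction i with
  | zero =>
    have : wadj E X 0 = ⊥ := by
      rw [wadj]; simp
    rw [this]
    exact ⟨inferInstance, by simp⟩
  | succ i ih =>
    obtain ⟨h1, h2⟩ := ih (by omega)
    have hy := asw_g E X A hA h i (by omega)
    set F := wadj E X i with hF
    set y := X.coeff i with hydef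
    let g : F := ⟨_, hy⟩
    obtain ⟨P, hP, hPd, hPy'⟩ := as_poly (p := p) (M := M) g
    have hPy : aeval y P = 0 := hPy' y rfl
    have hIntg : IsIntegral F y := ⟨P, hP, hPy⟩
    have heq : wadj E X (i + 1) = (IntermediateField.adjoin F {y}).restrictScalars E := by
      refine Eq.trans ?_ (IntermediateField.adjoin_adjoin_left E
        {z | ∃ j < i, X.coeff j = z} {y}).symm
      rw [wadj]
      congr 1
      ext z
      constructor
      · rintro ⟨j, hj, rfl⟩
        rcases Nat.lt_succ_iff_lt_or_eq.mp hj with h | rfl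
        · exact Or.inl ⟨j, h, rfl⟩
        · exact Or.inr rfl
      · rintro (⟨j, hj, rfl⟩ | hz)
        · exact ⟨j, by omega, rfl⟩
        · exact ⟨i, by omega, hz.symm⟩
    rw [heq]
    haveI : FiniteDimensional F (IntermediateField.adjoin F {y}) :=
      IntermediateField.adjoin.finiteDimensional hIntg
    have h3 : Module.finrank F (IntermediateField.adjoin F {y}) ≤ p := by
      rw [IntermediateField.adjoin.finrank hIntg, ← hPd]
      exact natDegree_le_of_dvd (minpoly.dvd _ _ hPy) hP.ne_zero
    haveI : Module.Free F (IntermediateField.adjoin F {y}) := Module.Free.of_divisionRing _ _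
    have h4 : Module.finrank E F * Module.finrank F (IntermediateField.adjoin F {y}) =
      Module.finrank E (IntermediateField.adjoin F {y}) :=
      Module.finrank_mul_finrank E F (IntermediateField.adjoin F {y})
    constructor
    · exact (FiniteDimensional.trans E F (IntermediateField.adjoin F {y}) :)
    · change Module.finrank E (IntermediateField.adjoin F {y}) ≤ _
      rw [← h4, pow_succ]
      exact Nat.mul_le_mul h2 h3

end ASW

section ASW2
open WittVector Polynomial

variable {p : ℕ} [hp : Fact p.Prime]

theorem trunc_ext {R : Type*} [CommRing R] {n : ℕ} {X Y : WittVector p R} :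
    truncate n X = truncate n Y ↔ ∀ j < n, X.coeff j = Y.coeff j := by
  constructor
  · intro h j hj
    have := congrArg (fun T => TruncatedWittVector.coeff ⟨j, hj⟩ T) h
    simpa [coeff_truncate] using this
  · intro h
    ext i
    rw [coeff_truncate, coeff_truncate]
    exact h i i.2

theorem witt_add_congr {R : Type*} [CommRing R] {n : ℕ} {X Y X' Y' : WittVector p R}
    (hX : ∀ j < n, X.coeff j = X'.coeff j) (hY : ∀ j < n, Y.coeff j = Y'.coeff j) :
    ∀ j < n, (X + Y).coeff j = (X' + Y').coeff j := by
  rw [← trunc_ext] at *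
  rw [map_add, map_add, hX, hY]

theorem asw_eq_trunc {R : Type*} [CommRing R] [CharP R p] {n : ℕ} {X Y : WittVector p R} :
    (∀ j < n, X.coeff j ^ p = Y.coeff j) ↔ truncate n (frobenius X) = truncate n Y := by
  rw [trunc_ext]
  simp only [coeff_frobenius_charP]

theorem asw_diff {R : Type*} [CommRing R] [CharP R p] {n : ℕ} {U U' B : WittVector p R}
    (hU : ∀ j < n, U.coeff j ^ p = (U + B).coeff j)
    (hU' : ∀ j < n, U'.coeff j ^ p = (U' + B).coeff j) :
    ∀ j < n, (U - U').coeff j ^ p = (U - U').coeff j := by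
  rw [asw_eq_trunc] at *
  rw [map_sub, map_sub, hU, hU', map_sub, map_add, map_add]
  ring

theorem asw_map {R S : Type*} [CommRing R] [CommRing S] (f : R →+* S) {n : ℕ}
    {U B : WittVector p R}
    (hU : ∀ j < n, U.coeff j ^ p = (U + B).coeff j) :
    ∀ j < n, (WittVector.map f U).coeff j ^ p = (WittVector.map f U + WittVector.map f B).coeff j := by
  intro j hj
  rw [← map_add, map_coeff, map_coeff, ← hU j hj, map_pow]

theorem as_isSeparable {F M : Type*} [Field F] [Field M] [Algebra F M] [CharP F p] (g : F) (y : M)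
    (hy : y ^ p - y = algebraMap F M g) : IsSeparable F y := by
  have hP : aeval y (X ^ p - (X + C g) : F[X]) = 0 := by
    simp only [map_sub, map_add, map_pow, aeval_X, aeval_C, ← hy]; ring
  refine Separable.of_dvd ?_ (minpoly.dvd _ _ hP)
  rw [separable_def]
  have : derivative (X ^ p - (X + C g) : F[X]) = -1 := by
    simp [derivative_X_pow]
  rw [this]
  exact isCoprime_one_right.neg_right

theorem fix_bot {F : Type*} [Field F] (σ : F →+* F) (z : F) (hz : z ∈ (⊥ : Subfield F)) :
    σ z = z := by
  have : (⊥ : Subfield F) ≤ RingHom.eqLocusField σ (RingHom.id F) := bot_le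
  exact this hz

theorem asw_core {E F : Type*} [Field E] [Field F] [Algebra E F] [FiniteDimensional E F]
    [CharP E p] [CharP F p] {n : ℕ} (X : WittVector p F) (A : WittVector p E)
    (h : ∀ j < n + 1, X.coeff j ^ p = (X + WittVector.map (algebraMap E F) A).coeff j)
    (hgen : ∀ σ : F ≃ₐ[E] F, (∀ j < n + 1, σ (X.coeff j) = X.coeff j) → σ = 1)
    (hgen' : ∀ S : IntermediateField E F, (∀ j < n + 1, X.coeff j ∈ S) → S = ⊤)
    (h0 : X.coeff 0 ∉ (algebraMap E F).range) :
    ∃ σ : F ≃ₐ[E] F, orderOf σ = p ^ (n + 1) := by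
  let Ω := AlgebraicClosure F
  haveI : CharP Ω p := charP_of_injective_algebraMap (algebraMap F Ω).injective p
  -- an embedding moving the first coordinate
  have hsep : IsSeparable E (X.coeff 0) := by
    apply as_isSeparable (p := p) (A.coeff 0)
    rw [h 0 (by omega), add_coeff_zero, map_coeff]; ring
  have hIntg : ∀ s : F, IsIntegral E s ∧ (Polynomial.map (algebraMap E Ω) (minpoly E s)).Splits :=
    fun s => ⟨Algebra.IsIntegral.isIntegral s, IsAlgClosed.splits _⟩
  obtain ⟨τ, hτ⟩ : ∃ τ : F →ₐ[E] Ω, τ (X.coeff 0) ≠ algebraMap F Ω (X.coeff 0) := by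
    have hc := card_rootSet_eq_natDegree (K := Ω) hsep (hIntg _).2
    have hd : 1 < (minpoly E (X.coeff 0)).natDegree := by
      have h1 := minpoly.natDegree_pos (hIntg (X.coeff 0)).1
      have h2 : (minpoly E (X.coeff 0)).natDegree ≠ 1 := fun h => h0
        (minpoly.natDegree_eq_one_iff.mp h)
      omega
    rw [← hc, Fintype.one_lt_card_iff] at hd
    obtain ⟨⟨a, ha⟩, ⟨b, hb⟩, hab⟩ := hd
    have hab' : a ≠ b := fun h => hab (by subst h; rfl)
    have ha' := (mem_rootSet.mp ha).2
    have hb' := (mem_rootSet.mp hb).2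
    obtain ⟨ta, hta⟩ := IntermediateField.exists_algHom_of_splits_of_aeval hIntg ha'
    obtain ⟨tb, htb⟩ := IntermediateField.exists_algHom_of_splits_of_aeval hIntg hb'
    by_cases hh : a = algebraMap F Ω (X.coeff 0)
    · exact ⟨tb, by rw [htb, ← hh]; exact hab'.symm⟩
    · exact ⟨ta, by rw [hta]; exact hh⟩
  let inc : F →ₐ[E] Ω := IsScalarTower.toAlgHom E F Ω
  have hB : ∀ f : F →ₐ[E] Ω, WittVector.map (f : F →+* Ω) (WittVector.map (algebraMap E F) A) =
      WittVector.map (algebraMap E Ω) A := by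
    intro f; ext j; simp [map_coeff]
  have e1 := asw_map (τ : F →+* Ω) h
  have e2 := asw_map (inc : F →+* Ω) h
  rw [hB] at e1 e2
  have e3 := asw_diff e1 e2
  -- the image of `τ` is contained in `F`
  have hrange : ∀ j < n + 1, τ (X.coeff j) ∈ inc.fieldRange := by
    have hmem : ∀ j < n + 1, (WittVector.map (τ : F →+* Ω) X - WittVector.map (inc : F →+* Ω) X).coeff j
        ∈ inc.fieldRange := by
      intro j hj
      have := (Subfield.mem_bot_iff_pow_eq_self Ω p).mpr (e3 j hj)
      exact (bot_le : (⊥ : Subfield Ω) ≤ inc.fieldRange.toSubfield) this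
    set U := WittVector.map (τ : F →+* Ω) X with hU
    set U' := WittVector.map (inc : F →+* Ω) X with hU'
    have h3 : U = (U - U') + U' := by ring
    intro j hj
    have h4 : τ (X.coeff j) = U.coeff j := by rw [hU, map_coeff]; rfl
    rw [h4, h3]
    rw [witt_add_congr (n := n + 1) (X' := WittVector.init (n + 1) (U - U')) (Y' := U')
      (fun j hj => (witt_init_coeff_lt _ hj).symm) (fun j hj => rfl) j hj]
    refine witt_add_mem inc.fieldRange.toSubalgebra.toSubring _ _ ?_ ?_ j
    · intro j
      rcases lt_or_ge j (n + 1) with h | h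
      · rw [witt_init_coeff_lt _ h]; exact hmem j h
      · rw [witt_init_coeff_ge _ h]; exact zero_mem _
    · intro j
      rw [hU', map_coeff]
      exact ⟨X.coeff j, rfl⟩
  have htop : inc.fieldRange.comap τ = ⊤ := hgen' _ hrange
  have hall : ∀ z : F, ∃ y : F, inc y = τ z := by
    intro z
    have : z ∈ inc.fieldRange.comap τ := by rw [htop]; trivial
    exact this
  have hinj : Function.Injective inc := inc.toRingHom.injective
  choose s hs using hall
  let σ0 : F →ₐ[E] F :=
    { toFun := s
      map_one' := hinj (by rw [hs, map_one, map_one])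
      map_mul' := fun a b => hinj (by rw [hs, map_mul, map_mul, hs, hs])
      map_zero' := hinj (by rw [hs, map_zero, map_zero])
      map_add' := fun a b => hinj (by rw [hs, map_add, map_add, hs, hs])
      commutes' := fun a => hinj (by rw [hs, AlgHom.commutes, AlgHom.commutes]) }
  let σ : F ≃ₐ[E] F := Algebra.IsAlgebraic.algEquivEquivAlgHom E F |>.symm σ0
  have hσ0 : σ (X.coeff 0) ≠ X.coeff 0 := by
    intro hh
    apply hτ
    have h1 : inc (σ0 (X.coeff 0)) = τ (X.coeff 0) := hs _
    rw [← h1]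
    exact congrArg inc hh
  -- the cocycle
  have hA : ∀ f : F ≃ₐ[E] F, WittVector.map (f : F →+* F) (WittVector.map (algebraMap E F) A) =
      WittVector.map (algebraMap E F) A := by
    intro f; ext j; simp [map_coeff]
  have e4 := asw_map (σ : F →+* F) h
  rw [hA] at e4
  have e5 := asw_diff e4 h
  set Z := WittVector.map (σ : F →+* F) X - X with hZ
  have hσZ : truncate (n + 1) (WittVector.map (σ : F →+* F) Z) = truncate (n + 1) Z := by
    rw [trunc_ext]
    intro j hj
    rw [map_coeff]
    exact fix_bot _ _ ((Subfield.mem_bot_iff_pow_eq_self F p).mpr (e5 j hj))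
  have hmapt : ∀ U V : WittVector p F, truncate (n + 1) U = truncate (n + 1) V →
      truncate (n + 1) (WittVector.map (σ : F →+* F) U) =
      truncate (n + 1) (WittVector.map (σ : F →+* F) V) := by
    intro U V hUV
    rw [trunc_ext] at *
    intro j hj
    rw [map_coeff, map_coeff, hUV j hj]
  have hpow : ∀ m : ℕ, truncate (n + 1) (WittVector.map ((σ ^ m : F ≃ₐ[E] F) : F →+* F) X) =
      truncate (n + 1) (X + Z * (m : WittVector p F)) := by
    intro m
    induction m with
    | zero => simp only [Nat.cast_zero, mul_zero, add_zero]; rw [trunc_ext]; intro j hj; rfl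
    | succ m ih =>
      have h1 : WittVector.map ((σ ^ (m + 1) : F ≃ₐ[E] F) : F →+* F) X =
          WittVector.map (σ : F →+* F) (WittVector.map ((σ ^ m : F ≃ₐ[E] F) : F →+* F) X) := by
        ext j
        simp only [map_coeff, pow_succ']
        rfl
      rw [h1, hmapt _ _ ih, map_add, map_mul, map_add, map_mul, hσZ, map_natCast]
      have h2 : WittVector.map (σ : F →+* F) X = Z + X := by rw [hZ]; ring
      rw [h2]
      simp only [map_add, map_mul]
      push_cast
      rw [map_add, map_one]
      ring
  have hone : ∀ m : ℕ, σ ^ m = 1 ↔ ∀ j < n + 1, (Z * (m : WittVector p F)).coeff j = 0 := by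
    intro m
    have h1 : (∀ j < n + 1, (Z * (m : WittVector p F)).coeff j = 0) ↔
        truncate (n + 1) (WittVector.map ((σ ^ m : F ≃ₐ[E] F) : F →+* F) X) = truncate (n + 1) X := by
      rw [hpow, map_add]
      have : (∀ j < n + 1, (Z * (m : WittVector p F)).coeff j = 0) ↔
          truncate (n + 1) (Z * (m : WittVector p F)) = truncate (n + 1) 0 := by
        rw [trunc_ext]; simp only [zero_coeff]
      rw [this, map_zero]
      simp
    rw [h1, trunc_ext]
    constructor
    · intro h j hj; rw [h, map_coeff]; rfl
    · intro h
      apply hgen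
      intro j hj
      have := h j hj
      rw [map_coeff] at this
      exact this
  refine ⟨σ, orderOf_eq_prime_pow ?_ ?_⟩
  · rw [hone]
    intro hh
    have h1 := hh n (by omega)
    have h2 := mul_pow_charP_coeff_succ Z (m := 0) (n := n)
    push_cast at h1
    rw [zero_add, h1] at h2
    have h3 : Z.coeff 0 = 0 := pow_eq_zero_iff (pow_ne_zero _ hp.out.ne_zero) |>.mp h2.symm
    apply hσ0
    have h4 : WittVector.map (σ : F →+* F) X = Z + X := by rw [hZ]; ring
    have h5 := congrArg (fun W => WittVector.coeff W 0) h4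
    simp only [add_coeff_zero, h3, zero_add, map_coeff] at h5
    exact h5
  · rw [hone]
    intro j hj
    push_cast
    exact mul_pow_charP_coeff_zero Z hj

theorem asw_main (E : Type*) {M : Type*} [Field E] [Field M] [Algebra E M] [CharP E p] {n : ℕ}
    (hn : 1 ≤ n) (X A : WittVector p M) (hA : ∀ j < n, A.coeff j ∈ (algebraMap E M).range)
    (h : ∀ j < n, X.coeff j ^ p = (X + A).coeff j) (h0 : X.coeff 0 ∉ (algebraMap E M).range) :
    FiniteDimensional E (wadj E X n) ∧ Module.finrank E (wadj E X n) = p ^ n ∧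
    IsGalois E (wadj E X n) ∧ IsCyclic ((wadj E X n) ≃ₐ[E] (wadj E X n)) := by
  obtain ⟨hfd, hle⟩ := asw_le E X A hA h n le_rfl
  obtain ⟨n, rfl⟩ : ∃ n', n = n' + 1 := ⟨n - 1, by omega⟩
  set F := wadj E X (n + 1) with hF
  haveI : CharP F p := charP_of_injective_algebraMap (algebraMap E F).injective p
  choose! b hb using hA
  let AE : WittVector p E := WittVector.mk p b
  let XF : WittVector p F := WittVector.mk p fun j => if hj : j < n + 1 then
    ⟨X.coeff j, wadj_mem E X hj⟩ else 0
  have hXF : ∀ j < n + 1, (XF.coeff j : M) = X.coeff j := by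
    intro j hj; simp only [XF, coeff_mk, dif_pos hj]
  have heq : ∀ j < n + 1, XF.coeff j ^ p = (XF + WittVector.map (algebraMap E F) AE).coeff j := by
    intro j hj
    apply (algebraMap F M).injective
    rw [map_pow, ← map_coeff (algebraMap F M) (_ + _), map_add]
    change (XF.coeff j : M) ^ p = _
    rw [hXF j hj, h j hj]
    symm
    refine witt_add_congr ?_ ?_ j hj
    · intro j hj; rw [map_coeff]; exact hXF j hj
    · intro j hj; rw [map_coeff, map_coeff, ← hb j hj]; rfl
  obtain ⟨σ, hσ⟩ := asw_core XF AE heq (by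
    intro σ hσ
    have : (σ : F →ₐ[E] F) = AlgHom.id E F := by
      apply IntermediateField.algHom_ext_of_eq_adjoin E hF
      rintro x ⟨j, hj, rfl⟩
      have h1 := hσ j hj
      have h2 : XF.coeff j = ⟨X.coeff j, wadj_mem E X hj⟩ := Subtype.ext (hXF j hj)
      rw [h2] at h1
      exact h1
    ext1 z
    exact DFunLike.congr_fun this z) (by
    intro S hS
    have h1 : F ≤ S.map F.val := by
      apply IntermediateField.adjoin_le_iff.mpr
      rintro z ⟨j, hj, rfl⟩
      exact ⟨XF.coeff j, hS j hj, hXF j hj⟩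
    rw [eq_top_iff]
    intro z _
    obtain ⟨w, hw, hwz⟩ := h1 z.2
    have : w = z := Subtype.ext hwz
    rw [← this]; exact hw) (by
    rintro ⟨c, hc⟩
    apply h0
    refine ⟨c, ?_⟩
    rw [← hXF 0 (by omega), ← hc]; rfl)
  have hcard : p ^ (n + 1) ≤ Nat.card (F ≃ₐ[E] F) := by
    rw [← hσ]; exact Nat.le_of_dvd Nat.card_pos (orderOf_dvd_natCard σ)
  have hle2 : Nat.card (F ≃ₐ[E] F) ≤ Module.finrank E F := by
    rw [Nat.card_eq_fintype_card]; exact AlgEquiv.card_le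
  have hfin : Module.finrank E F = p ^ (n + 1) := by omega
  refine ⟨hfd, hfin, IsGalois.of_card_aut_eq_finrank E F (by omega),
    isCyclic_of_orderOf_eq_card σ (by omega)⟩

end ASW2

section Laurent

variable {k : Type*} [Field k]

theorem lsVal_ge {x : LaurentSeries k} {d : ℤ} :
    ((d : ℤ) : WithTop ℤ) ≤ lsVal x ↔ ∀ j < d, x.coeff j = 0 := by
  unfold lsVal
  split_ifs with h
  · subst h; simp
  · rw [WithTop.coe_le_coe]
    constructor
    · intro hd j hj
      exact HahnSeries.coeff_eq_zero_of_lt_order (lt_of_lt_of_le hj hd)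
    · intro hj
      by_contra hcon
      exact HahnSeries.coeff_order_eq_zero.not.mpr h (hj _ (not_le.mp hcon))

/-- The Euler derivation `t d/dt` on Laurent series. -/
def eulerFun (x : LaurentSeries k) : LaurentSeries k where
  coeff j := (j : k) * x.coeff j
  isPWO_support' := x.isPWO_support.mono (by
    intro j hj h
    apply hj
    simp only [h, mul_zero])

theorem eulerFun_coeff (x : LaurentSeries k) (j : ℤ) :
    (eulerFun x).coeff j = (j : k) * x.coeff j := rfl

theorem eulerFun_support (x : LaurentSeries k) : (eulerFun x).support ⊆ x.support := by
  intro j hj h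
  apply hj
  simp only [eulerFun_coeff, h, mul_zero]

theorem eulerFun_add (x y : LaurentSeries k) : eulerFun (x + y) = eulerFun x + eulerFun y := by
  ext j
  simp only [eulerFun_coeff, HahnSeries.coeff_add]
  ring

theorem eulerFun_mul (x y : LaurentSeries k) :
    eulerFun (x * y) = x * eulerFun y + y * eulerFun x := by
  rw [mul_comm y]
  ext j
  rw [HahnSeries.coeff_add, eulerFun_coeff, HahnSeries.coeff_mul,
    HahnSeries.coeff_mul_right' y.isPWO_support (eulerFun_support y),
    HahnSeries.coeff_mul_left' x.isPWO_support (eulerFun_support x), Finset.mul_sum,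
    ← Finset.sum_add_distrib]
  refine Finset.sum_congr rfl fun ij hij => ?_
  have h := (Finset.mem_antidiagonal.mp hij).2.2
  rw [eulerFun_coeff, eulerFun_coeff, ← h]
  push_cast
  ring

variable {K : Type*} [Field K]

/-- The Euler derivation on a local field. -/
def eulerK (ι : K ≃+* LaurentSeries k) : Derivation ℤ K K :=
  Derivation.mk'
    ((AddMonoidHom.mk' (fun x : K => ι.symm (eulerFun (ι x))) (by
      intro a b; rw [map_add, eulerFun_add, map_add])).toIntLinearMap) (by
    intro a b
    change ι.symm (eulerFun (ι (a * b))) = a * ι.symm (eulerFun (ι b)) + b * ι.symm (eulerFun (ι a))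
    rw [map_mul, eulerFun_mul, map_add, map_mul, map_mul]
    simp)

theorem eulerK_apply (ι : K ≃+* LaurentSeries k) (x : K) :
    eulerK ι x = ι.symm (eulerFun (ι x)) := rfl

theorem lfVal_eulerK (ι : K ≃+* LaurentSeries k) (x : K) (h : ((0 : ℤ) : WithTop ℤ) ≤ lfVal ι x) :
    ((1 : ℤ) : WithTop ℤ) ≤ lfVal ι (eulerK ι x) := by
  unfold lfVal at *
  rw [eulerK_apply, RingEquiv.apply_symm_apply]
  rw [lsVal_ge] at *
  intro j hj
  rw [eulerFun_coeff]
  rcases eq_or_ne j 0 with rfl | h0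
  · simp
  · rw [h j (by omega), mul_zero]

/-- The uniformizer. -/
def tK (ι : K ≃+* LaurentSeries k) : K := ι.symm (HahnSeries.single 1 1)

theorem lfVal_tK (ι : K ≃+* LaurentSeries k) : lfVal ι (tK ι) = ((1 : ℤ) : WithTop ℤ) := by
  unfold lfVal tK lsVal
  rw [RingEquiv.apply_symm_apply, if_neg (by simp), HahnSeries.order_single one_ne_zero]

theorem eulerK_tK (ι : K ≃+* LaurentSeries k) : eulerK ι (tK ι) = tK ι := by
  rw [eulerK_apply]
  unfold tK
  congr 1
  rw [RingEquiv.apply_symm_apply]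
  ext j
  rw [eulerFun_coeff, HahnSeries.coeff_single]
  split_ifs with h
  · subst h; simp
  · simp

theorem lfVal_res (ι : K ≃+* LaurentSeries k) (x : K) (h : ((0 : ℤ) : WithTop ℤ) ≤ lfVal ι x) :
    ((1 : ℤ) : WithTop ℤ) ≤ lfVal ι (x - ι.symm (HahnSeries.C ((ι x).coeff 0))) := by
  unfold lfVal at *
  rw [map_sub, RingEquiv.apply_symm_apply]
  rw [lsVal_ge] at *
  intro j hj
  rw [HahnSeries.coeff_sub, HahnSeries.C_apply, HahnSeries.coeff_single]
  split_ifs with h0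
  · subst h0; simp
  · rw [h j (by omega), sub_zero]

theorem lfVal_hensel {p : ℕ} [hp : Fact p.Prime] [CharP k p]
    (ι : K ≃+* LaurentSeries k) (x : K) (h : ((0 : ℤ) : WithTop ℤ) ≤ lfVal ι x)
    (c : k) (hc : c ^ p - c = (ι x).coeff 0) : ∃ b : K, b ^ p - b = x := by
  unfold lfVal at h
  rw [lsVal_ge] at h
  let a : PowerSeries k := PowerSeries.mk fun j => (ι x).coeff j
  have ha : (HahnSeries.ofPowerSeries ℤ k a) = ι x := by
    ext j
    rcases lt_or_ge j 0 with hj | hj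
    · rw [h j hj]
      apply HahnSeries.embDomain_of_notMem_range
      rintro ⟨y, rfl⟩
      exact absurd hj (not_lt.mpr (Int.natCast_nonneg y))
    · obtain ⟨j, rfl⟩ := Int.eq_ofNat_of_zero_le hj
      rw [HahnSeries.ofPowerSeries_apply_coeff]
      simp [a]
  let I : Ideal (PowerSeries k) := Ideal.span {PowerSeries.X}
  haveI : HenselianRing (PowerSeries k) I := inferInstance
  have hdeg : (Polynomial.X + Polynomial.C a : Polynomial (PowerSeries k)).degree < (p : ℕ) := by
    rw [Polynomial.degree_X_add_C]; exact_mod_cast hp.out.one_lt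
  obtain ⟨b, hb, -⟩ := HenselianRing.is_henselian (I := I)
    (Polynomial.X ^ p - (Polynomial.X + Polynomial.C a)) (Polynomial.monic_X_pow_sub hdeg)
    (PowerSeries.C c) (by
      rw [Ideal.mem_span_singleton, PowerSeries.X_dvd_iff]
      simp only [Polynomial.eval_sub, Polynomial.eval_add, Polynomial.eval_pow, Polynomial.eval_X,
        Polynomial.eval_C, map_sub, map_add, map_pow, PowerSeries.constantCoeff_C]
      have : PowerSeries.constantCoeff a = (ι x).coeff 0 := by
        rw [← PowerSeries.coeff_zero_eq_constantCoeff_apply]; simp [a]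
      rw [this, ← hc]; ring) (by
      haveI : CharP (PowerSeries k) p :=
        charP_of_injective_algebraMap (algebraMap k (PowerSeries k)).injective p
      have : Polynomial.derivative (Polynomial.X ^ p - (Polynomial.X + Polynomial.C a)) = -1 := by
        simp [Polynomial.derivative_X_pow]
      rw [this]
      apply IsUnit.map
      rw [Polynomial.eval_neg, Polynomial.eval_one]
      exact isUnit_one.neg)
  refine ⟨ι.symm (HahnSeries.ofPowerSeries ℤ k b), ?_⟩
  have hb2 : b ^ p - b = a := by
    have := hb.eq_zero
    simp only [Polynomial.eval_sub, Polynomial.eval_add, Polynomial.eval_pow, Polynomial.eval_X,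
        Polynomial.eval_C] at this
    linear_combination this
  apply ι.injective
  rw [map_sub, map_pow, RingEquiv.apply_symm_apply, ← ha, ← hb2, map_sub, map_pow]

/-- Extension of derivations to separable extensions. -/
theorem exists_deriv {L : Type*} [Field L] [Algebra K L] [Algebra.IsSeparable K L]
    (d : Derivation ℤ K K) : ∃ D : Derivation ℤ L L, ∀ x : K,
      D (algebraMap K L x) = algebraMap K L (d x) := by
  haveI : Algebra.FormallyEtale K L := Algebra.FormallyEtale.of_isSeparable K L
  have hB := KaehlerDifferential.isBaseChange_of_formallyEtale ℤ K L
  let f : (KaehlerDifferential ℤ K) →ₗ[K] L :=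
    (Algebra.linearMap K L).comp d.liftKaehlerDifferential
  let g : (KaehlerDifferential ℤ L) →ₗ[L] L := hB.lift f
  refine ⟨g.compDer (KaehlerDifferential.D ℤ L), fun x => ?_⟩
  have h1 := hB.lift_eq f (KaehlerDifferential.D ℤ K x)
  rw [KaehlerDifferential.map_D] at h1
  change g (KaehlerDifferential.D ℤ L (algebraMap K L x)) = _
  rw [h1]
  simp [f]

end Laurent

section Setup
open WittVector

/-- The conjectural upper breaks. -/
def cc (p r : ℕ) (m : ℕ → ℤ) : ℕ → ℤ
  | 0 => 0
  | s + 1 => max (p * cc p r m s) (m (r + s))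

/-- The lower breaks. -/
def bb (p r : ℕ) (m : ℕ → ℤ) : ℕ → ℤ
  | 0 => 0
  | s + 1 => bb p r m s + p ^ s * (cc p r m (s + 1) - cc p r m s)

theorem cc_nonneg (p r : ℕ) (m : ℕ → ℤ) (s : ℕ) : 0 ≤ cc p r m s := by
  induction s with
  | zero => exact le_rfl
  | succ s ih => exact le_trans (mul_nonneg (by positivity) ih) (le_max_left _ _)

/-- The indexed version of `cc`. -/
def Cj (p r : ℕ) (m : ℕ → ℤ) (j : ℕ) : ℤ := cc p r m (j + 1 - r)

theorem Cj_nonneg (p r : ℕ) (m : ℕ → ℤ) (j : ℕ) : 0 ≤ Cj p r m j := cc_nonneg _ _ _ _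

theorem Cj_lt {p r : ℕ} {m : ℕ → ℤ} {j : ℕ} (h : j < r) : Cj p r m j = 0 := by
  unfold Cj; rw [show j + 1 - r = 0 by omega]; rfl

theorem Cj_succ {p r : ℕ} {m : ℕ → ℤ} {j : ℕ} (h : r ≤ j + 1) :
    Cj p r m (j + 1) = max (p * Cj p r m j) (m (j + 1)) := by
  unfold Cj; rw [show j + 1 + 1 - r = (j + 1 - r) + 1 by omega, cc,
    show r + (j + 1 - r) = j + 1 by omega]

theorem Cj_r {p r : ℕ} {m : ℕ → ℤ} : Cj p r m r = max 0 (m r) := by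
  unfold Cj; rw [show r + 1 - r = 0 + 1 by omega, cc, cc, mul_zero, add_zero]

theorem Cj_step (p r : ℕ) (m : ℕ → ℤ) (j : ℕ) : p * Cj p r m j ≤ Cj p r m (j + 1) := by
  rcases le_or_gt r (j + 1) with h | h
  · rw [Cj_succ h]; exact le_max_left _ _
  · rw [Cj_lt h, Cj_lt (show j < r by omega), mul_zero]

theorem Cj_pow (p r : ℕ) (m : ℕ → ℤ) {i j : ℕ} (h : j ≤ i) :
    (p : ℤ) ^ (i - j) * Cj p r m j ≤ Cj p r m i := by
  obtain ⟨d, rfl⟩ := Nat.exists_eq_add_of_le h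
  rw [Nat.add_sub_cancel_left]
  clear h
  induction d with
  | zero => simp
  | succ d ih =>
    refine le_trans ?_ (Cj_step p r m (j + d))
    rw [pow_succ', mul_assoc]
    exact mul_le_mul_of_nonneg_left ih (by positivity)

/-- The collected data. -/
structure Stp (p : ℕ) [Fact p.Prime] (k K : Type*) {L κ : Type*} [Field k] [Field K] [Field L]
    [Field κ] [Algebra K L] [Algebra k κ] [CharP L p] {v : L → WithTop ℤ} (hv : IsNormVal v) (e : ℤ) (t : L)
    (D : Derivation ℤ L L) (res : valRing v hv →+* κ) (X A : WittVector p L) (n r : ℕ)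
    (m : ℕ → ℤ) : Prop where
  e_pos : 0 < e
  vt : v t = (e : WithTop ℤ)
  Dt : D t = t
  tK : t ∈ (algebraMap K L).range
  kval : ∀ f : K, f ≠ 0 → ∃ w : ℤ, v (algebraMap K L f) = ((e * w : ℤ) : WithTop ℤ)
  kD : ∀ f : K, ((0 : ℤ) : WithTop ℤ) ≤ v (algebraMap K L f) →
    (e : WithTop ℤ) ≤ v (D (algebraMap K L f))
  kperf : ∀ f : K, ((0 : ℤ) : WithTop ℤ) ≤ v (algebraMap K L f) →
    ∃ h : K, ((0 : ℤ) : WithTop ℤ) ≤ v (algebraMap K L h) ∧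
      ((1 : ℤ) : WithTop ℤ) ≤ v (algebraMap K L f - algebraMap K L h ^ p)
  kres : ∀ (f : K) (hf : algebraMap K L f ∈ valRing v hv), ∃ c : k,
    res ⟨algebraMap K L f, hf⟩ = algebraMap k κ c
  res_zero : ∀ z : valRing v hv, res z = 0 ↔ ((1 : ℤ) : WithTop ℤ) ≤ v z
  A_mem : ∀ j, A.coeff j ∈ (algebraMap K L).range
  eq : ∀ j < n, X.coeff j ^ p = (X + A).coeff j
  r1 : 1 ≤ r
  rn : r ≤ n
  A_lt : ∀ j < r, ((0 : ℤ) : WithTop ℤ) ≤ v (A.coeff j)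
  A_ge : ∀ j, r ≤ j → j < n → (((0 : ℤ) : WithTop ℤ) ≤ v (A.coeff j) ∧ m j ≤ 0) ∨
    (v (A.coeff j) = ((e * (-m j) : ℤ) : WithTop ℤ) ∧ 0 < m j ∧ ¬ (p : ℤ) ∣ m j)
  A_r : r < n → 0 < m r
  x0 : ∀ h : X.coeff 0 ∈ valRing v hv, res ⟨X.coeff 0, h⟩ ∉ (algebraMap k κ).range

variable {p : ℕ} [hp : Fact p.Prime] {k K L κ : Type*} [Field k] [Field K] [Field L]
    [Field κ] [Algebra K L] [Algebra k κ] [CharP L p] {v : L → WithTop ℤ} {hv : IsNormVal v} {e : ℤ} {t : L}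
    {D : Derivation ℤ L L} {res : valRing v hv →+* κ} {X A : WittVector p L} {n r : ℕ}
    {m : ℕ → ℤ}

theorem mem_valRing {z : L} : z ∈ valRing v hv ↔ ((0 : ℤ) : WithTop ℤ) ≤ v z := Iff.rfl

theorem D_pow_p (D : Derivation ℤ L L) (z : L) : D (z ^ p) = 0 := by
  rw [Derivation.leibniz_pow]
  simp

theorem Stp.bA (S : Stp p k K hv e t D res X A n r m) (j : ℕ) (hj : j < n) :
    ((-(e * Cj p r m j) : ℤ) : WithTop ℤ) ≤ v (A.coeff j) := by
  have he := S.e_pos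
  have h0 := Cj_nonneg p r m j
  rcases lt_or_ge j r with h | h
  · exact nv_mono (S.A_lt j h) (by nlinarith)
  · rcases S.A_ge j h hj with ⟨h1, h2⟩ | ⟨h1, h2, h3⟩
    · exact nv_mono h1 (by nlinarith)
    · refine nv_ge_of h1 ?_
      have : m j ≤ Cj p r m j := by
        rcases Nat.eq_or_lt_of_le h with rfl | h'
        · rw [Cj_r]; exact le_max_right _ _
        · obtain ⟨j', rfl⟩ : ∃ j', j = j' + 1 := ⟨j - 1, by omega⟩
          rw [Cj_succ (by omega)]; exact le_max_right _ _
      nlinarith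

theorem Stp.bX (S : Stp p k K hv e t D res X A n r m) (j : ℕ) (hj : j < n) :
    ((-(e * Cj p r m j) : ℤ) : WithTop ℤ) ≤ v (X.coeff j ^ p) := by
  have he := S.e_pos
  have hp2 : (2 : ℤ) ≤ p := by exact_mod_cast hp.out.two_le
  induction j using Nat.strong_induction_on with
  | _ i ih =>
  by_contra hcon
  obtain ⟨d', hd', hlt'⟩ := nv_not_ge hcon
  have hne : X.coeff i ≠ 0 := by
    intro h; rw [h, zero_pow hp.out.ne_zero] at hd'
    exact nv_ne hv hd' rfl
  obtain ⟨d, hd⟩ := nv_fin hv hne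
  have hdd := nv_inj hd' (nv_pow hv hd p)
  have h0 := mul_nonneg he.le (Cj_nonneg p r m i)
  have hd0 : d < 0 := by nlinarith
  have hpw : ∀ j ≤ i, -(e * Cj p r m i) ≤ ((p ^ (i - j) : ℕ) : ℤ) * (-(e * Cj p r m j)) := by
    intro j hj
    have := mul_le_mul_of_nonneg_left (Cj_pow p r m hj) he.le
    push_cast
    nlinarith
  have key := witt_isobaric hv X A i (max (e * Cj p r m i) (-d)) ?_ ?_
  · rw [← S.eq i hj, hd'] at key
    have key' : -(max (e * Cj p r m i) (-d)) ≤ d' := by exact_mod_cast key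
    rcases max_cases (e * Cj p r m i) (-d) with ⟨h1, h2⟩ | ⟨h1, h2⟩ <;> rw [h1] at key' <;> nlinarith
  · intro j hji
    rcases Nat.eq_or_lt_of_le hji with rfl | hlt
    · rw [Nat.sub_self, pow_zero, pow_one]
      exact nv_ge_of hd (by have := le_max_right (e * Cj p r m j) (-d); linarith)
    · have h1 := ih j hlt (by omega)
      have h2 : X.coeff j ^ p ^ (i - j) = (X.coeff j ^ p) ^ p ^ (i - j - 1) := by
        rw [← pow_mul, ← pow_succ']; congr 2; omega
      rw [h2]
      refine nv_mono (nv_ge_pow hv h1 _) ?_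
      have h3 := hpw j hji
      have h4 := le_max_left (e * Cj p r m i) (-d)
      have h5 : ((p ^ (i - j) : ℕ) : ℤ) = p * ((p ^ (i - j - 1) : ℕ) : ℤ) := by
        rw [show i - j = (i - j - 1) + 1 by omega, pow_succ']; push_cast; simp
      rw [h5] at h3
      have h6 : 0 ≤ ((p ^ (i - j - 1) : ℕ) : ℤ) * (e * Cj p r m j) :=
        mul_nonneg (by positivity) (mul_nonneg he.le (Cj_nonneg p r m j))
      nlinarith
  · intro j hji
    refine nv_mono (nv_ge_pow hv (S.bA j (by omega)) _) ?_
    have := le_max_left (e * Cj p r m i) (-d)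
    linarith [hpw j hji]

theorem Stp.X_int (S : Stp p k K hv e t D res X A n r m) (j : ℕ) (hj : j < r) :
    ((0 : ℤ) : WithTop ℤ) ≤ v (X.coeff j) := by
  have h := S.bX j (lt_of_lt_of_le hj S.rn)
  rw [Cj_lt hj, mul_zero, neg_zero] at h
  by_contra hcon
  obtain ⟨d, hd, hd0⟩ := nv_not_ge hcon
  have h1 := nv_le_of (nv_pow hv hd p) h
  have hp2 : (2 : ℤ) ≤ p := by exact_mod_cast hp.out.two_le
  nlinarith

theorem Stp.D_X (S : Stp p k K hv e t D res X A n r m) (i : ℕ) (hi : i < n) :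
    D (X.coeff i) = - wth D i A -
      ∑ j ∈ Finset.range i, X.coeff j ^ (p ^ (i - j) - 1) * D (X.coeff j) := by
  have h := wth_add D i X A
  have h0 : wth D i (X + A) = 0 := by
    unfold wth
    refine Finset.sum_eq_zero fun j hj => ?_
    rw [Finset.mem_range] at hj
    rw [← S.eq j (by omega), D_pow_p, mul_zero]
  rw [h0] at h
  have h1 : wth D i X = ∑ j ∈ Finset.range i, X.coeff j ^ (p ^ (i - j) - 1) * D (X.coeff j)
      + D (X.coeff i) := by
    unfold wth
    rw [Finset.sum_range_succ]; simp
  rw [h1] at h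
  linear_combination -h

/-- Behaviour of `D` on a subfield on which it is unramified. -/
theorem Stp.D_unram (S : Stp p k K hv e t D res X A n r m) (F : IntermediateField K L)
    (h2 : ∀ z ∈ F, ((0 : ℤ) : WithTop ℤ) ≤ v z → (e : WithTop ℤ) ≤ v (D z))
    (z : L) (hz : z ∈ F) (w : ℤ) (hw : v z = ((e * w : ℤ) : WithTop ℤ)) :
    ((e * w : ℤ) : WithTop ℤ) ≤ v (D z) ∧
      (¬ (p : ℤ) ∣ w → v (D z) = ((e * w : ℤ) : WithTop ℤ)) := by
  have he := S.e_pos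
  obtain ⟨t', ht'⟩ := S.tK
  have htF : t ∈ F := by rw [← ht']; exact F.algebraMap_mem _
  have ht0 : t ≠ 0 := nv_ne hv S.vt
  have hwt : v (t ^ w) = ((e * w : ℤ) : WithTop ℤ) := by
    rw [nv_zpow hv S.vt]; congr 1; ring
  have hwt' : v (t ^ (-w)) = ((e * (-w) : ℤ) : WithTop ℤ) := by
    rw [nv_zpow hv S.vt]; congr 1; ring
  set u := t ^ (-w) * z with hu
  have huF : u ∈ F := mul_mem (zpow_mem htF _) hz
  have hu0 : v u = ((0 : ℤ) : WithTop ℤ) := by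
    rw [hu, nv_mul hv hwt' hw]; congr 1; ring
  have hzu : z = t ^ w * u := by
    rw [hu, ← mul_assoc, ← zpow_add₀ ht0, add_neg_cancel, zpow_zero, one_mul]
  have hDt : D (t ^ w) = (w : L) * t ^ w := by
    rw [Derivation.leibniz_zpow, S.Dt, zsmul_eq_mul, smul_eq_mul, zpow_sub_one₀ ht0]
    field_simp
  have hDz : D z = (w : L) * (t ^ w * u) + t ^ w * D u := by
    rw [hzu, Derivation.leibniz, hDt, smul_eq_mul, smul_eq_mul]; ring
  have hDu := nv_ge_mul hv hwt.ge (h2 u huF hu0.ge)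
  have htu := nv_mul hv hwt hu0
  rw [hDz]
  constructor
  · by_cases hpw : (p : ℤ) ∣ w
    · have : (w : L) = 0 := (CharP.intCast_eq_zero_iff L p w).mpr hpw
      rw [this, zero_mul, zero_add]
      exact nv_mono hDu (by linarith)
    · have := nv_mul hv (nv_intCast hv hpw) htu
      exact nv_ge_add hv (nv_ge_of this (by linarith)) (nv_mono hDu (by linarith))
  · intro hpw
    have := nv_mul hv (nv_intCast hv hpw) htu
    rw [nv_add hv this hDu (by linarith)]
    congr 1; ring

theorem Stp.D_K (S : Stp p k K hv e t D res X A n r m)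
    (z : L) (hz : z ∈ (algebraMap K L).range) (w : ℤ) (hw : v z = ((e * w : ℤ) : WithTop ℤ)) :
    ((e * w : ℤ) : WithTop ℤ) ≤ v (D z) ∧
      (¬ (p : ℤ) ∣ w → v (D z) = ((e * w : ℤ) : WithTop ℤ)) := by
  refine S.D_unram ⊥ ?_ z (IntermediateField.mem_bot.mpr hz) w hw
  intro z hz h0
  obtain ⟨f, rfl⟩ := IntermediateField.mem_bot.mp hz
  exact S.kD f h0

theorem Stp.wth_int_term (S : Stp p k K hv e t D res X A n r m) (i j : ℕ)
    (h : ((0 : ℤ) : WithTop ℤ) ≤ v (A.coeff j)) :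
    (e : WithTop ℤ) ≤ v (A.coeff j ^ (p ^ (i - j) - 1) * D (A.coeff j)) := by
  refine nv_ge0_mul hv (nv_ge0_pow hv h _) ?_
  obtain ⟨f, hf⟩ := S.A_mem j
  rw [← hf] at h ⊢
  exact S.kD f h

theorem Stp.wth_lt (S : Stp p k K hv e t D res X A n r m) (i : ℕ) (hi : i < r) :
    (e : WithTop ℤ) ≤ v (wth D i A) := by
  unfold wth
  refine nv_ge_sum hv _ _ fun j hj => ?_
  rw [Finset.mem_range] at hj
  exact S.wth_int_term i j (S.A_lt j (by omega))

theorem Stp.wth_ge (S : Stp p k K hv e t D res X A n r m) (i : ℕ) (hi : r ≤ i) (hin : i < n) :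
    v (wth D i A) = ((-(e * Cj p r m i) : ℤ) : WithTop ℤ) := by
  have he := S.e_pos
  have hCr : ∀ s, r ≤ s → 0 < Cj p r m s := by
    intro s hs
    have h1 := Cj_pow p r m hs
    have h2 : 0 < Cj p r m r := by
      rw [Cj_r]; exact lt_of_lt_of_le (S.A_r (by omega)) (le_max_right _ _)
    have h3 : (0 : ℤ) < (p : ℤ) ^ (s - r) := by have := hp.out.pos; positivity
    nlinarith
  have hterm : ∀ j ≤ i, r ≤ j → ((e : WithTop ℤ) ≤ v (A.coeff j ^ (p ^ (i - j) - 1) * D (A.coeff j)) ∧ m j ≤ 0) ∨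
      (v (A.coeff j ^ (p ^ (i - j) - 1) * D (A.coeff j)) =
        ((-(e * ((p : ℤ) ^ (i - j) * m j)) : ℤ) : WithTop ℤ) ∧ 0 < m j ∧ ¬ (p : ℤ) ∣ m j) := by
    intro j hj hrj
    rcases S.A_ge j hrj (by omega) with ⟨h1, h2⟩ | ⟨h1, h2, h3⟩
    · exact Or.inl ⟨S.wth_int_term i j h1, h2⟩
    · right
      refine ⟨?_, h2, h3⟩
      have h4 := (S.D_K _ (S.A_mem j) _ h1).2 (by rwa [dvd_neg])
      rw [nv_mul hv (nv_pow hv h1 _) h4]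
      congr 1
      have : 1 ≤ p ^ (i - j) := Nat.one_le_pow _ _ hp.out.pos
      push_cast [Nat.cast_sub this]
      ring
  have key : ∀ s, r ≤ s → s ≤ i →
      v (∑ j ∈ Finset.range (s + 1), A.coeff j ^ (p ^ (i - j) - 1) * D (A.coeff j)) =
        ((-(e * ((p : ℤ) ^ (i - s) * Cj p r m s)) : ℤ) : WithTop ℤ) := by
    intro s hs
    induction s, hs using Nat.le_induction with
    | base =>
      intro hri
      rw [Finset.sum_range_succ, add_comm]
      have h1 : (e : WithTop ℤ) ≤ v (∑ j ∈ Finset.range r, A.coeff j ^ (p ^ (i - j) - 1) * D (A.coeff j)) := by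
        refine nv_ge_sum hv _ _ fun j hj => ?_
        rw [Finset.mem_range] at hj
        exact S.wth_int_term i j (S.A_lt j hj)
      have hmr := S.A_r (by omega)
      rcases hterm r hri le_rfl with ⟨-, h2⟩ | ⟨h2, h3, -⟩
      · omega
      · rw [nv_add hv h2 h1, Cj_r, max_eq_right h3.le]
        have : (0 : ℤ) < (p : ℤ) ^ (i - r) := by have := hp.out.pos; positivity
        have := mul_pos he (mul_pos this h3)
        linarith
    | succ s hs ih =>
      intro hsi
      have ih := ih (by omega)
      rw [Finset.sum_range_succ]
      have hpp : (p : ℤ) ^ (i - s) = (p : ℤ) ^ (i - (s + 1)) * p := by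
        rw [← pow_succ]; congr 1; omega
      have hpos : (0 : ℤ) < (p : ℤ) ^ (i - (s + 1)) := by have := hp.out.pos; positivity
      set P := (p : ℤ) ^ (i - (s + 1))
      have hCs := hCr s hs
      have hp0 : (0 : ℤ) < p := by exact_mod_cast hp.out.pos
      rw [hpp] at ih
      rw [Cj_succ (by omega)]
      rcases hterm (s + 1) hsi (by omega) with ⟨h1, h2⟩ | ⟨h1, h2, h3⟩
      · rw [nv_add hv ih h1, max_eq_left]
        · congr 1; ring
        · nlinarith
        · have := mul_pos he (mul_pos (mul_pos hpos hp0) hCs); linarith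
      · rcases lt_trichotomy (p * Cj p r m s) (m (s + 1)) with hlt | heq | hgt
        · rw [add_comm, nv_add hv h1 ih.ge, max_eq_right hlt.le]
          have := mul_lt_mul_of_pos_left hlt (mul_pos he hpos)
          linarith
        · exact absurd ⟨_, heq.symm⟩ h3
        · rw [nv_add hv ih h1.ge, max_eq_left hgt.le]
          · congr 1; ring
          · have := mul_lt_mul_of_pos_left hgt (mul_pos he hpos)
            linarith
  have := key i hi le_rfl
  rw [Nat.sub_self, pow_zero, one_mul] at this
  exact this

end Setup

section Indep
open WittVector Polynomial

variable {p : ℕ} [hp : Fact p.Prime]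

theorem wadj_zero (E : Type*) {M : Type*} [Field E] [Field M] [Algebra E M] (X : WittVector p M) :
    wadj E X 0 = ⊥ := by
  rw [wadj]; simp

theorem wadj_succ_eq (E : Type*) {M : Type*} [Field E] [Field M] [Algebra E M]
    (X : WittVector p M) (i : ℕ) : wadj E X (i + 1) =
      (IntermediateField.adjoin (wadj E X i) {X.coeff i}).restrictScalars E := by
  refine Eq.trans ?_ (IntermediateField.adjoin_adjoin_left E
    {z | ∃ j < i, X.coeff j = z} {X.coeff i}).symm
  rw [wadj]
  congr 1
  ext z
  constructor
  · rintro ⟨j, hj, rfl⟩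
    rcases Nat.lt_succ_iff_lt_or_eq.mp hj with h | rfl
    · exact Or.inl ⟨j, h, rfl⟩
    · exact Or.inr rfl
  · rintro (⟨j, hj, rfl⟩ | hz)
    · exact ⟨j, by omega, rfl⟩
    · exact ⟨i, by omega, hz.symm⟩

theorem asw_finrank (E : Type*) {M : Type*} [Field E] [Field M] [Algebra E M] [CharP E p] {n : ℕ}
    (X A : WittVector p M) (hA : ∀ j < n, A.coeff j ∈ (algebraMap E M).range)
    (h : ∀ j < n, X.coeff j ^ p = (X + A).coeff j) (h0 : X.coeff 0 ∉ (algebraMap E M).range)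
    (i : ℕ) (hi : i ≤ n) : Module.finrank E (wadj E X i) = p ^ i := by
  rcases Nat.eq_zero_or_pos i with rfl | hi0
  · rw [wadj_zero]; simp
  · exact (asw_main E hi0 X A (fun j hj => hA j (by omega)) (fun j hj => h j (by omega)) h0).2.1

theorem asw_indep (E : Type*) {M : Type*} [Field E] [Field M] [Algebra E M] [CharP E p] {n : ℕ}
    (X A : WittVector p M) (hA : ∀ j < n, A.coeff j ∈ (algebraMap E M).range)
    (h : ∀ j < n, X.coeff j ^ p = (X + A).coeff j) (h0 : X.coeff 0 ∉ (algebraMap E M).range)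
    (i : ℕ) (hi : i < n) (f : ℕ → M) (hf : ∀ l, f l ∈ wadj E X i)
    (hz : ∑ l ∈ Finset.range p, f l * X.coeff i ^ l = 0) : ∀ l < p, f l = 0 := by
  have hy := asw_g E X A hA h i hi
  have d1 := asw_finrank E X A hA h h0 i hi.le
  have d2 := asw_finrank E X A hA h h0 (i + 1) hi
  rw [wadj_succ_eq] at d2
  set F := wadj E X i with hF
  set y := X.coeff i with hydef
  let g : F := ⟨_, hy⟩
  obtain ⟨P, hP, hPd, hPy'⟩ := as_poly (p := p) (M := M) g
  have hPy : aeval y P = 0 := hPy' y rfl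
  have hIntg : IsIntegral F y := ⟨P, hP, hPy⟩
  haveI : Module.Free F (IntermediateField.adjoin F {y}) := Module.Free.of_divisionRing _ _
  have h4 : Module.finrank E F * Module.finrank F (IntermediateField.adjoin F {y}) =
    Module.finrank E (IntermediateField.adjoin F {y}) :=
    Module.finrank_mul_finrank E F (IntermediateField.adjoin F {y})
  change Module.finrank E (IntermediateField.adjoin F {y}) = _ at d2
  rw [d1, d2, pow_succ] at h4
  have h5 := Nat.eq_of_mul_eq_mul_left (pow_pos hp.out.pos i) h4
  rw [IntermediateField.adjoin.finrank hIntg] at h5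
  set Q : F[X] := ∑ l ∈ Finset.range p, C (⟨f l, hf l⟩ : F) * (Polynomial.X : F[X]) ^ l with hQ
  have hQy : aeval y Q = 0 := by
    rw [hQ, map_sum, ← hz]
    refine Finset.sum_congr rfl fun l _ => ?_
    simp
  have hQd : Q.degree < p := by
    refine lt_of_le_of_lt (degree_sum_le _ _) ?_
    rw [Finset.sup_lt_iff (by exact WithBot.bot_lt_coe p)]
    intro l hl
    refine lt_of_le_of_lt (degree_C_mul_X_pow_le _ _) ?_
    exact_mod_cast Finset.mem_range.mp hl
  have hQ0 : Q = 0 := by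
    by_contra hne
    have := degree_le_of_dvd (minpoly.dvd F y hQy) hne
    rw [degree_eq_natDegree (minpoly.ne_zero hIntg), h5] at this
    exact absurd hQd (not_lt.mpr this)
  intro l hl
  have h6 : Q.coeff l = 0 := by rw [hQ0]; simp
  rw [hQ, finsetSum_coeff, Finset.sum_eq_single l] at h6
  · simp at h6; exact congrArg Subtype.val h6
  · intro b _ hb
    rw [coeff_C_mul, coeff_X_pow, if_neg hb.symm, mul_zero]
  · intro hl'; exact absurd (Finset.mem_range.mpr hl) hl'

end Indep

section Unram
open WittVector

/-- The integral truncation of a Witt vector. -/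
def intW {p : ℕ} {L : Type*} [Field L] {v : L → WithTop ℤ} (hv : IsNormVal v)
    (X : WittVector p L) : WittVector p (valRing v hv) :=
  WittVector.mk p fun j => if h : X.coeff j ∈ valRing v hv then ⟨X.coeff j, h⟩ else 0

/-- The residue Witt vector. -/
def resW {p : ℕ} [Fact p.Prime] {L κ : Type*} [Field L] [Field κ] {v : L → WithTop ℤ} {hv : IsNormVal v}
    (res : valRing v hv →+* κ) (X : WittVector p L) : WittVector p κ :=
  WittVector.map res (intW hv X)

variable {p : ℕ} [hp : Fact p.Prime] {k K L κ : Type*} [Field k] [Field K] [Field L]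
    [Field κ] [Algebra K L] [Algebra k κ] [CharP L p] {v : L → WithTop ℤ} {hv : IsNormVal v} {e : ℤ} {t : L}
    {D : Derivation ℤ L L} {res : valRing v hv →+* κ} {X A : WittVector p L} {n r : ℕ}
    {m : ℕ → ℤ}

theorem resW_coeff (X : WittVector p L) (j : ℕ) (h : X.coeff j ∈ valRing v hv) :
    (resW res X).coeff j = res ⟨X.coeff j, h⟩ := by
  rw [resW, map_coeff]
  congr 1
  simp [intW, h]

theorem Stp.res_eq (S : Stp p k K hv e t D res X A n r m) :
    ∀ j < r, (resW res X).coeff j ^ p = (resW res X + resW res A).coeff j := by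
  refine asw_map res ?_
  intro j hj
  apply Subtype.val_injective
  have hX : ∀ j < r, X.coeff j = (WittVector.map (valRing v hv).subtype (intW hv X)).coeff j := by
    intro j hj
    rw [map_coeff]
    have := S.X_int j hj
    rw [← mem_valRing (hv := hv)] at this
    simp [intW, this]
  have hA : ∀ j < r, A.coeff j = (WittVector.map (valRing v hv).subtype (intW hv A)).coeff j := by
    intro j hj
    rw [map_coeff]
    have := S.A_lt j hj
    rw [← mem_valRing (hv := hv)] at this
    simp [intW, this]
  have h1 := witt_add_congr hX hA j hj
  rw [← map_add, map_coeff, ← S.eq j (lt_of_lt_of_le hj S.rn), hX j hj, map_coeff] at h1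
  simpa using h1

theorem Stp.res_A (S : Stp p k K hv e t D res X A n r m) :
    ∀ j < r, (resW res A).coeff j ∈ (algebraMap k κ).range := by
  intro j hj
  have h := S.A_lt j hj
  rw [resW_coeff A j h]
  obtain ⟨f, hf⟩ := S.A_mem j
  have h' := h
  rw [← hf] at h'
  obtain ⟨c, hc⟩ := S.kres f h'
  refine ⟨c, ?_⟩
  rw [← hc]
  congr 2

theorem Stp.res_x0 (S : Stp p k K hv e t D res X A n r m) :
    (resW res X).coeff 0 ∉ (algebraMap k κ).range := by
  have h := S.X_int 0 S.r1
  rw [resW_coeff X 0 h]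
  exact S.x0 h

/-- The unramified stage. -/
structure QQ {p : ℕ} {k K L κ : Type*} [Field k] [Field K] [Field L]
    [Field κ] [Algebra K L] [Algebra k κ] {v : L → WithTop ℤ} {hv : IsNormVal v} (e : ℤ)
    (D : Derivation ℤ L L) (res : valRing v hv →+* κ)
    (F : IntermediateField K L) (R : IntermediateField k κ) : Prop where
  q1 : ∀ z ∈ F, z ≠ 0 → ∃ w : ℤ, v z = ((e * w : ℤ) : WithTop ℤ)
  q2 : ∀ z ∈ F, ((0 : ℤ) : WithTop ℤ) ≤ v z → (e : WithTop ℤ) ≤ v (D z)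
  q3 : ∀ z ∈ F, ∀ hz : z ∈ valRing v hv, ∃ h ∈ F, ∃ hh : h ∈ valRing v hv,
    res ⟨z, hz⟩ = res ⟨h, hh⟩ ^ p
  q4 : ∀ z ∈ F, ∀ hz : z ∈ valRing v hv, res ⟨z, hz⟩ ∈ R

theorem Stp.Q_zero (S : Stp p k K hv e t D res X A n r m) :
    QQ (p := p) e D res (wadj K X 0) (wadj k (resW res X) 0) := by
  rw [wadj_zero, wadj_zero]
  constructor
  · intro z hz h0
    obtain ⟨f, rfl⟩ := IntermediateField.mem_bot.mp hz
    exact S.kval f (by rintro rfl; simp at h0)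
  · intro z hz h0
    obtain ⟨f, rfl⟩ := IntermediateField.mem_bot.mp hz
    exact S.kD f h0
  · intro z hz h0
    obtain ⟨f, rfl⟩ := IntermediateField.mem_bot.mp hz
    obtain ⟨h, h1, h2⟩ := S.kperf f h0
    refine ⟨algebraMap K L h, IntermediateField.algebraMap_mem _ _, h1, ?_⟩
    rw [← map_pow, ← sub_eq_zero, ← map_sub, S.res_zero]
    exact h2
  · intro z hz h0
    obtain ⟨f, rfl⟩ := IntermediateField.mem_bot.mp hz
    obtain ⟨c, hc⟩ := S.kres f h0
    rw [hc]; exact IntermediateField.algebraMap_mem _ _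

theorem Stp.Q_key [CharP k p] (S : Stp p k K hv e t D res X A n r m) (i : ℕ) (hi : i < r)
    (Q : QQ (p := p) e D res (wadj K X i) (wadj k (resW res X) i)) (z : L)
    (hz : z ∈ wadj K X (i + 1)) (hz0 : z ≠ 0) :
    ∃ (w : ℤ) (f : ℕ → L), v z = ((e * w : ℤ) : WithTop ℤ) ∧ (∀ l, f l ∈ wadj K X i) ∧
      (∀ l, ((e * w : ℤ) : WithTop ℤ) ≤ v (f l)) ∧ z = ∑ l ∈ Finset.range p, f l * X.coeff i ^ l := by
  have hin := lt_of_lt_of_le hi S.rn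
  have hz1 := wadj_succ K X i 0 (zero_mem _) z hz
  rw [sub_zero] at hz1
  obtain ⟨f, hf, hzf⟩ := as_span (p := p) _ _ (asw_g K X A (fun j _ => S.A_mem j) S.eq i hin) z hz1
  obtain ⟨l₀, hl₀, hmin⟩ := Finset.exists_min_image (Finset.range p) (fun l => v (f l))
    ⟨0, Finset.mem_range.mpr hp.out.pos⟩
  have hne : f l₀ ≠ 0 := by
    intro h0
    apply hz0
    rw [hzf]
    refine Finset.sum_eq_zero fun l hl => ?_
    have := hmin l hl
    simp only [h0, nv_zero hv, top_le_iff] at this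
    rw [(hv.1 _).mp this, zero_mul]
  obtain ⟨w, hw⟩ := Q.q1 _ (hf l₀) hne
  have hx : X.coeff i ∈ valRing v hv := S.X_int i hi
  obtain ⟨t', ht'⟩ := S.tK
  have htF : t ∈ wadj K X i := by rw [← ht']; exact IntermediateField.algebraMap_mem _ _
  have htw := nv_zpow hv S.vt (-w)
  have ht0 : t ≠ 0 := nv_ne hv S.vt
  set g : ℕ → L := fun l => if l < p then f l * t ^ (-w) else 0 with hg
  have hgF : ∀ l, g l ∈ wadj K X i := by
    intro l; simp only [hg]; split_ifs
    · exact mul_mem (hf l) (zpow_mem htF _)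
    · exact zero_mem _
  have hgO : ∀ l, g l ∈ valRing v hv := by
    intro l; rw [mem_valRing]; simp only [hg]; split_ifs with hl
    · have h1 := hmin l (Finset.mem_range.mpr hl)
      simp only [hw] at h1
      exact nv_mono (nv_ge_mul hv h1 htw.ge) (by linarith)
    · exact nv_ge_zero hv 0
  have hzg : z * t ^ (-w) = ∑ l ∈ Finset.range p, g l * X.coeff i ^ l := by
    rw [hzf, Finset.sum_mul]
    refine Finset.sum_congr rfl fun l hl => ?_
    simp only [hg, if_pos (Finset.mem_range.mp hl)]; ring
  have hzO : z * t ^ (-w) ∈ valRing v hv := by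
    rw [hzg]
    exact sum_mem fun l _ => mul_mem (hgO l) (pow_mem hx l)
  have hres : res ⟨_, hzO⟩ = ∑ l ∈ Finset.range p, res ⟨g l, hgO l⟩ * (resW res X).coeff i ^ l := by
    rw [resW_coeff X i hx]
    simp only [← map_pow, ← map_mul, ← map_sum]
    congr 1
    apply Subtype.ext
    change z * t ^ (-w) = _
    rw [hzg]
    push_cast
    rfl
  have hv0 : v (z * t ^ (-w)) = ((0 : ℤ) : WithTop ℤ) := by
    by_contra hcon
    have h1 : ((1 : ℤ) : WithTop ℤ) ≤ v (z * t ^ (-w)) := by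
      by_contra h2
      obtain ⟨d, hd, hd1⟩ := nv_not_ge h2
      have := nv_le_of hd hzO
      rw [show d = 0 by omega] at hd
      exact hcon hd
    have h2 := (S.res_zero ⟨_, hzO⟩).mpr h1
    rw [hres] at h2
    have h3 := asw_indep k (resW res X) (resW res A) S.res_A S.res_eq S.res_x0 i hi
      (fun l => res ⟨g l, hgO l⟩) (fun l => Q.q4 _ (hgF l) (hgO l)) h2 l₀ (Finset.mem_range.mp hl₀)
    have h4 := (S.res_zero _).mp h3
    have h5 : v (g l₀) = ((0 : ℤ) : WithTop ℤ) := by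
      simp only [hg, if_pos (Finset.mem_range.mp hl₀)]
      rw [nv_mul hv hw htw]; congr 1; ring
    have := nv_le_of h5 h4
    omega
  refine ⟨w, fun l => if l < p then f l else 0, ?_, ?_, ?_, ?_⟩
  · obtain ⟨c, hc⟩ := nv_fin hv hz0
    have := nv_inj hv0 (nv_mul hv hc htw)
    rw [hc]; congr 1; linarith
  · intro l; dsimp only; split_ifs
    · exact hf l
    · exact zero_mem _
  · intro l; dsimp only; split_ifs with hl
    · have h1 := hmin l (Finset.mem_range.mpr hl)
      simpa only [hw] using h1
    · exact nv_ge_zero hv _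
  · rw [hzf]
    refine Finset.sum_congr rfl fun l hl => ?_
    simp only [if_pos (Finset.mem_range.mp hl)]

theorem Stp.Q_succ [CharP k p] (S : Stp p k K hv e t D res X A n r m) (i : ℕ) (hi : i < r)
    (Q : QQ (p := p) e D res (wadj K X i) (wadj k (resW res X) i)) :
    QQ (p := p) e D res (wadj K X (i + 1)) (wadj k (resW res X) (i + 1)) := by
  have he := S.e_pos
  have hin := lt_of_lt_of_le hi S.rn
  have hx : X.coeff i ∈ valRing v hv := S.X_int i hi
  haveI : CharP κ p := charP_of_injective_algebraMap (algebraMap k κ).injective p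
  have key : ∀ z ∈ wadj K X (i + 1), ∀ hz : z ∈ valRing v hv, ∃ (f : ℕ → valRing v hv),
      (∀ l, (f l : L) ∈ wadj K X i) ∧ (⟨z, hz⟩ : valRing v hv) = ∑ l ∈ Finset.range p, f l * ⟨X.coeff i, hx⟩ ^ l := by
    intro z hz hzO
    rcases eq_or_ne z 0 with rfl | hz0
    · refine ⟨0, fun l => by simpa using zero_mem (wadj K X i), ?_⟩
      apply Subtype.ext; simp
    obtain ⟨w, f, h1, h2, h3, h4⟩ := S.Q_key i hi Q z hz hz0
    have := nv_le_of h1 hzO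
    refine ⟨fun l => ⟨f l, nv_mono (h3 l) this⟩, h2, ?_⟩
    apply Subtype.ext
    change z = _
    rw [h4]
    push_cast
    rfl
  constructor
  · intro z hz hz0
    obtain ⟨w, f, h1, -⟩ := S.Q_key i hi Q z hz hz0
    exact ⟨w, h1⟩
  · intro z hz hzO
    obtain ⟨f, hf, hzf⟩ := key z hz hzO
    have hzf' : z = ∑ l ∈ Finset.range p, (f l : L) * X.coeff i ^ l := by
      have := congrArg Subtype.val hzf
      push_cast at this
      exact this
    have hDx : (e : WithTop ℤ) ≤ v (D (X.coeff i)) := by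
      rw [S.D_X i hin]
      refine nv_ge_sub hv (nv_ge_neg hv (S.wth_lt i hi)) (nv_ge_sum hv _ _ fun j hj => ?_)
      rw [Finset.mem_range] at hj
      have hxj := S.X_int j (by omega)
      exact nv_ge0_mul hv (nv_ge0_pow hv hxj _) (Q.q2 _ (wadj_mem K X hj) hxj)
    rw [hzf', map_sum]
    refine nv_ge_sum hv _ _ fun l hl => ?_
    rw [Derivation.leibniz, Derivation.leibniz_pow]
    simp only [smul_eq_mul, nsmul_eq_mul]
    refine nv_ge_add hv (nv_ge0_mul hv (f l).2 (nv_ge0_mul hv (nv_ge_natCast hv l)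
      (nv_ge0_mul hv (nv_ge0_pow hv hx _) hDx))) ?_
    exact nv_ge0_mul hv (nv_ge0_pow hv hx _) (Q.q2 _ (hf l) (f l).2)
  · intro z hz hzO
    obtain ⟨f, hf, hzf⟩ := key z hz hzO
    have hm := wadj_mono K X (Nat.le_succ i)
    choose h hhF hhO hh using fun l => Q.q3 _ (hf l) (f l).2
    have hgF := asw_g K X A (fun j _ => S.A_mem j) S.eq i hin
    have hgO : X.coeff i ^ p - X.coeff i ∈ valRing v hv := sub_mem (pow_mem hx p) hx
    obtain ⟨h', hh'F, hh'O, hh'⟩ := Q.q3 _ hgF hgO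
    set y : valRing v hv := ⟨X.coeff i, hx⟩ - ⟨h', hh'O⟩ with hy
    have hyx : res ⟨X.coeff i, hx⟩ = res y ^ p := by
      rw [hy, map_sub, sub_pow_char, ← hh', ← map_pow, ← map_sub]
      congr 1
      apply Subtype.ext
      push_cast
      ring
    set H : valRing v hv := ∑ l ∈ Finset.range p, ⟨h l, hhO l⟩ * y ^ l with hH
    refine ⟨H, ?_, H.2, ?_⟩
    · rw [hH]; push_cast
      refine sum_mem fun l _ => mul_mem (hm (hhF l)) (pow_mem ?_ l)
      exact sub_mem (wadj_mem K X (Nat.lt_succ_self i)) (hm hh'F)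
    · rw [hzf]
      change _ = res H ^ p
      rw [hH, map_sum, map_sum, sum_pow_char]
      refine Finset.sum_congr rfl fun l _ => ?_
      rw [map_mul, map_mul, mul_pow, map_pow, map_pow, hyx, ← hh l, ← pow_mul, ← pow_mul, mul_comm l p]
  · intro z hz hzO
    obtain ⟨f, hf, hzf⟩ := key z hz hzO
    have hm := wadj_mono k (resW res X) (Nat.le_succ i)
    rw [hzf, map_sum]
    refine sum_mem fun l _ => ?_
    rw [map_mul, map_pow, ← resW_coeff X i hx]
    exact mul_mem (hm (Q.q4 _ (hf l) (f l).2)) (pow_mem (wadj_mem k _ (Nat.lt_succ_self i)) l)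

theorem Stp.Q [CharP k p] (S : Stp p k K hv e t D res X A n r m) (i : ℕ) (hi : i ≤ r) :
    QQ (p := p) e D res (wadj K X i) (wadj k (resW res X) i) := by
  induction i with
  | zero => exact S.Q_zero
  | succ i ih => exact S.Q_succ i (by omega) (ih (by omega))

end Unram

section BB

theorem cc_step_le (p r : ℕ) (m : ℕ → ℤ) (s : ℕ) : p * cc p r m s ≤ cc p r m (s + 1) := by
  rw [cc]; exact le_max_left _ _

theorem cc_pos {p r : ℕ} {m : ℕ → ℤ} (hp : 2 ≤ p) (hm : 0 < m r) (s : ℕ) : 0 < cc p r m (s + 1) := by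
  induction s with
  | zero => rw [cc]; exact lt_of_lt_of_le hm (le_max_right _ _)
  | succ s ih =>
    refine lt_of_lt_of_le ?_ (cc_step_le p r m (s + 1))
    have : (2 : ℤ) ≤ p := by exact_mod_cast hp
    nlinarith

theorem cc_lt {p r : ℕ} {m : ℕ → ℤ} (hp : 2 ≤ p) (hm : 0 < m r) (s : ℕ) :
    cc p r m s < cc p r m (s + 1) := by
  have h2 : (2 : ℤ) ≤ p := by exact_mod_cast hp
  cases s with
  | zero => exact cc_pos hp hm 0
  | succ s =>
    have h1 := cc_pos hp hm s
    have h3 := cc_step_le p r m (s + 1)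
    nlinarith

theorem bb_lt {p r : ℕ} {m : ℕ → ℤ} (hp : 2 ≤ p) (hm : 0 < m r) (s : ℕ) :
    bb p r m s < bb p r m (s + 1) := by
  have h1 := cc_lt hp hm s
  have h2 : (0 : ℤ) < (p : ℤ) ^ s := by positivity
  rw [bb]
  nlinarith

theorem bb_mono {p r : ℕ} {m : ℕ → ℤ} (hp : 2 ≤ p) (hm : 0 < m r) : StrictMono (bb p r m) :=
  strictMono_nat_of_lt_succ (bb_lt hp hm)

theorem cc_mono {p r : ℕ} {m : ℕ → ℤ} (hp : 2 ≤ p) (hm : 0 < m r) : StrictMono (cc p r m) :=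
  strictMono_nat_of_lt_succ (cc_lt hp hm)

theorem bb_nonneg {p r : ℕ} {m : ℕ → ℤ} (hp : 2 ≤ p) (hm : 0 < m r) (s : ℕ) : 0 ≤ bb p r m s :=
  (bb_mono hp hm).monotone (Nat.zero_le s)

end BB

section Terms
variable {p : ℕ} [hp : Fact p.Prime] {L : Type*} [Field L] [CharP L p] {v : L → WithTop ℤ}

theorem pow_diff_aux (hv : IsNormVal v) {y w : L} {d d' : ℤ} (hy : v y = (d : WithTop ℤ))
    (hw : v w = (d' : WithTop ℤ)) (hd : d < d') (l : ℕ) :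
    ((2 * d' + ((l : ℤ) - 1) * d : ℤ) : WithTop ℤ) ≤
      v ((y + w) ^ (l + 1) - y ^ (l + 1) - (l + 1 : ℕ) * (w * y ^ l)) := by
  induction l with
  | zero =>
    have : (y + w) ^ (0 + 1) - y ^ (0 + 1) - (0 + 1 : ℕ) * (w * y ^ 0) = 0 := by push_cast; ring
    rw [this]; exact nv_ge_zero hv _
  | succ l ih =>
    have : (y + w) ^ (l + 1 + 1) - y ^ (l + 1 + 1) - (l + 1 + 1 : ℕ) * (w * y ^ (l + 1)) =
        (y + w) * ((y + w) ^ (l + 1) - y ^ (l + 1) - (l + 1 : ℕ) * (w * y ^ l)) +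
          (l + 1 : ℕ) * (w * w * y ^ l) := by
      push_cast; ring
    rw [this]
    have hyw := nv_add hv hy hw.ge hd
    refine nv_ge_add hv (nv_mono (nv_ge_mul hv hyw.ge ih) ?_) (nv_ge0_mul hv (nv_ge_natCast hv _)
      (nv_ge_of (nv_mul hv (nv_mul hv hw hw) (nv_pow hv hy l)) ?_))
    · push_cast; linarith
    · push_cast; linarith

theorem pow_diff (hv : IsNormVal v) {y w : L} {d d' : ℤ} (hy : v y = (d : WithTop ℤ))
    (hw : v w = (d' : WithTop ℤ)) (hd : d < d') (l : ℕ) (h1 : 1 ≤ l) (hl : l < p) :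
    v ((y + w) ^ l - y ^ l) = ((d' + ((l : ℤ) - 1) * d : ℤ) : WithTop ℤ) := by
  obtain ⟨l, rfl⟩ : ∃ l', l = l' + 1 := ⟨l - 1, by omega⟩
  have h2 := pow_diff_aux hv hy hw hd l
  have h3 : v ((l + 1 : ℕ) : L) = ((0 : ℤ) : WithTop ℤ) :=
    nv_natCast (p := p) hv (fun h => by have := Nat.le_of_dvd (by omega) h; omega)
  have h4 := nv_mul hv h3 (nv_mul hv hw (nv_pow hv hy l))
  have h5 := nv_add hv h4 h2 (by push_cast; linarith)
  rw [add_sub_cancel] at h5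
  rw [h5]; congr 1; push_cast; ring

theorem sigma_term (hv : IsNormVal v) {F : Set L} {y : L} {d γ : ℤ} (σ : L →+* L)
    (hy : v y = (d : WithTop ℤ)) (hγ : 0 < γ)
    (hσ : ∀ f ∈ F, ∀ a : ℤ, v f = (a : WithTop ℤ) → ((a + γ + 1 : ℤ) : WithTop ℤ) ≤ v (σ f - f))
    (hw : v (σ y - y) = ((d + γ : ℤ) : WithTop ℤ)) :
    (∀ f ∈ F, ∀ l < p, ∀ c : ℤ, (c : WithTop ℤ) ≤ v (f * y ^ l) →
      ((c + γ : ℤ) : WithTop ℤ) ≤ v (σ (f * y ^ l) - f * y ^ l)) ∧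
    (∀ f ∈ F, ∀ l < p, 1 ≤ l → ∀ c : ℤ, v (f * y ^ l) = (c : WithTop ℤ) →
      v (σ (f * y ^ l) - f * y ^ l) = ((c + γ : ℤ) : WithTop ℤ)) := by
  have hσy : v (σ y) = (d : WithTop ℤ) := by
    have := nv_add hv hy hw.ge (by linarith)
    rwa [add_sub_cancel] at this
  have key : ∀ f ∈ F, ∀ l < p, ∀ a : ℤ, v f = (a : WithTop ℤ) →
      ((a + l * d + γ + 1 : ℤ) : WithTop ℤ) ≤ v ((σ f - f) * σ y ^ l) := by
    intro f hf l _ a ha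
    exact nv_mono (nv_ge_mul hv (hσ f hf a ha) (nv_pow hv hσy l).ge) (by linarith)
  have hexp : ∀ f : L, ∀ l : ℕ, σ (f * y ^ l) - f * y ^ l =
      f * (σ y ^ l - y ^ l) + (σ f - f) * σ y ^ l := by
    intro f l; rw [map_mul, map_pow]; ring
  have main : ∀ f ∈ F, ∀ l < p, 1 ≤ l → ∀ c : ℤ, v (f * y ^ l) = (c : WithTop ℤ) →
      v (σ (f * y ^ l) - f * y ^ l) = ((c + γ : ℤ) : WithTop ℤ) := by
    intro f hf l hl h1 c hc
    have hf0 : f ≠ 0 := fun h => nv_ne hv hc (by rw [h, zero_mul])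
    obtain ⟨a, ha⟩ := nv_fin hv hf0
    have hca := nv_inj hc (nv_mul hv ha (nv_pow hv hy l))
    have h2 := pow_diff (p := p) hv hy hw (by linarith) l h1 hl
    rw [add_sub_cancel] at h2
    rw [hexp, nv_add hv (nv_mul hv ha h2) (key f hf l hl a ha) (by linarith)]
    congr 1; rw [hca]; ring
  refine ⟨?_, main⟩
  intro f hf l hl c hc
  rcases eq_or_ne f 0 with rfl | hf0
  · simp [nv_zero hv]
  obtain ⟨a, ha⟩ := nv_fin hv hf0
  have hfy := nv_mul hv ha (nv_pow hv hy l)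
  have hca := nv_le_of hfy hc
  rcases Nat.eq_zero_or_pos l with rfl | h1
  · rw [hexp, pow_zero, pow_zero, sub_self, mul_zero, zero_add, mul_one]
    refine nv_mono (hσ f hf a ha) ?_
    simp at hca; linarith
  · exact nv_ge_of (main f hf l hl h1 _ hfy) (by linarith)

theorem D_term (hv : IsNormVal v) {F : Set L} {y : L} {d γ c₀ : ℤ} (D : Derivation ℤ L L)
    (hy : v y = (d : WithTop ℤ))
    (hD : ∀ f ∈ F, ∀ a : ℤ, v f = (a : WithTop ℤ) → ((a + γ + 1 : ℤ) : WithTop ℤ) ≤ v (D f))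
    (hDy : v (D y) = (c₀ : WithTop ℤ)) (hc₀ : c₀ = d + γ) :
    (∀ f ∈ F, ∀ l < p, ∀ c : ℤ, (c : WithTop ℤ) ≤ v (f * y ^ l) →
      ((c + γ : ℤ) : WithTop ℤ) ≤ v (D (f * y ^ l))) ∧
    (∀ f ∈ F, ∀ l < p, 1 ≤ l → ∀ c : ℤ, v (f * y ^ l) = (c : WithTop ℤ) →
      v (D (f * y ^ l)) = ((c + γ : ℤ) : WithTop ℤ)) := by
  have key : ∀ f ∈ F, ∀ l < p, ∀ a : ℤ, v f = (a : WithTop ℤ) →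
      ((a + l * d + γ + 1 : ℤ) : WithTop ℤ) ≤ v (y ^ l * D f) := by
    intro f hf l _ a ha
    exact nv_mono (nv_ge_mul hv (nv_pow hv hy l).ge (hD f hf a ha)) (by linarith)
  have hexp : ∀ f : L, ∀ l : ℕ, D (f * y ^ l) = f * (l * (y ^ (l - 1) * D y)) + y ^ l * D f := by
    intro f l
    rw [Derivation.leibniz, Derivation.leibniz_pow]
    simp only [smul_eq_mul, nsmul_eq_mul]
  have main : ∀ f ∈ F, ∀ l < p, 1 ≤ l → ∀ c : ℤ, v (f * y ^ l) = (c : WithTop ℤ) →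
      v (D (f * y ^ l)) = ((c + γ : ℤ) : WithTop ℤ) := by
    intro f hf l hl h1 c hc
    have hf0 : f ≠ 0 := fun h => nv_ne hv hc (by rw [h, zero_mul])
    obtain ⟨a, ha⟩ := nv_fin hv hf0
    have hca := nv_inj hc (nv_mul hv ha (nv_pow hv hy l))
    have h3 : v (l : L) = ((0 : ℤ) : WithTop ℤ) :=
      nv_natCast (p := p) hv (fun h => by have := Nat.le_of_dvd (by omega) h; omega)
    have h2 := nv_mul hv h3 (nv_mul hv (nv_pow hv hy (l - 1)) hDy)
    rw [Nat.cast_sub h1] at h2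
    push_cast at h2
    rw [hexp, nv_add hv (nv_mul hv ha h2) (key f hf l hl a ha) (by rw [hc₀]; linarith)]
    congr 1; rw [hca, hc₀]; ring
  refine ⟨?_, main⟩
  intro f hf l hl c hc
  rcases eq_or_ne f 0 with rfl | hf0
  · simp [nv_zero hv]
  obtain ⟨a, ha⟩ := nv_fin hv hf0
  have hfy := nv_mul hv ha (nv_pow hv hy l)
  have hca := nv_le_of hfy hc
  rcases Nat.eq_zero_or_pos l with rfl | h1
  · rw [pow_zero, mul_one]
    refine nv_mono (hD f hf a ha) ?_
    simp at hca; linarith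
  · exact nv_ge_of (main f hf l hl h1 _ hfy) (by linarith)

end Terms

section Ram
open WittVector

variable {p : ℕ} [hp : Fact p.Prime] {k K L κ : Type*} [Field k] [Field K] [Field L]
    [Field κ] [Algebra K L] [Algebra k κ] [CharP L p] {v : L → WithTop ℤ} {hv : IsNormVal v} {e : ℤ} {t : L}
    {D : Derivation ℤ L L} {res : valRing v hv →+* κ} {X A : WittVector p L} {n r : ℕ}
    {m : ℕ → ℤ}

/-- The ramified stage. -/
structure PP {p : ℕ} {k K L κ : Type*} [Field k] [Field K] [Field L]
    [Field κ] [Algebra K L] [Algebra k κ] {v : L → WithTop ℤ} {hv : IsNormVal v} (e : ℤ)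
    (D : Derivation ℤ L L) (res : valRing v hv →+* κ) (X : WittVector p L) (r : ℕ) (m : ℕ → ℤ)
    (F : IntermediateField K L) (R : IntermediateField k κ) (s : ℕ) (q : ℤ) : Prop where
  qpos : 0 < q
  qe : q * p ^ s = e
  p1 : ∀ z ∈ F, ∀ c : ℤ, v z = (c : WithTop ℤ) → q ∣ c
  p1' : ∃ z ∈ F, v z = (q : WithTop ℤ)
  p2 : ∀ z ∈ F, ∀ c : ℤ, (c : WithTop ℤ) ≤ v z →
    ((c - (e * cc p r m s - bb p r m s * q) : ℤ) : WithTop ℤ) ≤ v (D z)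
  p2' : ∀ z ∈ F, ∀ c : ℤ, v z = (c : WithTop ℤ) → ¬ p * q ∣ c →
    v (D z) = ((c - (e * cc p r m s - bb p r m s * q) : ℤ) : WithTop ℤ)
  p3 : ∀ z ∈ F, ∀ hz : z ∈ valRing v hv, ∃ h ∈ F, ∃ hh : h ∈ valRing v hv,
    res ⟨z, hz⟩ = res ⟨h, hh⟩ ^ p
  p4 : ∀ z ∈ F, ∀ hz : z ∈ valRing v hv, res ⟨z, hz⟩ ∈ R
  p5 : ∀ σ : L ≃ₐ[K] L, ∀ s' < s, (∀ z ∈ wadj K X (r + s'), σ z = z) →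
    σ (X.coeff (r + s')) ≠ X.coeff (r + s') → ∀ z ∈ F, ∀ c : ℤ,
    ((c : WithTop ℤ) ≤ v z → ((c + bb p r m (s' + 1) * q : ℤ) : WithTop ℤ) ≤ v (σ z - z)) ∧
    (v z = (c : WithTop ℤ) → ¬ p * q ∣ c →
      v (σ z - z) = ((c + bb p r m (s' + 1) * q : ℤ) : WithTop ℤ))

theorem Stp.P_zero [CharP k p] (S : Stp p k K hv e t D res X A n r m) :
    PP e D res X r m (wadj K X (r + 0)) (wadj k (resW res X) r) 0 e := by
  have Q := S.Q r le_rfl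
  have he := S.e_pos
  rw [add_zero]
  constructor
  · exact he
  · simp
  · intro z hz c hc
    obtain ⟨w, hw⟩ := Q.q1 z hz (nv_ne hv hc)
    exact ⟨w, nv_inj hc hw⟩
  · obtain ⟨t', ht'⟩ := S.tK
    exact ⟨t, by rw [← ht']; exact IntermediateField.algebraMap_mem _ _, S.vt⟩
  · intro z hz c hc
    rcases eq_or_ne z 0 with rfl | h0
    · rw [map_zero]; exact nv_ge_zero hv _
    obtain ⟨w, hw⟩ := Q.q1 z hz h0
    have := nv_le_of hw hc
    refine nv_mono (S.D_unram _ Q.q2 z hz w hw).1 ?_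
    simp [cc, bb]; exact this
  · intro z hz c hc hd
    obtain ⟨w, hw⟩ := Q.q1 z hz (nv_ne hv hc)
    have := nv_inj hc hw
    rw [(S.D_unram _ Q.q2 z hz w hw).2 ?_]
    · congr 1; simp [cc, bb]; exact this.symm
    · rintro ⟨u, rfl⟩
      exact hd ⟨u, by rw [this]; ring⟩
  · exact Q.q3
  · exact Q.q4
  · intro σ s' hs'; omega

/-- Numerical facts. -/
theorem num_facts {p r : ℕ} {m : ℕ → ℤ} (hp : 2 ≤ p) (hm : 0 < m r) (s : ℕ) {e q : ℤ} (he : 0 < e)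
    (hq : 0 < q) :
    0 < e * cc p r m (s + 1) ∧
    e * cc p r m s + (e * cc p r m s - bb p r m s * q) < e * cc p r m (s + 1) ∧
    p * (e * cc p r m s - bb p r m s * q) < e * cc p r m (s + 1) := by
  have h2 : (2 : ℤ) ≤ p := by exact_mod_cast hp
  have hC := cc_pos hp hm s
  have hstep := cc_step_le p r m s
  have hc := cc_nonneg p r m s
  have h3 := mul_le_mul_of_nonneg_left hstep he.le
  have h4 : e * (2 * cc p r m s) ≤ e * (p * cc p r m s) :=
    mul_le_mul_of_nonneg_left (by nlinarith) he.le
  refine ⟨mul_pos he hC, ?_⟩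
  cases s with
  | zero => simp only [cc, bb] at *; constructor <;> nlinarith
  | succ s =>
    have hb : 0 < bb p r m (s + 1) := lt_of_le_of_lt (bb_nonneg hp hm s) (bb_lt hp hm s)
    have hbq := mul_pos hb hq
    constructor
    · linarith
    · nlinarith

theorem Stp.D_Xi (S : Stp p k K hv e t D res X A n r m) (s : ℕ) (hs : r + s < n) (q : ℤ)
    (P : PP (k := k) e D res X r m (wadj K X (r + s)) (wadj k (resW res X) r) s q) :
    v (D (X.coeff (r + s))) = ((-(e * cc p r m (s + 1)) : ℤ) : WithTop ℤ) := by
  have he := S.e_pos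
  have hp2 : (2 : ℤ) ≤ p := by exact_mod_cast hp.out.two_le
  obtain ⟨hC, hn1, hn2⟩ := num_facts (r := r) (m := m) hp.out.two_le (S.A_r (by omega)) s he P.qpos
  have hw := S.wth_ge (r + s) (by omega) hs
  have hCj : Cj p r m (r + s) = cc p r m (s + 1) := by unfold Cj; congr 1; omega
  rw [hCj] at hw
  rw [S.D_X _ hs]
  refine nv_sub hv (nv_neg hv hw) (d := -(e * cc p r m (s + 1)) + 1) ?_ (by linarith)
  refine nv_ge_sum hv _ _ fun j hj => ?_
  rw [Finset.mem_range] at hj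
  rcases eq_or_ne (X.coeff j) 0 with h0 | h0
  · rw [h0, map_zero, mul_zero]; exact nv_ge_zero hv _
  obtain ⟨d, hd⟩ := nv_fin hv h0
  have h1 := S.bX j (by omega)
  have h2 := nv_le_of (nv_pow hv hd p) h1
  have h3 := P.p2 _ (wadj_mem K X hj) d hd.ge
  refine nv_mono (nv_ge_mul hv (nv_pow hv hd _).ge h3) ?_
  have hpos : 1 ≤ p ^ (r + s - j) := Nat.one_le_pow _ _ hp.out.pos
  rw [Nat.cast_sub hpos]
  push_cast
  -- p^(i-j) d ≥ -e cc s
  have h4 : -(e * cc p r m s) ≤ (p : ℤ) ^ (r + s - j) * d := by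
    have h5 := Cj_pow p r m (show j ≤ r + s - 1 by omega)
    have h6 : Cj p r m (r + s - 1) = cc p r m s := by
      unfold Cj; congr 1; have := S.r1; omega
    rw [h6] at h5
    have h7 : r + s - j = (r + s - 1 - j) + 1 := by omega
    rw [h7, pow_succ]
    have h8 : (0 : ℤ) ≤ (p : ℤ) ^ (r + s - 1 - j) := by positivity
    have h9 := mul_le_mul_of_nonneg_left h2 h8
    have h10 := mul_le_mul_of_nonneg_left h5 he.le
    nlinarith
  nlinarith

theorem Stp.exists_y (S : Stp p k K hv e t D res X A n r m) (s : ℕ) (hs : r + s < n) (q : ℤ)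
    (P : PP (k := k) e D res X r m (wadj K X (r + s)) (wadj k (resW res X) r) s q) :
    ∃ c ∈ wadj K X (r + s), ∃ d : ℤ, v (X.coeff (r + s) - c) = (d : WithTop ℤ) ∧ d < 0 ∧ ¬ q ∣ d ∧
      v (D (X.coeff (r + s) - c)) = ((-(e * cc p r m (s + 1)) : ℤ) : WithTop ℤ) := by
  have he := S.e_pos
  have hq := P.qpos
  have hp2 : (2 : ℤ) ≤ p := by exact_mod_cast hp.out.two_le
  obtain ⟨hC, hn1, hn2⟩ := num_facts (r := r) (m := m) hp.out.two_le (S.A_r (by omega)) s he P.qpos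
  have hDx := S.D_Xi s hs q P
  have hgx := asw_g K X A (fun j _ => S.A_mem j) S.eq (r + s) hs
  have hbx := S.bX (r + s) hs
  have hCj : Cj p r m (r + s) = cc p r m (s + 1) := by unfold Cj; congr 1; omega
  rw [hCj] at hbx
  set x := X.coeff (r + s) with hxdef
  set F := wadj K X (r + s) with hF
  set C := e * cc p r m (s + 1) with hCdef
  set δ := e * cc p r m s - bb p r m s * q with hδ
  have good : ∀ c ∈ F, ((-C : ℤ) : WithTop ℤ) ≤ v (c ^ p) → v (D (x - c)) = ((-C : ℤ) : WithTop ℤ) ∧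
      ∃ d : ℤ, v (x - c) = (d : WithTop ℤ) ∧ d < 0 ∧ -C ≤ p * d := by
    intro c hc hcp
    have hDc : ((-C + 1 : ℤ) : WithTop ℤ) ≤ v (D c) := by
      rcases eq_or_ne c 0 with rfl | h0
      · rw [map_zero]; exact nv_ge_zero hv _
      obtain ⟨d, hd⟩ := nv_fin hv h0
      have h1 := nv_le_of (nv_pow hv hd p) hcp
      refine nv_mono (P.p2 c hc d hd.ge) ?_
      nlinarith
    have hDy : v (D (x - c)) = ((-C : ℤ) : WithTop ℤ) := by
      rw [map_sub]; exact nv_sub hv hDx hDc (by linarith)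
    refine ⟨hDy, ?_⟩
    have hy0 : x - c ≠ 0 := by
      intro h; rw [h, map_zero] at hDy; exact nv_ne hv hDy rfl
    obtain ⟨d, hd⟩ := nv_fin hv hy0
    have hyp : ((-C : ℤ) : WithTop ℤ) ≤ v ((x - c) ^ p) := by
      rw [sub_pow_char]; exact nv_ge_sub hv hbx hcp
    have h2 := nv_le_of (nv_pow hv hd p) hyp
    refine ⟨d, hd, ?_, h2⟩
    by_contra hd0
    have hgF : (x - c) ^ p - (x - c) ∈ F := by
      have : (x - c) ^ p - (x - c) = (x ^ p - x) - (c ^ p - c) := by rw [sub_pow_char]; ring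
      rw [this]; exact sub_mem hgx (sub_mem (pow_mem hc p) hc)
    have hgO : ((0 : ℤ) : WithTop ℤ) ≤ v ((x - c) ^ p - (x - c)) := by
      have h3 : ((0 : ℤ) : WithTop ℤ) ≤ v (x - c) := nv_ge_of hd (by linarith)
      exact nv_ge_sub hv (nv_ge0_pow hv h3 p) h3
    have h4 := P.p2 _ hgF 0 hgO
    have h5 : D ((x - c) ^ p - (x - c)) = - D (x - c) := by rw [map_sub, D_pow_p, zero_sub]
    rw [h5, nv_neg hv hDy] at h4
    have h6 : 0 - δ ≤ -C := by exact_mod_cast h4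
    nlinarith
  obtain ⟨d, ⟨c, hcF, hcp, hcd⟩, hmax⟩ := Int.exists_greatest_of_bdd
    (P := fun d => ∃ c ∈ F, ((-C : ℤ) : WithTop ℤ) ≤ v (c ^ p) ∧ v (x - c) = (d : WithTop ℤ))
    ⟨0, by
      rintro z ⟨c, hcF, hcp, hcd⟩
      obtain ⟨_, d, hd, hd0, _⟩ := good c hcF hcp
      rw [nv_inj hcd hd]; exact hd0.le⟩
    (by
      have h0 : ((-C : ℤ) : WithTop ℤ) ≤ v ((0 : L) ^ p) := by
        rw [zero_pow hp.out.ne_zero]; exact nv_ge_zero hv _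
      obtain ⟨_, d, hd, _⟩ := good 0 (zero_mem _) h0
      exact ⟨d, 0, zero_mem _, h0, hd⟩)
  obtain ⟨hDy, d', hd', hd0, hCd⟩ := good c hcF hcp
  obtain rfl := nv_inj hcd hd'
  refine ⟨c, hcF, d, hcd, hd0, ?_, hDy⟩
  rintro ⟨w, hw⟩
  obtain ⟨ϖ, hϖF, hϖ⟩ := P.p1'
  have hϖ0 := nv_ne hv hϖ
  have hgF : (x - c) ^ p - (x - c) ∈ F := by
    have : (x - c) ^ p - (x - c) = (x ^ p - x) - (c ^ p - c) := by rw [sub_pow_char]; ring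
    rw [this]; exact sub_mem hgx (sub_mem (pow_mem hcF p) hcF)
  have hvg := nv_as' hp.out.two_le hv hcd hd0
  have hϖw := nv_zpow hv hϖ w
  have hϖp := nv_pow hv hϖw p
  set g := (x - c) ^ p - (x - c) with hg
  set P' := (ϖ ^ w) ^ p with hP'
  have hP'0 : P' ≠ 0 := pow_ne_zero _ (zpow_ne_zero _ hϖ0)
  have hu := nv_mul hv hvg (nv_inv hv hϖp)
  have huO : g * P'⁻¹ ∈ valRing v hv := by
    rw [mem_valRing]; exact nv_ge_of hu (by rw [hw]; ring_nf; rfl)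
  have huF : g * P'⁻¹ ∈ F := mul_mem hgF (inv_mem (pow_mem (zpow_mem hϖF _) _))
  obtain ⟨h, hhF, hhO, hh⟩ := P.p3 _ huF huO
  rw [← map_pow, ← sub_eq_zero, ← map_sub, S.res_zero] at hh
  have hh' : ((1 : ℤ) : WithTop ℤ) ≤ v (g * P'⁻¹ - h ^ p) := hh
  have hgh := nv_ge_mul hv hh' hϖp.ge
  have e1 : (g * P'⁻¹ - h ^ p) * P' = g - (h * ϖ ^ w) ^ p := by
    rw [sub_mul, mul_assoc, inv_mul_cancel₀ hP'0, mul_one, mul_pow]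
  rw [e1] at hgh
  have hcF' : c + h * ϖ ^ w ∈ F := add_mem hcF (mul_mem hhF (zpow_mem hϖF _))
  have hcp' : ((-C : ℤ) : WithTop ℤ) ≤ v ((c + h * ϖ ^ w) ^ p) := by
    rw [add_pow_char, mul_pow]
    refine nv_ge_add hv hcp (nv_ge0_mul hv (nv_ge0_pow hv hhO p) (nv_ge_of hϖp ?_))
    rw [mul_comm w q, ← hw]; exact hCd
  obtain ⟨_, d2, hd2, hd20, _⟩ := good _ hcF' hcp'
  have hle := hmax d2 ⟨_, hcF', hcp', hd2⟩
  have e2 : (x - (c + h * ϖ ^ w)) ^ p = (g - (h * ϖ ^ w) ^ p) + (x - c) := by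
    rw [hg, ← sub_sub, sub_pow_char]; ring
  have hge : ((p * d + 1 : ℤ) : WithTop ℤ) ≤ v ((x - (c + h * ϖ ^ w)) ^ p) := by
    rw [e2]
    refine nv_ge_add hv (nv_mono hgh ?_) (nv_ge_of hcd ?_)
    · rw [hw]; linarith
    · nlinarith
  have := nv_le_of (nv_pow hv hd2 p) hge
  nlinarith

end Ram

section Ram2
open WittVector

variable {p : ℕ} [hp : Fact p.Prime] {k K L κ : Type*} [Field k] [Field K] [Field L]
    [Field κ] [Algebra K L] [Algebra k κ] [CharP L p] {v : L → WithTop ℤ} {hv : IsNormVal v} {e : ℤ} {t : L}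
    {D : Derivation ℤ L L} {res : valRing v hv →+* κ} {X A : WittVector p L} {n r : ℕ}
    {m : ℕ → ℤ}

theorem Stp.P_succ (S : Stp p k K hv e t D res X A n r m) (s : ℕ) (hs : r + s < n) (q : ℤ)
    (P : PP (k := k) e D res X r m (wadj K X (r + s)) (wadj k (resW res X) r) s q) :
    ∃ q', PP (k := k) e D res X r m (wadj K X (r + (s + 1))) (wadj k (resW res X) r) (s + 1) q' := by
  have he := S.e_pos
  have hq := P.qpos
  have hp2 : (2 : ℤ) ≤ p := by exact_mod_cast hp.out.two_le
  have hpz : Prime (p : ℤ) := Nat.prime_iff_prime_int.mp hp.out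
  have hm := S.A_r (by omega)
  obtain ⟨c, hcF, d, hd, hd0, hqd, hDy⟩ := S.exists_y s hs q P
  have hgx := asw_g K X A (fun j _ => S.A_mem j) S.eq (r + s) hs
  have hsp0 := wadj_succ K X (r + s) c hcF
  have hFF := wadj_mono K X (show r + s ≤ r + (s + 1) by omega)
  have hyF' : X.coeff (r + s) - c ∈ wadj K X (r + (s + 1)) :=
    sub_mem (wadj_mem K X (by omega)) (hFF hcF)
  have hgF : (X.coeff (r + s) - c) ^ p - (X.coeff (r + s) - c) ∈ wadj K X (r + s) := by
    have : (X.coeff (r + s) - c) ^ p - (X.coeff (r + s) - c) =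
      (X.coeff (r + s) ^ p - X.coeff (r + s)) - (c ^ p - c) := by rw [sub_pow_char]; ring
    rw [this]; exact sub_mem hgx (sub_mem (pow_mem hcF p) hcF)
  have hσy : ∀ σ : L ≃ₐ[K] L, (∀ z ∈ wadj K X (r + s), σ z = z) →
      σ (X.coeff (r + s) - c) - (X.coeff (r + s) - c) = σ (X.coeff (r + s)) - X.coeff (r + s) := by
    intro σ hσ; rw [map_sub, hσ c hcF]; ring
  have hqe := P.qe
  set y := X.coeff (r + s) - c with hydef
  set F := wadj K X (r + s) with hF
  have hspan : ∀ z ∈ wadj K X (r + (s + 1)), ∃ f : ℕ → L, (∀ l, f l ∈ (F : Set L)) ∧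
      z = ∑ l ∈ Finset.range p, f l * y ^ l := by
    intro z hz
    exact as_span F y hgF z (hsp0 z hz)
  have hvg := nv_as' hp.out.two_le hv hd hd0
  have hpq : (p : ℤ) ∣ q := by
    by_contra hpq
    have h1 := P.p1 _ hgF _ hvg
    have h2 : IsCoprime (p : ℤ) q := (hpz.coprime_iff_not_dvd).mpr hpq
    exact hqd (h2.symm.dvd_of_dvd_mul_left h1)
  obtain ⟨q', rfl⟩ := hpq
  have hq' : 0 < q' := by
    by_contra h; have : (p : ℤ) * q' ≤ 0 := by nlinarith
    omega
  have hdq : q' ∣ d := by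
    have h1 := P.p1 _ hgF _ hvg
    exact Int.dvd_of_mul_dvd_mul_left (by linarith) h1
  obtain ⟨β', rfl⟩ := hdq
  have hβ : ¬ (p : ℤ) ∣ β' := by
    rintro ⟨u, rfl⟩; exact hqd ⟨u, by ring⟩
  have hDg : v (D (y ^ p - y)) = ((-(e * cc p r m (s + 1)) : ℤ) : WithTop ℤ) := by
    rw [map_sub, D_pow_p, zero_sub]; exact nv_neg hv hDy
  have hng : ¬ (p : ℤ) * (p * q') ∣ p * (q' * β') := by
    rintro ⟨u, hu⟩
    apply hβ
    refine ⟨u, ?_⟩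
    have h1 : (p : ℤ) * q' ≠ 0 := by positivity
    apply mul_left_cancel₀ h1
    linarith
  have hbeta0 := nv_inj hDg (P.p2' _ hgF _ hvg hng)
  have hbeta : -β' = bb p r m (s + 1) := by
    rw [bb]
    have h1 : (p : ℤ) * q' ≠ 0 := by positivity
    apply mul_left_cancel₀ h1
    rw [← hqe] at hbeta0
    linarith
  have hF1 : ∀ f ∈ (F : Set L), ∀ c : ℤ, v f = (c : WithTop ℤ) → (p * q') ∣ c := P.p1
  have hβ0 : β' < 0 := by
    by_contra h; have := mul_nonneg hq'.le (not_lt.mp h); omega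
  -- D step
  have hDT := D_term (p := p) hv (F := (F : Set L)) (γ := -(e * cc p r m (s + 1) - bb p r m (s + 1) * q')) D hd
    (by
      intro f hf a ha
      refine nv_mono (P.p2 f hf a ha.ge) ?_
      rw [← hbeta]
      nlinarith) hDy (by rw [← hbeta]; ring)
  have hDS := span_T hv (F := (F : Set L)) rfl hq'.ne' hβ hd hF1
    (D : L →ₗ[ℤ] L).toAddMonoidHom hDT.1 hDT.2
  -- residues
  have hres : ∀ z ∈ wadj K X (r + (s + 1)), ∀ hz : z ∈ valRing v hv, ∃ f ∈ F,
      ∃ hf : f ∈ valRing v hv, res ⟨z, hz⟩ = res ⟨f, hf⟩ := by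
    intro z hz hzO
    by_cases h1 : ((1 : ℤ) : WithTop ℤ) ≤ v z
    · refine ⟨0, zero_mem _, zero_mem _, ?_⟩
      rw [(S.res_zero ⟨z, hzO⟩).mpr h1]
      exact (map_zero res).symm
    have hz0 : v z = ((0 : ℤ) : WithTop ℤ) := by
      obtain ⟨u, hu, hu1⟩ := nv_not_ge h1
      have := nv_le_of hu hzO
      rw [hu]; congr 1; omega
    obtain ⟨f, hf, rfl⟩ := hspan z hz
    obtain ⟨l₀, hl₀, u, hu, huz, hrest⟩ := span_val hv rfl hq'.ne' hβ hd hF1 f hf (nv_ne hv hz0)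
    obtain rfl := nv_inj huz hz0
    have hfl : f l₀ ≠ 0 := fun h => nv_ne hv hu (by rw [h, zero_mul])
    obtain ⟨a, ha⟩ := nv_fin hv hfl
    have h2 := nv_inj hu (nv_mul hv ha (nv_pow hv hd l₀))
    obtain ⟨b, rfl⟩ := hF1 _ (hf l₀) _ ha
    have h3 : (p : ℤ) ∣ l₀ * β' := by
      refine ⟨-b, ?_⟩
      apply mul_left_cancel₀ hq'.ne'
      linarith
    have h4 : l₀ = 0 := by
      rcases hpz.dvd_or_dvd h3 with h | h
      · have := Int.natCast_dvd_natCast.mp h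
        by_contra h5
        have := Nat.le_of_dvd (by omega) this
        omega
      · exact absurd h hβ
    subst h4
    rw [pow_zero, mul_one] at hu
    refine ⟨f 0, hf 0, hu.ge, ?_⟩
    rw [← sub_eq_zero, ← map_sub, S.res_zero]
    change ((1 : ℤ) : WithTop ℤ) ≤ v (∑ l ∈ Finset.range p, f l * y ^ l - f 0)
    rw [← Finset.add_sum_erase _ _ (Finset.mem_range.mpr hp.out.pos), pow_zero, mul_one,
      add_sub_cancel_left]
    refine nv_ge_sum hv _ _ fun l hl => ?_
    obtain ⟨hl1, hl2⟩ := Finset.mem_erase.mp hl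
    exact hrest l (Finset.mem_range.mp hl2) hl1
  refine ⟨q', ?_⟩
  constructor
  · exact hq'
  · rw [← hqe, pow_succ]; ring
  · intro z hz u hu
    obtain ⟨f, hf, rfl⟩ := hspan z hz
    obtain ⟨l₀, hl₀, u', hu', huz, hrest⟩ := span_val hv rfl hq'.ne' hβ hd hF1 f hf (nv_ne hv hu)
    obtain rfl := nv_inj huz hu
    have hfl : f l₀ ≠ 0 := fun h => nv_ne hv hu' (by rw [h, zero_mul])
    obtain ⟨a, ha⟩ := nv_fin hv hfl
    rw [nv_inj hu' (nv_mul hv ha (nv_pow hv hd l₀))]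
    obtain ⟨b, rfl⟩ := hF1 _ (hf l₀) _ ha
    exact ⟨p * b + l₀ * β', by ring⟩
  · obtain ⟨ϖ, hϖF, hϖ⟩ := P.p1'
    obtain ⟨a, b, hab⟩ := (hpz.coprime_iff_not_dvd).mpr hβ
    refine ⟨ϖ ^ a * y ^ b, mul_mem (zpow_mem (hFF hϖF) _) (zpow_mem hyF' _), ?_⟩
    rw [nv_mul hv (nv_zpow hv hϖ a) (nv_zpow hv hd b)]
    congr 1
    calc a * (p * q') + b * (q' * β') = q' * (a * p + b * β') := by ring
      _ = q' := by rw [hab, mul_one]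
  · intro z hz u hu
    obtain ⟨f, hf, rfl⟩ := hspan z hz
    have := (hDS f hf u).1 hu
    exact this
  · intro z hz u hu hnd
    obtain ⟨f, hf, rfl⟩ := hspan z hz
    exact (hDS f hf u).2 hu hnd
  · intro z hz hzO
    obtain ⟨f, hf, hfO, hf1⟩ := hres z hz hzO
    obtain ⟨h, hhF, hhO, hh⟩ := P.p3 f hf hfO
    exact ⟨h, hFF hhF, hhO, by rw [hf1, hh]⟩
  · intro z hz hzO
    obtain ⟨f, hf, hfO, hf1⟩ := hres z hz hzO
    rw [hf1]; exact P.p4 f hf hfO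
  · intro σ s' hs' hσF hσx z hz u
    have hb0 : 0 < bb p r m (s' + 1) :=
      lt_of_le_of_lt (bb_nonneg hp.out.two_le hm s') (bb_lt hp.out.two_le hm s')
    have key : (∀ f ∈ (F : Set L), ∀ a : ℤ, v f = (a : WithTop ℤ) →
        ((a + bb p r m (s' + 1) * q' + 1 : ℤ) : WithTop ℤ) ≤ v (σ f - f)) ∧
        v (σ y - y) = ((q' * β' + bb p r m (s' + 1) * q' : ℤ) : WithTop ℤ) := by
      rcases Nat.lt_succ_iff_lt_or_eq.mp hs' with h | rfl
      · constructor
        · intro f hf a ha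
          refine nv_mono (((P.p5 σ s' h hσF hσx f hf a).1) ha.ge) ?_
          have := mul_pos hb0 hq'
          nlinarith
        · have h1 := (P.p5 σ s' h hσF hσx _ hgF _).2 hvg hng
          have h2 : (σ y - y) ^ p - (σ y - y) = σ (y ^ p - y) - (y ^ p - y) := by
            rw [sub_pow_char, map_sub σ (y ^ p) y, map_pow]; ring
          have hlt : bb p r m (s' + 1) < bb p r m (s + 1) := bb_mono hp.out.two_le hm (by omega)
          obtain ⟨d', hd', hpd⟩ := nv_as hp.out.two_le hv h2 h1 (by
            have h3 : bb p r m (s' + 1) + β' < 0 := by linarith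
            have h4 : (0 : ℤ) < p * q' := by positivity
            nlinarith)
          rw [hd']
          congr 1
          apply mul_left_cancel₀ (show (p : ℤ) ≠ 0 by positivity)
          rw [hpd]; ring
      · constructor
        · intro f hf a ha
          rw [hσF f hf, sub_self]; exact nv_ge_zero hv _
        · have h2 : (σ y - y) ^ p = σ y - y := by
            have h3 : (σ y - y) ^ p - (σ y - y) = σ (y ^ p - y) - (y ^ p - y) := by
              rw [sub_pow_char, map_sub σ (y ^ p) y, map_pow]; ring
            rw [hσF _ hgF, sub_self, sub_eq_zero] at h3
            exact h3
          rw [nv_fix hp.out.two_le hv (by rw [hσy σ hσF]; exact sub_ne_zero.mpr hσx) h2]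
          congr 1
          rw [← hbeta]; ring
    have hST := sigma_term (p := p) hv (F := (F : Set L)) (σ : L →+* L) hd (mul_pos hb0 hq')
      key.1 key.2
    have hSS := span_T hv (F := (F : Set L)) rfl hq'.ne' hβ hd hF1
      ((σ : L →+* L).toAddMonoidHom - AddMonoidHom.id L) hST.1 hST.2
    obtain ⟨f, hf, rfl⟩ := hspan z hz
    exact hSS f hf u

theorem Stp.P [CharP k p] (S : Stp p k K hv e t D res X A n r m) (s : ℕ) (hs : r + s ≤ n) :
    ∃ q, PP (k := k) e D res X r m (wadj K X (r + s)) (wadj k (resW res X) r) s q := by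
  induction s with
  | zero => exact ⟨e, S.P_zero⟩
  | succ s ih =>
    obtain ⟨q, P⟩ := ih (by omega)
    exact S.P_succ s (by omega) q P

end Ram2

section Herbrand

/-- `x` is in the `s`-th region of the sequence `b`. -/
def InReg (N : ℕ) (b : ℕ → ℝ) (s : ℕ) (x : ℝ) : Prop :=
  s ≤ N ∧ b s < x ∧ (s = N ∨ x ≤ b (s + 1))

theorem inReg_exists (N : ℕ) (b : ℕ → ℝ) (h0 : b 0 = 0) (x : ℝ) (hx : 0 < x) :
    ∃ s, InReg N b s x := by
  refine ⟨Nat.findGreatest (fun s => b s < x) N, Nat.findGreatest_le N, ?_, ?_⟩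
  · exact Nat.findGreatest_spec (P := fun s => b s < x) (Nat.zero_le N) (by rwa [h0])
  · by_contra! hcon
    obtain ⟨h1, h2⟩ := hcon
    have h3 := Nat.findGreatest_le (P := fun s => b s < x) N
    exact Nat.findGreatest_is_greatest (P := fun s => b s < x) (Nat.lt_succ_self _)
      (by omega) h2

theorem inReg_unique {N : ℕ} {b : ℕ → ℝ} (hb : 0 < N → StrictMono b) {s s' : ℕ} {x : ℝ}
    (h : InReg N b s x) (h' : InReg N b s' x) : s = s' := by
  have aux : ∀ s s', InReg N b s x → InReg N b s' x → ¬ s < s' := by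
    rintro s s' ⟨h1, h2, h3⟩ ⟨h1', h2', h3'⟩ hlt
    have h4 : x ≤ b (s + 1) := h3.resolve_left (by omega)
    have h5 := (hb (by omega)).monotone (show s + 1 ≤ s' by omega)
    linarith
  have := aux s s' h h'
  have := aux s' s h' h
  omega

variable {p N : ℕ} {b c : ℕ → ℝ} {g : ℝ → ℝ}

theorem int_reg (hg : ∀ s x, InReg N b s x → g x = ((p : ℝ) ^ s)⁻¹) (s : ℕ) (hs : s ≤ N) (x : ℝ)
    (hx : b s ≤ x) (hx' : s = N ∨ x ≤ b (s + 1)) :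
    IntervalIntegrable g MeasureTheory.volume (b s) x ∧
      ∫ t in (b s)..x, g t = (x - b s) * ((p : ℝ) ^ s)⁻¹ := by
  have h1 : ∀ t ∈ Set.uIoc (b s) x, g t = ((p : ℝ) ^ s)⁻¹ := by
    intro t ht
    rw [Set.uIoc_of_le hx] at ht
    exact hg s t ⟨hs, ht.1, hx'.imp id (fun h => le_trans ht.2 h)⟩
  constructor
  · refine (intervalIntegrable_const (c := ((p : ℝ) ^ s)⁻¹)).congr ?_
    intro t ht
    exact (h1 t ht).symm
  · rw [intervalIntegral.integral_congr_ae (g := fun _ => ((p : ℝ) ^ s)⁻¹)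
      (Filter.Eventually.of_forall h1)]
    simp

theorem phi_b (hb0 : b 0 = 0) (hc0 : c 0 = 0) (hb : 0 < N → StrictMono b)
    (hbc : ∀ s, b (s + 1) - b s = (p : ℝ) ^ s * (c (s + 1) - c s)) (hp : 0 < p)
    (hg : ∀ s x, InReg N b s x → g x = ((p : ℝ) ^ s)⁻¹) (s : ℕ) (hs : s ≤ N) :
    IntervalIntegrable g MeasureTheory.volume 0 (b s) ∧ ∫ t in (0 : ℝ)..(b s), g t = c s := by
  induction s with
  | zero => rw [hb0, hc0]; simp
  | succ s ih =>
    obtain ⟨i1, i2⟩ := ih (by omega)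
    obtain ⟨j1, j2⟩ := int_reg hg s (by omega) (b (s + 1))
      ((hb (by omega)).monotone (Nat.le_succ s)) (Or.inr le_rfl)
    refine ⟨i1.trans j1, ?_⟩
    rw [← intervalIntegral.integral_add_adjacent_intervals i1 j1, i2, j2, hbc]
    have : (p : ℝ) ^ s ≠ 0 := by positivity
    field_simp
    ring

theorem phi_reg (hb0 : b 0 = 0) (hc0 : c 0 = 0) (hb : 0 < N → StrictMono b)
    (hbc : ∀ s, b (s + 1) - b s = (p : ℝ) ^ s * (c (s + 1) - c s)) (hp : 0 < p)
    (hg : ∀ s x, InReg N b s x → g x = ((p : ℝ) ^ s)⁻¹) (s : ℕ) (x : ℝ) (hx : InReg N b s x) :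
    ∫ t in (0 : ℝ)..x, g t = c s + (x - b s) * ((p : ℝ) ^ s)⁻¹ := by
  obtain ⟨i1, i2⟩ := phi_b hb0 hc0 hb hbc hp hg s hx.1
  obtain ⟨j1, j2⟩ := int_reg hg s hx.1 x hx.2.1.le hx.2.2
  rw [← intervalIntegral.integral_add_adjacent_intervals i1 j1, i2, j2]

theorem phi_inReg (hb0 : b 0 = 0) (hc0 : c 0 = 0) (hb : 0 < N → StrictMono b)
    (hbc : ∀ s, b (s + 1) - b s = (p : ℝ) ^ s * (c (s + 1) - c s)) (hp : 0 < p)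
    (hg : ∀ s x, InReg N b s x → g x = ((p : ℝ) ^ s)⁻¹) (s : ℕ) (x : ℝ) (hx : InReg N b s x) :
    InReg N c s (∫ t in (0 : ℝ)..x, g t) := by
  rw [phi_reg hb0 hc0 hb hbc hp hg s x hx]
  obtain ⟨h1, h2, h3⟩ := hx
  have hpos : (0 : ℝ) < ((p : ℝ) ^ s)⁻¹ := by positivity
  refine ⟨h1, ?_, h3.imp id fun h => ?_⟩
  · nlinarith
  · have h4 : (x - b s) * ((p : ℝ) ^ s)⁻¹ ≤ (b (s + 1) - b s) * ((p : ℝ) ^ s)⁻¹ :=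
      mul_le_mul_of_nonneg_right (by linarith) hpos.le
    rw [hbc] at h4
    have h5 : (p : ℝ) ^ s * (c (s + 1) - c s) * ((p : ℝ) ^ s)⁻¹ = c (s + 1) - c s := by
      have : (p : ℝ) ^ s ≠ 0 := by positivity
      field_simp
    linarith

theorem phi_surj (hb0 : b 0 = 0) (hc0 : c 0 = 0) (hb : 0 < N → StrictMono b)
    (hbc : ∀ s, b (s + 1) - b s = (p : ℝ) ^ s * (c (s + 1) - c s)) (hp : 0 < p)
    (hg : ∀ s x, InReg N b s x → g x = ((p : ℝ) ^ s)⁻¹) (u : ℝ) (hu : 0 < u) :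
    ∃ x ∈ Set.Ici (0 : ℝ), ∫ t in (0 : ℝ)..x, g t = u := by
  obtain ⟨s, h1, h2, h3⟩ := inReg_exists N c hc0 u hu
  have hpos : (0 : ℝ) < (p : ℝ) ^ s := by positivity
  have hreg : InReg N b s (b s + (u - c s) * (p : ℝ) ^ s) := by
    refine ⟨h1, by nlinarith, h3.imp id fun h => ?_⟩
    have := hbc s
    nlinarith
  refine ⟨_, ?_, (phi_reg hb0 hc0 hb hbc hp hg s _ hreg).trans ?_⟩
  · have hbs : 0 ≤ b s := by
      rcases Nat.eq_zero_or_pos s with rfl | h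
      · rw [hb0]
      · rw [← hb0]; exact (hb (by omega)).monotone (Nat.zero_le s)
    have := hreg.2.1
    exact le_trans hbs this.le
  · have : (p : ℝ) ^ s ≠ 0 := by positivity
    field_simp
    ring

/-- The abstract computation of upper ramification groups. -/
theorem upper_groups {F L : Type*} [Field F] [Field L] [Algebra F L] (v : L → WithTop ℤ) (π : L)
    (hb0 : b 0 = 0) (hc0 : c 0 = 0) (hb : 0 < N → StrictMono b) (hc : 0 < N → StrictMono c)
    (hbc : ∀ s, b (s + 1) - b s = (p : ℝ) ^ s * (c (s + 1) - c s)) (hp : 0 < p)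
    (H : ℕ → Set (L ≃ₐ[F] L)) (hcard : ∀ s ≤ N, (H s).ncard = p ^ (N - s))
    (h0 : ramGrp F v π 0 = H 0)
    (hH : ∀ s x, InReg N b s x → ramGrp F v π x = H s) :
    ∀ s u, InReg N c s u → upperRamGrp F v π u = H s := by
  intro s u hsu
  have hg : ∀ s x, InReg N b s x →
      ((ramGrp F v π x).ncard : ℝ) / ((ramGrp F v π 0).ncard : ℝ) = ((p : ℝ) ^ s)⁻¹ := by
    intro s x hx
    rw [h0, hH s x hx, hcard s hx.1, hcard 0 (Nat.zero_le _)]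
    push_cast
    rw [Nat.sub_zero]
    have h1 : (p : ℝ) ^ N = (p : ℝ) ^ (N - s) * (p : ℝ) ^ s := by
      rw [← pow_add]; congr 1; have := hx.1; omega
    rw [h1]
    have h2 : (p : ℝ) ^ (N - s) ≠ 0 := by positivity
    field_simp
  have hu : 0 < u := by
    have h1 : 0 ≤ c s := by
      rcases Nat.eq_zero_or_pos s with rfl | h
      · rw [hc0]
      · rw [← hc0]; exact (hc (by have := hsu.1; omega)).monotone (Nat.zero_le s)
    exact lt_of_le_of_lt h1 hsu.2.1
  have hex := phi_surj hb0 hc0 hb hbc hp hg u hu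
  have hmem : hhPsi F v π u ∈ Set.Ici (0 : ℝ) := Function.invFunOn_mem hex
  have heq : hhPhi F v π (hhPsi F v π u) = u := Function.invFunOn_eq hex
  unfold upperRamGrp
  set y := hhPsi F v π u with hy
  have hy0 : 0 < y := by
    rcases lt_or_eq_of_le (show (0 : ℝ) ≤ y from hmem) with h | h
    · exact h
    · rw [← h] at heq
      simp [hhPhi] at heq
      linarith
  obtain ⟨s', hs'⟩ := inReg_exists N b hb0 y hy0
  have h1 := phi_inReg hb0 hc0 hb hbc hp hg s' y hs'
  have heq' : ∫ t in (0 : ℝ)..y, ((ramGrp F v π t).ncard : ℝ) / ((ramGrp F v π 0).ncard : ℝ) = u := heq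
  rw [heq'] at h1
  rw [inReg_unique hc hsu h1]
  exact hH s' y hs'

theorem upper_breaks {F L : Type*} [Field F] [Field L] [Algebra F L] (v : L → WithTop ℤ) (π : L)
    (hb0 : b 0 = 0) (hc0 : c 0 = 0) (hb : 0 < N → StrictMono b) (hc : 0 < N → StrictMono c)
    (hbc : ∀ s, b (s + 1) - b s = (p : ℝ) ^ s * (c (s + 1) - c s)) (hp : 2 ≤ p)
    (H : ℕ → Set (L ≃ₐ[F] L)) (hcard : ∀ s ≤ N, (H s).ncard = p ^ (N - s))
    (h0 : ramGrp F v π 0 = H 0)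
    (hH : ∀ s x, InReg N b s x → ramGrp F v π x = H s) (u : ℝ) (hu : 0 < u) :
    IsUpperBreak F v π u ↔ ∃ i ∈ Finset.Icc 1 N, u = c i := by
  have hU := upper_groups v π hb0 hc0 hb hc hbc (by omega) H hcard h0 hH
  constructor
  · rintro ⟨-, h⟩
    obtain ⟨s, hs⟩ := inReg_exists N c hc0 u hu
    by_contra hcon
    have hsmall : ∃ ε > 0, InReg N c s (u + ε) := by
      obtain ⟨h1, h2, h3⟩ := hs
      rcases h3 with rfl | h3
      · exact ⟨1, one_pos, h1, by linarith, Or.inl rfl⟩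
      · rcases Nat.lt_or_ge s N with h4 | h4
        · have h5 : u ≠ c (s + 1) := fun h => hcon ⟨s + 1, Finset.mem_Icc.mpr ⟨by omega, by omega⟩, h⟩
          have h6 := lt_of_le_of_ne h3 h5
          exact ⟨c (s + 1) - u, by linarith, h1, by linarith, Or.inr (by linarith)⟩
        · exact ⟨1, one_pos, h1, by linarith, Or.inl (by omega)⟩
    obtain ⟨ε, hε, hsε⟩ := hsmall
    apply h ε hε
    rw [hU s _ hsε, hU s _ hs]
  · rintro ⟨i, hi, rfl⟩
    obtain ⟨hi1, hi2⟩ := Finset.mem_Icc.mp hi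
    obtain ⟨s, rfl⟩ : ∃ s, i = s + 1 := ⟨i - 1, by omega⟩
    refine ⟨hu.le, fun ε hε heq => ?_⟩
    have hs : InReg N c s (c (s + 1)) := ⟨by omega, hc (by omega) (Nat.lt_succ_self s), Or.inr le_rfl⟩
    obtain ⟨s', hs'⟩ := inReg_exists N c hc0 (c (s + 1) + ε) (by linarith)
    rw [hU s _ hs, hU s' _ hs'] at heq
    have h1 := congrArg Set.ncard heq
    rw [hcard s (by omega), hcard s' hs'.1] at h1
    have h2 := Nat.pow_right_injective hp h1
    have h3 : s' = s := by have := hs'.1; omega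
    subst h3
    rcases hs'.2.2 with h | h
    · omega
    · linarith

end Herbrand

section CCsup

theorem cc_attained {p r : ℕ} {m : ℕ → ℤ} (hm : 0 < m r) (i : ℕ) :
    ∃ j < i + 1, cc p r m (i + 1) = (p : ℤ) ^ (i - j) * m (r + j) := by
  induction i with
  | zero => exact ⟨0, by omega, by simp [cc, hm.le]⟩
  | succ i ih =>
    obtain ⟨j, hj, h⟩ := ih
    rw [cc]
    rcases max_cases (p * cc p r m (i + 1)) (m (r + (i + 1))) with ⟨h1, -⟩ | ⟨h1, -⟩
    · refine ⟨j, by omega, ?_⟩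
      rw [h1, h, show i + 1 - j = (i - j) + 1 by omega, pow_succ]; ring
    · exact ⟨i + 1, by omega, by rw [h1]; simp⟩

theorem cc_ge {p r : ℕ} {m : ℕ → ℤ} (i j : ℕ) (hj : j < i + 1) :
    (p : ℤ) ^ (i - j) * m (r + j) ≤ cc p r m (i + 1) := by
  induction i with
  | zero => obtain rfl : j = 0 := by omega
            simp [cc]
  | succ i ih =>
    rw [cc]
    rcases Nat.lt_succ_iff_lt_or_eq.mp hj with h | rfl
    · refine le_trans ?_ (le_max_left _ _)
      rw [show i + 1 - j = (i - j) + 1 by omega, pow_succ', mul_assoc]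
      exact mul_le_mul_of_nonneg_left (ih h) (by positivity)
    · simp

theorem cc_sup {p r : ℕ} {m : ℕ → ℤ} (hm : 0 < m r) (i : ℕ) (h : (Finset.range (i + 1)).Nonempty) :
    (Finset.range (i + 1)).sup' h (fun j => (p : ℝ) ^ (i + 1 - 1 - j) * (m (r + j) : ℝ)) =
      (cc p r m (i + 1) : ℝ) := by
  apply le_antisymm
  · refine Finset.sup'_le _ _ fun j hj => ?_
    rw [Nat.add_sub_cancel]
    exact_mod_cast cc_ge i j (Finset.mem_range.mp hj)
  · obtain ⟨j, hj, h1⟩ := cc_attained (p := p) hm i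
    refine Finset.le_sup'_of_le _ (Finset.mem_range.mpr hj) ?_
    rw [Nat.add_sub_cancel, h1]
    push_cast
    exact le_rfl

end CCsup

section Galois
open WittVector

variable {p : ℕ} [hp : Fact p.Prime] {k K L κ : Type*} [Field k] [Field K] [Field L]
    [Field κ] [Algebra K L] [Algebra k κ] [CharP L p] {v : L → WithTop ℤ} {hv : IsNormVal v} {e : ℤ} {t : L}
    {D : Derivation ℤ L L} {res : valRing v hv →+* κ} {X A : WittVector p L} {n r : ℕ}
    {m : ℕ → ℤ}

theorem fix_wadj (σ : L ≃ₐ[K] L) (i : ℕ) :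
    (∀ z ∈ wadj K X i, σ z = z) ↔ ∀ j < i, σ (X.coeff j) = X.coeff j := by
  constructor
  · intro h j hj
    exact h _ (wadj_mem K X hj)
  · intro h z hz
    have hle : wadj K X i ≤ IntermediateField.fixedField (Subgroup.zpowers σ) := by
      apply IntermediateField.adjoin_le_iff.mpr
      rintro z ⟨j, hj, rfl⟩
      rintro ⟨τ, hτ⟩
      have hst : Subgroup.zpowers σ ≤ MulAction.stabilizer (L ≃ₐ[K] L) (X.coeff j) := by
        rw [Subgroup.zpowers_le]
        exact h j hj
      exact hst hτ
    exact hle hz ⟨σ, Subgroup.mem_zpowers σ⟩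

theorem Stp.final_q [CharP k p] (S : Stp p k K hv e t D res X A n r m)
    (htop : wadj K X n = ⊤) (π : L) (hπ : v π = ((1 : ℤ) : WithTop ℤ)) :
    PP (k := k) e D res X r m (⊤ : IntermediateField K L) (wadj k (resW res X) r) (n - r) 1 := by
  have hrn := S.rn
  obtain ⟨q, P⟩ := S.P (n - r) (by omega)
  rw [show r + (n - r) = n by omega, htop] at P
  have h1 := P.p1 π trivial 1 hπ
  have : q = 1 := by
    have := P.qpos
    exact le_antisymm (Int.le_of_dvd one_pos h1) (by omega)
  rwa [this] at P

theorem Stp.final_e [CharP k p] (S : Stp p k K hv e t D res X A n r m)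
    (htop : wadj K X n = ⊤) (π : L) (hπ : v π = ((1 : ℤ) : WithTop ℤ)) :
    e = p ^ (n - r) := by
  have P := S.final_q htop π hπ
  rw [← P.qe, one_mul]

theorem Stp.final_f [CharP k p] (S : Stp p k K hv e t D res X A n r m)
    (htop : wadj K X n = ⊤) (π : L) (hπ : v π = ((1 : ℤ) : WithTop ℤ))
    (hres : Function.Surjective res) : Module.finrank k κ = p ^ r := by
  have P := S.final_q htop π hπ
  have h : wadj k (resW res X) r = ⊤ := by
    rw [eq_top_iff]
    intro y _
    obtain ⟨z, rfl⟩ := hres y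
    exact P.p4 z.1 trivial z.2
  have h2 := asw_finrank k (resW res X) (resW res A) S.res_A S.res_eq S.res_x0 r le_rfl
  rw [h, IntermediateField.finrank_top'] at h2
  exact h2

theorem Stp.not_inertia (S : Stp p k K hv e t D res X A n r m) (σ : L ≃ₐ[K] L)
    (h : ∃ j < r, σ (X.coeff j) ≠ X.coeff j) : ¬ InInertia v σ := by
  intro hI
  have h' : ∃ j, j < r ∧ σ (X.coeff j) ≠ X.coeff j := h
  obtain ⟨hj, hne⟩ := Nat.find_spec h'
  have hmin : ∀ i < Nat.find h', σ (X.coeff i) = X.coeff i := by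
    intro i hi
    have := Nat.find_min h' hi
    by_contra hc
    exact this ⟨by omega, hc⟩
  set j := Nat.find h'
  have hfix := (fix_wadj σ j).mpr hmin
  have hrn := S.rn
  have hg := hfix _ (asw_g K X A (fun j _ => S.A_mem j) S.eq j (by omega))
  have hw : (σ (X.coeff j) - X.coeff j) ^ p = σ (X.coeff j) - X.coeff j := by
    rw [sub_pow_char]
    rw [map_sub, map_pow] at hg
    linear_combination hg
  have h0 := nv_fix hp.out.two_le hv (sub_ne_zero.mpr hne) hw
  have h1 := hI (X.coeff j) (S.X_int j hj)
  have := nv_le_of h0 h1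
  omega

theorem Stp.wild [CharP k p] (S : Stp p k K hv e t D res X A n r m)
    (htop : wadj K X n = ⊤) (π : L) (hπ : v π = ((1 : ℤ) : WithTop ℤ)) (σ : L ≃ₐ[K] L)
    (s : ℕ) (hs : s < n - r) (hfix : ∀ j < r + s, σ (X.coeff j) = X.coeff j)
    (hne : σ (X.coeff (r + s)) ≠ X.coeff (r + s)) :
    InInertia v σ ∧ v (σ π - π) = ((1 + bb p r m (s + 1) : ℤ) : WithTop ℤ) := by
  have P := S.final_q htop π hπ
  have h5 := P.p5 σ s hs ((fix_wadj σ _).mpr hfix) hne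
  have hm := S.A_r (by omega)
  have hbp := bb_mono hp.out.two_le hm (Nat.succ_pos s)
  have hb0 : bb p r m 0 = 0 := rfl
  rw [hb0] at hbp
  constructor
  · intro z hz
    have := (h5 z trivial 0).1 hz
    refine nv_mono this ?_
    have : 0 < bb p r m (s + 1) := hbp
    omega
  · have := (h5 π trivial 1).2 hπ (by
      rw [mul_one]
      intro h
      have h2 := Int.le_of_dvd one_pos h
      have : (2 : ℤ) ≤ p := by exact_mod_cast hp.out.two_le
      omega)
    rwa [mul_one] at this

/-- Automorphisms fixing the `(r+s)`-th layer. -/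
def HH (K : Type*) {L : Type*} [Field K] [Field L] [Algebra K L] (X : WittVector p L) (r s : ℕ) :
    Set (L ≃ₐ[K] L) := {σ | ∀ j < r + s, σ (X.coeff j) = X.coeff j}

theorem Stp.tri [CharP k p] (S : Stp p k K hv e t D res X A n r m)
    (htop : wadj K X n = ⊤) (π : L) (hπ : v π = ((1 : ℤ) : WithTop ℤ)) (σ : L ≃ₐ[K] L) :
    (¬ InInertia v σ ∧ ∀ s, σ ∉ HH K X r s) ∨ σ = 1 ∨
    (∃ s < n - r, InInertia v σ ∧ v (σ π - π) = ((1 + bb p r m (s + 1) : ℤ) : WithTop ℤ) ∧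
      ∀ s', σ ∈ HH K X r s' ↔ s' ≤ s) := by
  have hrn := S.rn
  by_cases h1 : ∃ j < r, σ (X.coeff j) ≠ X.coeff j
  · left
    refine ⟨S.not_inertia σ h1, fun s hs => ?_⟩
    obtain ⟨j, hj, hne⟩ := h1
    exact hne (hs j (by omega))
  push Not at h1
  right
  by_cases h2 : ∃ s, s < n - r ∧ σ (X.coeff (r + s)) ≠ X.coeff (r + s)
  · right
    obtain ⟨hs, hne⟩ := Nat.find_spec h2
    have hmin : ∀ i < r + Nat.find h2, σ (X.coeff i) = X.coeff i := by
      intro i hi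
      rcases lt_or_ge i r with h | h
      · exact h1 i h
      have := Nat.find_min h2 (show i - r < Nat.find h2 by omega)
      by_contra hc
      exact this ⟨by omega, by rwa [show r + (i - r) = i by omega]⟩
    obtain ⟨hI, hv'⟩ := S.wild htop π hπ σ _ hs hmin hne
    refine ⟨_, hs, hI, hv', fun s' => ⟨fun h => ?_, fun h j hj => hmin j (by omega)⟩⟩
    by_contra hc
    exact hne (h _ (by omega))
  · left
    push Not at h2
    have hf : ∀ z ∈ wadj K X n, σ z = z := by
      rw [fix_wadj]
      intro j hj
      rcases lt_or_ge j r with h | h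
      · exact h1 j h
      · have := h2 (j - r) (by omega)
        rwa [show r + (j - r) = j by omega] at this
    ext z
    exact hf z (by rw [htop]; trivial)

theorem HH_card [CharP K p] [FiniteDimensional K L] [IsGalois K L]
    (hA : ∀ j < n, A.coeff j ∈ (algebraMap K L).range)
    (h : ∀ j < n, X.coeff j ^ p = (X + A).coeff j) (h0 : X.coeff 0 ∉ (algebraMap K L).range)
    (htop : wadj K X n = ⊤) (s : ℕ) (hs : r + s ≤ n) :
    (HH K X r s).ncard = p ^ (n - r - s) := by
  have d1 := asw_finrank K X A hA h h0 (r + s) hs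
  have d2 := asw_finrank K X A hA h h0 n le_rfl
  rw [htop, IntermediateField.finrank_top'] at d2
  have d3 := Module.finrank_mul_finrank K (wadj K X (r + s)) L
  have d4 := IsGalois.card_fixingSubgroup_eq_finrank (wadj K X (r + s))
  have hset : HH K X r s = ((wadj K X (r + s)).fixingSubgroup : Set (L ≃ₐ[K] L)) := by
    ext σ
    rw [SetLike.mem_coe, IntermediateField.mem_fixingSubgroup_iff, fix_wadj]
    rfl
  rw [hset, ← Nat.card_coe_set_eq]
  have : Nat.card ((wadj K X (r + s)).fixingSubgroup : Set (L ≃ₐ[K] L)) =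
    Module.finrank (wadj K X (r + s)) L := d4
  rw [this]
  rw [d1, d2] at d3
  have hpp : 0 < p ^ (r + s) := pow_pos hp.out.pos _
  apply Nat.eq_of_mul_eq_mul_left hpp
  rw [d3, ← pow_add]
  congr 1
  omega

theorem Stp.final_u [CharP k p] [CharP K p] [FiniteDimensional K L] [IsGalois K L]
    (S : Stp p k K hv e t D res X A n r m)
    (htop : wadj K X n = ⊤) (h0 : X.coeff 0 ∉ (algebraMap K L).range)
    (π : L) (hπ : v π = ((1 : ℤ) : WithTop ℤ)) (u : ℝ) (hu : 0 < u) :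
    IsUpperBreak K v π u ↔ ∃ i ∈ Finset.Icc 1 (n - r), u = (cc p r m i : ℝ) := by
  have hrn := S.rn
  have hone : ∀ x, (1 : L ≃ₐ[K] L) ∈ ramGrp K v π x := by
    intro x
    have : ∀ z : L, (1 : L ≃ₐ[K] L) z - z = 0 := fun z => sub_self z
    constructor
    · intro z _
      rw [this]; exact nv_ge_zero hv 1
    · rw [this]; exact nv_ge_zero hv _
  have honeH : ∀ s, (1 : L ≃ₐ[K] L) ∈ HH K X r s := fun s j _ => rfl
  refine upper_breaks (p := p) (N := n - r) (b := fun s => (bb p r m s : ℝ))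
    (c := fun s => (cc p r m s : ℝ)) v π ?_ ?_ ?_ ?_ ?_ hp.out.two_le (HH K X r) ?_ ?_ ?_ u hu
  · simp [bb]
  · simp [cc]
  · intro hN a b hab
    show ((_ : ℤ) : ℝ) < ((_ : ℤ) : ℝ)
    exact_mod_cast bb_mono hp.out.two_le (S.A_r (by omega)) hab
  · intro hN a b hab
    show ((_ : ℤ) : ℝ) < ((_ : ℤ) : ℝ)
    exact_mod_cast cc_mono hp.out.two_le (S.A_r (by omega)) hab
  · intro s
    simp only [bb]
    push_cast
    ring
  · intro s hs
    exact HH_card (fun j _ => S.A_mem j) S.eq h0 htop s (by omega)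
  · ext σ
    rcases S.tri htop π hπ σ with ⟨h1, h2⟩ | rfl | ⟨s, hs, hI, hval, hmem⟩
    · exact ⟨fun h => (h1 h.1).elim, fun h => (h2 _ h).elim⟩
    · exact ⟨fun _ => honeH _, fun _ => hone _⟩
    · refine ⟨fun _ => (hmem 0).mpr (Nat.zero_le _), fun _ => ⟨hI, ?_⟩⟩
      refine nv_ge_of hval ?_
      have := bb_mono hp.out.two_le (S.A_r (by omega)) (Nat.succ_pos s)
      have hb0 : bb p r m 0 = 0 := rfl
      rw [hb0] at this
      have : 0 < bb p r m (s + 1) := this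
      simp
      omega
  · intro s x hx
    ext σ
    rcases S.tri htop π hπ σ with ⟨h1, h2⟩ | rfl | ⟨s', hs, hI, hval, hmem⟩
    · exact ⟨fun h => (h1 h.1).elim, fun h => (h2 _ h).elim⟩
    · exact ⟨fun _ => honeH _, fun _ => hone _⟩
    · have hmono := (bb_mono hp.out.two_le (S.A_r (by omega)) : StrictMono (bb p r m)).monotone
      rw [hmem]
      obtain ⟨hx1, hx2, hx3⟩ := hx
      constructor
      · intro h
        by_contra hc
        have h3 := nv_le_of hval h.2
        rw [Int.ceil_le] at h3
        have h4 : bb p r m (s' + 1) ≤ bb p r m s := hmono (by omega)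
        have h5 : (bb p r m (s' + 1) : ℝ) ≤ bb p r m s := by exact_mod_cast h4
        push_cast at h3
        simp only at hx2
        linarith
      · intro h
        refine ⟨hI, nv_ge_of hval ?_⟩
        rw [Int.ceil_le]
        have h4 : bb p r m (s + 1) ≤ bb p r m (s' + 1) := hmono (by omega)
        have h5 : (bb p r m (s + 1) : ℝ) ≤ bb p r m (s' + 1) := by exact_mod_cast h4
        rcases hx3 with h6 | h6
        · omega
        · push_cast
          simp only at h6
          linarith

end Galois

section Fin
open WittVector

variable {p : ℕ} [hp : Fact p.Prime] {k K L : Type*} [Field k] [Field K] [Field L]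
    [Algebra K L] {ι : K ≃+* LaurentSeries k} {v : L → WithTop ℤ} {e : ℕ}

theorem lfVal_order {f : K} (hf : f ≠ 0) : lfVal ι f = (((ι f).order : ℤ) : WithTop ℤ) := by
  unfold lfVal lsVal
  rw [if_neg (by simpa using hf)]

theorem lfVal_zero : lfVal ι (0 : K) = ⊤ := by
  unfold lfVal lsVal
  rw [if_pos (by simp)]

theorem ext_order (he : ExtendsWithE (lfVal ι) v e) {f : K} (hf : f ≠ 0) :
    v (algebraMap K L f) = (((e : ℤ) * (ι f).order : ℤ) : WithTop ℤ) :=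
  he f _ (lfVal_order hf)

theorem ext_ge (hv : IsNormVal v) (he : ExtendsWithE (lfVal ι) v e) {f : K} {c : ℤ}
    (h : (c : WithTop ℤ) ≤ lfVal ι f) : (((e : ℤ) * c : ℤ) : WithTop ℤ) ≤ v (algebraMap K L f) := by
  by_cases hf : f = 0
  · subst hf; rw [map_zero]; exact nv_ge_zero hv _
  · rw [ext_order he hf]
    rw [lfVal_order hf] at h
    have h1 : c ≤ (ι f).order := by exact_mod_cast h
    have h2 : (e : ℤ) * c ≤ (e : ℤ) * (ι f).order := mul_le_mul_of_nonneg_left h1 (by positivity)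
    exact_mod_cast h2

theorem ext_ge' (he : ExtendsWithE (lfVal ι) v e) (he0 : 0 < e) {f : K} {c : ℤ} {d : ℤ}
    (h : (c : WithTop ℤ) ≤ v (algebraMap K L f)) (hd : (e : ℤ) * (d - 1) < c) :
    (d : WithTop ℤ) ≤ lfVal ι f := by
  by_cases hf : f = 0
  · subst hf; rw [lfVal_zero]; exact le_top
  · rw [ext_order he hf] at h
    rw [lfVal_order hf]
    have h1 : c ≤ (e : ℤ) * (ι f).order := by exact_mod_cast h
    have h2 : (e : ℤ) * (d - 1) < (e : ℤ) * (ι f).order := by omega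
    have h3 := lt_of_mul_lt_mul_left h2 (by positivity)
    have h4 : d ≤ (ι f).order := by omega
    exact_mod_cast h4

theorem e_posL [Algebra.IsAlgebraic K L] (hv : IsNormVal v) (he : ExtendsWithE (lfVal ι) v e) :
    0 < e := by
  rcases Nat.eq_zero_or_pos e with rfl | h
  · exfalso
    obtain ⟨π, hπ⟩ := hv.2.2.2
    have hIntg : IsIntegral K π⁻¹ := (Algebra.IsAlgebraic.isAlgebraic π⁻¹).isIntegral
    have h := nv_integral hv ((minpoly K π⁻¹).map (algebraMap K L)) ((minpoly.monic hIntg).map _)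
      (fun i => by
        rw [Polynomial.coeff_map]
        by_cases hf : (minpoly K π⁻¹).coeff i = 0
        · rw [hf, map_zero]; exact nv_ge_zero hv _
        · rw [ext_order he hf]; simp) (x := π⁻¹) (by
        rw [Polynomial.eval_map_algebraMap]; exact minpoly.aeval _ _)
    have := nv_le_of (nv_inv hv hπ) h
    omega
  · exact h

theorem valIdeal_max (hv : IsNormVal v) : (valIdeal v hv).IsMaximal := by
  rw [Ideal.isMaximal_iff]
  constructor
  · intro h
    have h1 : ((1 : ℤ) : WithTop ℤ) ≤ v 1 := h
    have := nv_le_of hv.val_one h1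
    omega
  · intro J x hJ hx hxJ
    have h0 : ((0 : ℤ) : WithTop ℤ) ≤ v x.1 := x.2
    have h1 : ¬ ((1 : ℤ) : WithTop ℤ) ≤ v x.1 := hx
    obtain ⟨d, hd, hlt⟩ := nv_not_ge h1
    have := nv_le_of hd h0
    have hd0 : d = 0 := by omega
    subst hd0
    have hi := nv_inv hv hd
    have hmem : x.1⁻¹ ∈ valRing v hv := by
      rw [mem_valRing, hi]; simp
    have : (1 : valRing v hv) = ⟨x.1⁻¹, hmem⟩ * x := by
      apply Subtype.ext
      simp [inv_mul_cancel₀ (nv_ne hv hd)]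
    rw [this]
    exact J.mul_mem_left _ hxJ

theorem main_L [CharP k p] [PerfectField k] [CharP K p] [FiniteDimensional K L] [IsGalois K L]
    (n : ℕ) (hn : 1 ≤ n) (A : WittVector p K) (X : WittVector p L)
    (hX : ∀ j < n, X.coeff j ^ p = (X + WittVector.map (algebraMap K L) A).coeff j)
    (htop : wadj K X n = ⊤)
    (hred : ∀ i < n, 0 ≤ lfVal ι (A.coeff i) ∨
      ∀ z : ℤ, lfVal ι (A.coeff i) = (z : WithTop ℤ) → ¬ (p : ℤ) ∣ z)
    (m : ℕ → ℤ) (hm : ∀ i < n, m i = -(ι (A.coeff i)).order)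
    (hwp : ¬ ∃ c : K, c ^ p - c = A.coeff 0)
    (r : ℕ) (hr1 : 1 ≤ r) (hr2 : r ≤ n)
    (hrle : ∀ i < r, 0 ≤ lfVal ι (A.coeff i))
    (hrmax : r = n ∨ (r < n ∧ lfVal ι (A.coeff r) < ((0 : ℤ) : WithTop ℤ)))
    (hv : IsNormVal v) (he : ExtendsWithE (lfVal ι) v e)
    (π : L) (hπ : v π = (1 : ℤ)) :
    e = p ^ (n - r) ∧ residueDegree ι v hv e he = p ^ r ∧ (r < n → 0 < m r) ∧
    ∀ u : ℝ, 0 < u →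
      (IsUpperBreak K v π u ↔ ∃ i ∈ Finset.Icc 1 (n - r), u = (cc p r m i : ℝ)) := by
  have hp0 := hp.out.pos
  have he0 : 0 < e := e_posL hv he
  haveI : CharP L p := charP_of_injective_algebraMap (algebraMap K L).injective p
  have hX0 : X.coeff 0 ^ p - X.coeff 0 = algebraMap K L (A.coeff 0) := by
    rw [hX 0 (by omega), add_coeff_zero, map_coeff]; ring
  have hnot : X.coeff 0 ∉ (algebraMap K L).range := by
    rintro ⟨b, hb⟩
    refine hwp ⟨b, (algebraMap K L).injective ?_⟩
    rw [map_sub, map_pow, hb, hX0]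
  obtain ⟨D, hD⟩ := exists_deriv (L := L) (eulerK ι)
  letI : Field (valRing v hv ⧸ valIdeal v hv) :=
    @Ideal.Quotient.field _ _ (valIdeal v hv) (valIdeal_max hv)
  letI : Algebra k (valRing v hv ⧸ valIdeal v hv) := (resHom ι v hv e he).toAlgebra
  have halg : ∀ c : k, ∃ hc, algebraMap k (valRing v hv ⧸ valIdeal v hv) c =
      Ideal.Quotient.mk (valIdeal v hv)
        ⟨algebraMap K L (ι.symm (HahnSeries.C c)), hc⟩ := fun c => ⟨_, rfl⟩
  have hez : (0 : ℤ) < e := by exact_mod_cast he0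
  have S : Stp p k K hv (e : ℤ) (algebraMap K L (tK ι)) D (Ideal.Quotient.mk (valIdeal v hv))
      X (WittVector.map (algebraMap K L) A) n r m := by
    constructor
    · exact hez
    · rw [he _ 1 (lfVal_tK ι), mul_one]
    · rw [hD, eulerK_tK]
    · exact ⟨_, rfl⟩
    · intro f hf
      exact ⟨_, ext_order he hf⟩
    · intro f hf
      rw [hD]
      have h1 := ext_ge' he he0 (d := 0) hf (by omega)
      have := ext_ge hv he (lfVal_eulerK ι f h1)
      rwa [mul_one] at this
    · intro f hf
      have h1 := ext_ge' he he0 (d := 0) hf (by omega)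
      have h2 := lfVal_res ι f h1
      haveI : ExpChar k p := ExpChar.prime hp.out
      haveI : PerfectRing k p := PerfectField.toPerfectRing p
      obtain ⟨d, hd⟩ := surjective_frobenius k p ((ι f).coeff 0)
      obtain ⟨hc, -⟩ := halg d
      refine ⟨ι.symm (HahnSeries.C d), hc, ?_⟩
      rw [← map_pow, ← map_pow, ← map_pow, ← map_sub]
      rw [frobenius_def] at hd
      rw [hd]
      exact nv_mono (ext_ge hv he h2) (by omega)
    · intro f hf
      have h1 := ext_ge' he he0 (d := 0) (mem_valRing.mp hf) (by omega)
      have h2 := lfVal_res ι f h1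
      obtain ⟨hc, h3⟩ := halg ((ι f).coeff 0)
      refine ⟨(ι f).coeff 0, ?_⟩
      · rw [h3, Ideal.Quotient.eq]
        show ((1 : ℤ) : WithTop ℤ) ≤ v (algebraMap K L f - algebraMap K L _)
        rw [← map_sub]
        exact nv_mono (ext_ge hv he h2) (by omega)
    · intro z
      rw [Ideal.Quotient.eq_zero_iff_mem]
      exact Iff.rfl
    · intro j
      rw [map_coeff]; exact ⟨_, rfl⟩
    · exact hX
    · exact hr1
    · exact hr2
    · intro j hj
      rw [map_coeff]
      have := ext_ge hv he (c := 0) (hrle j hj)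
      rwa [mul_zero] at this
    · intro j hj hjn
      rw [map_coeff]
      by_cases hf : A.coeff j = 0
      · left
        rw [hf, map_zero, hm j hjn, hf]
        exact ⟨nv_ge_zero hv _, by simp⟩
      · have ho := lfVal_order (ι := ι) hf
        have hmj := hm j hjn
        by_cases hpos : 0 < m j
        · right
          refine ⟨?_, hpos, ?_⟩
          · rw [ext_order he hf, hmj, neg_neg]
          · rcases hred j hjn with h | h
            · rw [ho] at h
              have : 0 ≤ (ι (A.coeff j)).order := by exact_mod_cast h
              omega
            · rw [hmj, dvd_neg]; exact h _ ho
        · left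
          refine ⟨?_, by omega⟩
          have h0 : ((0 : ℤ) : WithTop ℤ) ≤ lfVal ι (A.coeff j) := by
            rw [ho]; exact_mod_cast (by omega : 0 ≤ (ι (A.coeff j)).order)
          have := ext_ge hv he h0
          rwa [mul_zero] at this
    · intro hrn
      rcases hrmax with h | ⟨h, h'⟩
      · omega
      · have hf : A.coeff r ≠ 0 := by
          intro hf
          rw [hf, lfVal_zero] at h'
          exact absurd h' (by simp)
        rw [lfVal_order hf] at h'
        have : (ι (A.coeff r)).order < 0 := by exact_mod_cast h'
        rw [hm r hrn]; omega
    · rintro h ⟨c, hc⟩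
      obtain ⟨hcm, h3⟩ := halg c
      rw [h3, Ideal.Quotient.eq] at hc
      have hc1 : ((1 : ℤ) : WithTop ℤ) ≤ v (algebraMap K L (ι.symm (HahnSeries.C c)) - X.coeff 0) :=
        hc
      have h4 : ((1 : ℤ) : WithTop ℤ) ≤
          v (algebraMap K L (ι.symm (HahnSeries.C c) ^ p - ι.symm (HahnSeries.C c) - A.coeff 0)) := by
        have : algebraMap K L (ι.symm (HahnSeries.C c) ^ p - ι.symm (HahnSeries.C c) - A.coeff 0) =
          (algebraMap K L (ι.symm (HahnSeries.C c)) - X.coeff 0) ^ p -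
            (algebraMap K L (ι.symm (HahnSeries.C c)) - X.coeff 0) := by
          rw [sub_pow_char, map_sub, map_sub, map_pow, ← hX0]; ring
        rw [this]
        refine nv_ge_sub hv (nv_mono (nv_ge_pow hv hc1 p) ?_) hc1
        have : (1 : ℤ) ≤ p := by exact_mod_cast hp0
        omega
      have h5 := ext_ge' he he0 (d := 1) h4 (by omega)
      unfold lfVal at h5
      rw [lsVal_ge] at h5
      have h6 := h5 0 (by omega)
      rw [map_sub, map_sub, map_pow, RingEquiv.apply_symm_apply, ← map_pow, ← map_sub,
        HahnSeries.coeff_sub] at h6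
      have h7 : (HahnSeries.C (c ^ p - c) : LaurentSeries k).coeff 0 = c ^ p - c := by
        simp [HahnSeries.C_apply]
      rw [h7] at h6
      exact hwp (lfVal_hensel ι _ (hrle 0 (by omega)) c (sub_eq_zero.mp h6))
  refine ⟨?_, ?_, S.A_r, fun u hu => S.final_u htop hnot π hπ u hu⟩
  · exact_mod_cast S.final_e htop π hπ
  · exact S.final_f htop π hπ Ideal.Quotient.mk_surjective

end Fin

/-- Corollary 8 of the paper.  Let `K ≅ k((t))` be a local field of
characteristic `p > 0` with perfect residue field `k`, let `a ∈ W_n(K)` be reduced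
with `m_i = -v_K(a_i)`, `m_0 = 0` and `a_0 ∉ ℘(K)`.  Let `1 ≤ r ≤ n` be maximal with
`m_i ≤ 0` for `0 ≤ i < r`, and `K_n = K[a] = K(x_0, …, x_{n-1})` where
`F(x) = x ⊕ a`.  Then `K_n/K` is a `(ℤ/p^nℤ)`-extension (Galois, cyclic, of degree
`p^n`) with residue class degree `p^r` and ramification index `e = p^{n-r}`, and its
positive upper ramification breaks are exactly the numbers
`u_i = max{p^{i-1}m_r, …, p m_{r+i-2}, m_{r+i-1}}` for `1 ≤ i ≤ n-r`. -/
theorem stmt_7 {p : ℕ} [Fact p.Prime] (k : Type) [Field k] [PerfectField k] [CharP k p]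
    (K : Type) [Field K] [CharP K p] (ι : K ≃+* LaurentSeries k)
    (n : ℕ) (hn : 1 ≤ n) (a : TruncatedWittVector p n K)
    (hred : ∀ i : Fin n, 0 ≤ lfVal ι (a.coeff i) ∨
      ∀ z : ℤ, lfVal ι (a.coeff i) = (z : WithTop ℤ) → ¬ (p : ℤ) ∣ z)
    (m : ℕ → ℤ) (hm : ∀ i : Fin n, m (i : ℕ) = -(ι (a.coeff i)).order)
    (hm0 : lfVal ι (a.coeff ⟨0, by omega⟩) = ((0 : ℤ) : WithTop ℤ))
    (hwp : ¬ ∃ c : K, c ^ p - c = a.coeff ⟨0, by omega⟩)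
    (r : ℕ) (hr1 : 1 ≤ r) (hr2 : r ≤ n)
    (hrle : ∀ i : Fin n, (i : ℕ) < r → 0 ≤ lfVal ι (a.coeff i))
    (hrmax : r = n ∨ ∃ h : r < n, lfVal ι (a.coeff ⟨r, h⟩) < ((0 : ℤ) : WithTop ℤ))
    (x : TruncatedWittVector p n (SepCl K))
    (hx : wittF x = x + wittMap (algebraMap K (SepCl K)) a)
    (Kn : IntermediateField K (SepCl K))
    (hKn : Kn = IntermediateField.adjoin K {α : SepCl K | ∃ j : Fin n, x.coeff j = α})
    (v : Kn → WithTop ℤ) (hv : IsNormVal v) (e : ℕ) (he : ExtendsWithE (lfVal ι) v e)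
    (π : Kn) (hπ : v π = (1 : ℤ)) :
    IsGalois K Kn ∧
    IsCyclic (Kn ≃ₐ[K] Kn) ∧
    Module.finrank K Kn = p ^ n ∧
    e = p ^ (n - r) ∧
    residueDegree ι v hv e he = p ^ r ∧
    (∀ i, ∀ hi : i ∈ Finset.Icc 1 (n - r),
      0 < (Finset.range i).sup'
        (Finset.nonempty_range_iff.mpr (by have := (Finset.mem_Icc.mp hi).1; omega))
        (fun j => (p : ℝ) ^ (i - 1 - j) * (m (r + j) : ℝ))) ∧
    (∀ u' : ℝ, 0 < u' →
      (IsUpperBreak K v π u' ↔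
        ∃ i, ∃ hi : i ∈ Finset.Icc 1 (n - r),
          u' = (Finset.range i).sup'
            (Finset.nonempty_range_iff.mpr (by have := (Finset.mem_Icc.mp hi).1; omega))
            (fun j => (p : ℝ) ^ (i - 1 - j) * (m (r + j) : ℝ)))) := by
  have hmemx : ∀ j : Fin n, x.coeff j ∈ Kn := fun j => by
    rw [hKn]; exact IntermediateField.subset_adjoin _ _ ⟨j, rfl⟩
  set A : WittVector p K := WittVector.mk p (fun j => if h : j < n then a.coeff ⟨j, h⟩ else 0)
    with hAdef
  have hA : ∀ j (h : j < n), A.coeff j = a.coeff ⟨j, h⟩ := fun j h => by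
    simp [hAdef, h]
  set X : WittVector p Kn := WittVector.mk p
    (fun j => if h : j < n then ⟨x.coeff ⟨j, h⟩, hmemx _⟩ else 0) with hXdef
  have hXc : ∀ j (h : j < n), (X.coeff j : SepCl K) = x.coeff ⟨j, h⟩ := fun j h => by
    simp [hXdef, h]
  have hX : ∀ j < n, X.coeff j ^ p = (X + WittVector.map (algebraMap K Kn) A).coeff j := by
    intro j hj
    apply Subtype.val_injective
    have e1 : WittVector.truncate n (WittVector.map (algebraMap Kn (SepCl K)) X) = x := by
      ext i
      rw [WittVector.coeff_truncate, WittVector.map_coeff]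
      exact congrArg Subtype.val (hXc i i.2)
    have e2 : WittVector.truncate n (WittVector.map (algebraMap Kn (SepCl K))
        (WittVector.map (algebraMap K Kn) A)) = wittMap (algebraMap K (SepCl K)) a := by
      ext i
      rw [WittVector.coeff_truncate, WittVector.map_coeff, WittVector.map_coeff, hA i i.2, wittMap,
        TruncatedWittVector.coeff_mk]
      rfl
    have e3 := congrArg (TruncatedWittVector.coeff ⟨j, hj⟩) hx
    rw [← e2] at e3
    nth_rewrite 2 [← e1] at e3
    rw [← map_add, ← map_add, WittVector.coeff_truncate, WittVector.map_coeff, wittF,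
      TruncatedWittVector.coeff_mk] at e3
    have e4 : ((X.coeff j ^ p : Kn) : SepCl K) = x.coeff ⟨j, hj⟩ ^ p := by
      rw [← hXc j hj]; rfl
    exact e4.trans e3
  have htop : wadj K X n = ⊤ := by
    have hmap : (wadj K X n).map Kn.val = (⊤ : IntermediateField K Kn).map Kn.val := by
      rw [wadj, IntermediateField.adjoin_map, ← AlgHom.fieldRange_eq_map,
        IntermediateField.fieldRange_val]
      refine Eq.trans ?_ hKn.symm
      congr 1
      ext z
      constructor
      · rintro ⟨y, ⟨j, hj, rfl⟩, rfl⟩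
        exact ⟨⟨j, hj⟩, (hXc j hj).symm⟩
      · rintro ⟨j, rfl⟩
        exact ⟨_, ⟨j, j.2, rfl⟩, hXc j j.2⟩
    exact IntermediateField.map_injective Kn.val hmap
  have hA0 : A.coeff 0 = a.coeff ⟨0, by omega⟩ := hA 0 (by omega)
  have hwp' : ¬ ∃ c : K, c ^ p - c = A.coeff 0 := by rw [hA0]; exact hwp
  have hnot : X.coeff 0 ∉ (algebraMap K Kn).range := by
    rintro ⟨b, hb⟩
    refine hwp' ⟨b, (algebraMap K Kn).injective ?_⟩
    rw [map_sub, map_pow, hb, hX 0 (by omega), WittVector.add_coeff_zero, WittVector.map_coeff]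
    ring
  obtain ⟨hfd, hfr, hgal, hcyc⟩ := asw_main K hn X (WittVector.map (algebraMap K Kn) A)
    (fun j _ => by rw [WittVector.map_coeff]; exact ⟨_, rfl⟩) hX hnot
  rw [htop] at hfd hfr hgal hcyc
  rw [IntermediateField.finrank_top'] at hfr
  haveI : IsGalois K Kn := IsGalois.of_algEquiv IntermediateField.topEquiv
  haveI : FiniteDimensional K Kn :=
    FiniteDimensional.of_finrank_pos (by rw [hfr]; exact pow_pos (Fact.out (p := p.Prime)).pos _)
  have hcyc' : IsCyclic (Kn ≃ₐ[K] Kn) :=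
    isCyclic_of_surjective
      (AlgEquiv.autCongr (IntermediateField.topEquiv : (⊤ : IntermediateField K Kn) ≃ₐ[K] Kn))
      (AlgEquiv.autCongr _).surjective
  obtain ⟨h1, h2, h3, h4⟩ := main_L (ι := ι) n hn A X hX htop
    (fun i hi => by rw [hA i hi]; exact hred _) m (fun i hi => by rw [hA i hi]; exact hm ⟨i, hi⟩)
    hwp' r hr1 hr2 (fun i hi => by rw [hA i (by omega)]; exact hrle _ hi)
    (by
      rcases hrmax with h | ⟨h, h'⟩
      · exact Or.inl h
      · exact Or.inr ⟨h, by rw [hA r h]; exact h'⟩) hv he π hπ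
  have hp2 := (Fact.out (p := p.Prime)).two_le
  have key : ∀ i, ∀ hi : i ∈ Finset.Icc 1 (n - r), (Finset.range i).sup'
        (Finset.nonempty_range_iff.mpr (by have := (Finset.mem_Icc.mp hi).1; omega))
        (fun j => (p : ℝ) ^ (i - 1 - j) * (m (r + j) : ℝ)) = (cc p r m i : ℝ) := by
    intro i hi
    obtain ⟨hi1, hi2⟩ := Finset.mem_Icc.mp hi
    obtain ⟨s, rfl⟩ : ∃ s, i = s + 1 := ⟨i - 1, by omega⟩
    exact cc_sup (h3 (by omega)) s _
  refine ⟨inferInstance, hcyc', hfr, h1, h2, ?_, ?_⟩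
  · intro i hi
    rw [key i hi]
    obtain ⟨hi1, hi2⟩ := Finset.mem_Icc.mp hi
    obtain ⟨s, rfl⟩ : ∃ s, i = s + 1 := ⟨i - 1, by omega⟩
    exact_mod_cast cc_pos hp2 (h3 (by omega)) s
  · intro u hu
    rw [h4 u hu]
    constructor
    · rintro ⟨i, hi, rfl⟩
      exact ⟨i, hi, (key i hi).symm⟩
    · rintro ⟨i, hi, h⟩
      exact ⟨i, hi, h.trans (key i hi)⟩
end
end

section
/- For j ≥ 1 let f_j(X_0, Y_0) = S_j(X_0, 0, …, 0, Y_0, 0, …, 0) ∈ Z[X_0, Y_0] be the specialization of the j-th Witt addition polynomial with all variables other than X_0 and Y_0 set to 0. Then: (i) the coefficient of the monomial X_0 Y_0^{p^j - 1} in f_j is -1; (ii) the total degree of f_j is p^j; and (iii) the coefficient of Y_0^{p^j} in f_j is 0. -/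
noncomputable section

open MvPolynomial

/-- The specialization `f_j(X_0, Y_0) = S_j(X_0, 0, …, 0, Y_0, 0, …, 0)` of the `j`-th
Witt addition polynomial `S_j = WittVector.wittAdd p j`, with all variables other than
`X_0` (index `(0,0)`) and `Y_0` (index `(1,0)`) set to `0`.  The result is a polynomial
in `ℤ[X_0, Y_0] = MvPolynomial (Fin 2) ℤ`, with `X 0 ↔ X_0` and `X 1 ↔ Y_0`. -/
def wittAddSpec (p j : ℕ) [Fact p.Prime] : MvPolynomial (Fin 2) ℤ :=
  MvPolynomial.aeval
    (fun v : Fin 2 × ℕ =>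
      if v.2 = 0 then (MvPolynomial.X v.1 : MvPolynomial (Fin 2) ℤ) else 0)
    (WittVector.wittAdd p j)

lemma wittAddSpec_rel (p : ℕ) [Fact p.Prime] (n : ℕ) :
    ∑ i ∈ Finset.range (n + 1), C ((p : ℤ) ^ i) * wittAddSpec p i ^ p ^ (n - i)
      = (X 0 ^ p ^ n + X 1 ^ p ^ n : MvPolynomial (Fin 2) ℤ) := by
  have hp : p ≠ 0 := (Fact.out : p.Prime).ne_zero
  have key : ∀ k : Fin 2, aeval (fun v : Fin 2 × ℕ =>
      if v.2 = 0 then (X v.1 : MvPolynomial (Fin 2) ℤ) else 0)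
      (rename (Prod.mk k) (wittPolynomial p ℤ n)) = X k ^ p ^ n := by
    intro k
    rw [aeval_rename, wittPolynomial_eq_sum_C_mul_X_pow, map_sum, Finset.sum_range_succ',
      Finset.sum_eq_zero]
    · simp
    · intro i _
      simp [hp]
  have h := congrArg (aeval (fun v : Fin 2 × ℕ =>
      if v.2 = 0 then (X v.1 : MvPolynomial (Fin 2) ℤ) else 0))
      (wittStructureInt_prop p (X 0 + X 1 : MvPolynomial (Fin 2) ℤ) n)
  rw [map_add, bind₁_X_right, bind₁_X_right, map_add, key, key,
    wittPolynomial_eq_sum_C_mul_X_pow] at h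
  rw [← h, map_sum, map_sum]
  refine Finset.sum_congr rfl fun i _ => ?_
  simp only [map_mul, map_pow, bind₁_X_right, wittAddSpec, WittVector.wittAdd, bind₁_C_right,
    algHom_C, algebraMap_eq]

lemma wittAddSpec_rel' (p : ℕ) [Fact p.Prime] (n : ℕ) :
    C ((p : ℤ) ^ n) * wittAddSpec p n
      = (X 0 ^ p ^ n + X 1 ^ p ^ n : MvPolynomial (Fin 2) ℤ)
        - ∑ i ∈ Finset.range n, C ((p : ℤ) ^ i) * wittAddSpec p i ^ p ^ (n - i) := by
  rw [← wittAddSpec_rel, Finset.sum_range_succ]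
  simp

lemma wittAddSpec_zero (p : ℕ) [Fact p.Prime] :
    wittAddSpec p 0 = X 0 + X 1 := by
  simpa using wittAddSpec_rel p 0

lemma wittAddSpec_hom (p : ℕ) [Fact p.Prime] (n : ℕ) :
    (wittAddSpec p n).IsHomogeneous (p ^ n) := by
  induction n using Nat.strong_induction_on with
  | _ n ih =>
    have h : (C ((p : ℤ) ^ n) * wittAddSpec p n).IsHomogeneous (p ^ n) := by
      rw [wittAddSpec_rel']
      refine ((isHomogeneous_X_pow _ _).add (isHomogeneous_X_pow _ _)).sub ?_
      refine IsHomogeneous.sum _ _ _ fun i hi => ?_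
      have hi' := Finset.mem_range.1 hi
      have := ((ih i hi').pow (p ^ (n - i))).C_mul ((p : ℤ) ^ i)
      rwa [← pow_add, Nat.add_sub_cancel' hi'.le] at this
    intro d hd
    apply h
    rw [coeff_C_mul]
    exact mul_ne_zero (pow_ne_zero _ (by exact_mod_cast (Fact.out : p.Prime).ne_zero)) hd

lemma wittAddSpec_dvd (p : ℕ) [Fact p.Prime] (n : ℕ) :
    (X 0 : MvPolynomial (Fin 2) ℤ) ^ 2 ∣
      wittAddSpec p (n + 1) + X 0 * X 1 ^ (p ^ (n + 1) - 1) := by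
  induction n using Nat.strong_induction_on with
  | _ n ih =>
    have hp := (Fact.out : p.Prime)
    have two_le : ∀ k, 2 ≤ p ^ (k + 1) := fun k =>
      hp.two_le.trans (Nat.le_self_pow (by simp) p)
    have h := wittAddSpec_rel' p (n + 1)
    rw [Finset.sum_range_succ', wittAddSpec_zero] at h
    obtain ⟨k, hk⟩ := Polynomial.powAddExpansion (X 1 : MvPolynomial (Fin 2) ℤ) (X 0) (p ^ (n + 1))
    have hs : (X 0 : MvPolynomial (Fin 2) ℤ) ^ 2 ∣
        ∑ i ∈ Finset.range n, C ((p : ℤ) ^ (i + 1)) *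
          wittAddSpec p (i + 1) ^ p ^ (n + 1 - (i + 1)) := by
      refine Finset.dvd_sum fun i hi => Dvd.dvd.mul_left ?_ _
      have hi' := Finset.mem_range.1 hi
      have hx : (X 0 : MvPolynomial (Fin 2) ℤ) ∣ wittAddSpec p (i + 1) := by
        have h1 := (dvd_pow_self (X 0 : MvPolynomial (Fin 2) ℤ) two_ne_zero).trans (ih i hi')
        exact (dvd_add_left (Dvd.intro _ rfl)).1 h1
      obtain ⟨e, he⟩ : ∃ e, n + 1 - (i + 1) = e + 1 := ⟨n - i - 1, by omega⟩
      rw [he]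
      exact (pow_dvd_pow_of_dvd hx 2).trans (pow_dvd_pow _ (two_le e))
    apply (X_prime (i := (0 : Fin 2)) (R := ℤ)).pow_dvd_of_dvd_mul_left 2
      (a := C ((p : ℤ) ^ (n + 1)))
    · rw [← monomial_zero', X_dvd_monomial]
      simp [hp.ne_zero]
    · have e : C ((p : ℤ) ^ (n + 1)) *
          (wittAddSpec p (n + 1) + X 0 * X 1 ^ (p ^ (n + 1) - 1)) =
          X 0 ^ p ^ (n + 1) - (X 0 ^ 2 * k + ∑ i ∈ Finset.range n, C ((p : ℤ) ^ (i + 1)) *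
          wittAddSpec p (i + 1) ^ p ^ (n + 1 - (i + 1))) := by
        rw [mul_add, h, add_comm (X 0) (X 1 : MvPolynomial (Fin 2) ℤ), Nat.sub_zero, hk]
        simp only [pow_zero, map_one, map_pow, map_natCast, Nat.cast_pow]
        ring
      rw [e]
      exact dvd_sub (pow_dvd_pow _ (two_le n)) (dvd_add (Dvd.intro _ rfl) hs)

/-- For `j ≥ 1` let `f_j(X_0, Y_0) = S_j(X_0, 0, …, 0, Y_0, 0, …, 0)`.
Then: (i) the coefficient of `X_0 Y_0^{p^j - 1}` in `f_j` is `-1`; (ii) the total degree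
of `f_j` is `p^j`; (iii) the coefficient of `Y_0^{p^j}` in `f_j` is `0`. -/
theorem stmt_11 (p : ℕ) [Fact p.Prime] (j : ℕ) (hj : 1 ≤ j) :
    MvPolynomial.coeff
        (Finsupp.single (0 : Fin 2) 1 + Finsupp.single (1 : Fin 2) (p ^ j - 1))
        (wittAddSpec p j) = -1 ∧
    (wittAddSpec p j).totalDegree = p ^ j ∧
    MvPolynomial.coeff (Finsupp.single (1 : Fin 2) (p ^ j)) (wittAddSpec p j) = 0 := by
  obtain ⟨n, rfl⟩ : ∃ n, j = n + 1 := ⟨j - 1, by omega⟩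
  have hp2 : 2 ≤ p ^ (n + 1) :=
    (Fact.out : p.Prime).two_le.trans (Nat.le_self_pow (by simp) p)
  obtain ⟨g, hg⟩ := wittAddSpec_dvd p n
  have hm : (X 0 * X 1 ^ (p ^ (n + 1) - 1) : MvPolynomial (Fin 2) ℤ) =
      monomial (Finsupp.single (0 : Fin 2) 1 + Finsupp.single (1 : Fin 2) (p ^ (n + 1) - 1)) 1 := by
    rw [X_pow_eq_monomial, X, monomial_mul, one_mul]
  have hf : ∀ d : Fin 2 →₀ ℕ, d 0 < 2 → coeff d (wittAddSpec p (n + 1)) =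
      - coeff d (X 0 * X 1 ^ (p ^ (n + 1) - 1) : MvPolynomial (Fin 2) ℤ) := by
    intro d hd
    have h := congrArg (coeff d) hg
    rw [coeff_add, X_pow_eq_monomial (n := (0 : Fin 2)) (e := 2), coeff_monomial_mul', if_neg] at h
    · linarith
    · rw [Finsupp.single_le_iff]
      omega
  have h1 : coeff (Finsupp.single (0 : Fin 2) 1 + Finsupp.single (1 : Fin 2) (p ^ (n + 1) - 1))
        (wittAddSpec p (n + 1)) = -1 := by
    rw [hf _ (by simp), hm, coeff_monomial, if_pos rfl]
  refine ⟨h1, (wittAddSpec_hom p (n + 1)).totalDegree ?_, ?_⟩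
  · intro h0
    simp [h0] at h1
  · rw [hf _ (by simp), hm, coeff_monomial, if_neg, neg_zero]
    intro h
    have := DFunLike.congr_fun h 0
    simp at this
end
end
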